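/- Let m ≥ 3, n ≥ 1 and N ≥ 1. For every m-admissible pair (q,r), every index 1 ≤ α ≤ N and every u_0 ∈ L^2_x, the free N-body propagator on the waveguide satisfies the Lorentz-refined Strichartz estimate with frozen spatial variables ‖e^{itΔ_x} u_0‖_{L^q_t L^{r,2}_{y_α} L^2_{z_α} L^2_{x̂_α}} ≲ ‖u_0‖_{L^2_x}. -/

import Mathlib

/-!
Setting of Z. Zhao, "On Strichartz estimate for many body Schrödinger equations
in the waveguide setting": the waveguide manifold `ℝ^m × 𝕋^n`, the `N`-body
configuration space `(ℝ^m × 𝕋^n)^N`, the many body Schrödinger operator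
`H_N = Δ_x - ∑_{α<β} V(x_α - x_β)`, its propagator (characterized weakly),
iterated mixed Lebesgue/Lorentz norms, and Koch–Tataru `V^p`-spaces adapted to
the free propagator.
-/

noncomputable section
open MeasureTheory
open scoped ENNReal NNReal

namespace ManyBodyWaveguide

instance : Fact ((0:ℝ) < 1) := ⟨one_pos⟩

/-- The `n`-dimensional torus `𝕋^n`. -/
abbrev Torus (n : ℕ) := Fin n → AddCircle (1 : ℝ)

/-- The waveguide manifold `ℝ^m × 𝕋^n`, a point being `(y, z)`. -/
abbrev Wg (m n : ℕ) := (Fin m → ℝ) × Torus n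

/-- The configuration space `(ℝ^m × 𝕋^n)^N` of `N` particles. -/
abbrev Cfg (m n N : ℕ) := Fin N → Wg m n

/-- `L²_x = L²((ℝ^m × 𝕋^n)^N)`. -/
abbrev L2 (m n N : ℕ) := Lp ℂ 2 (volume : Measure (Cfg m n N))

/-- The unfolded (periodic) configuration space `(ℝ^m × ℝ^n)^N`. -/
abbrev CfgE (m n N : ℕ) := Fin N → ((Fin m → ℝ) × (Fin n → ℝ))

/-- Projection of the unfolded configuration space onto `(ℝ^m × 𝕋^n)^N`. -/
def fold (m n N : ℕ) : CfgE m n N → Cfg m n N :=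
  fun x α => ((x α).1, fun j => (((x α).2 j : ℝ) : AddCircle (1:ℝ)))

/-- The canonical lift of a configuration, using representatives in `[0,1)`. -/
def liftCfg (m n N : ℕ) : Cfg m n N → CfgE m n N :=
  fun x α => ((x α).1, fun j => (AddCircle.equivIco 1 0 ((x α).2 j)).1)

/-- Second directional derivative of `f` at `x` in direction `v`. -/
def secondDeriv {E F : Type*} [NormedAddCommGroup E] [NormedSpace ℝ E]
    [NormedAddCommGroup F] [NormedSpace ℝ F] (f : E → F) (x v : E) : F :=
  fderiv ℝ (fun y => fderiv ℝ f y v) x v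

/-- Coordinate vector in the Euclidean direction `i` of particle `α`. -/
def eY (m n N : ℕ) (α : Fin N) (i : Fin m) : CfgE m n N :=
  Pi.single α (Pi.single i (1:ℝ), 0)

/-- Coordinate vector in the periodic direction `j` of particle `α`. -/
def eZ (m n N : ℕ) (α : Fin N) (j : Fin n) : CfgE m n N :=
  Pi.single α (0, Pi.single j (1:ℝ))

/-- The Laplacian `Δ_x = ∑_α Δ_{x_α}` on the unfolded configuration space. -/
def laplacianE (m n N : ℕ) (f : CfgE m n N → ℂ) (x : CfgE m n N) : ℂ :=
  ∑ α : Fin N, ((∑ i : Fin m, secondDeriv f x (eY m n N α i)) +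
    (∑ j : Fin n, secondDeriv f x (eZ m n N α j)))

/-- The Laplacian `Δ_x` on `(ℝ^m × 𝕋^n)^N`, computed on the periodic unfolding. -/
def lap (m n N : ℕ) (φ : Cfg m n N → ℂ) : Cfg m n N → ℂ :=
  fun x => laplacianE m n N (φ ∘ fold m n N) (liftCfg m n N x)

/-- Test functions on `(ℝ^m × 𝕋^n)^N`: smooth (periodically unfolded) and
compactly supported. -/
def IsTest (m n N : ℕ) (φ : Cfg m n N → ℂ) : Prop :=
  ContDiff ℝ (⊤ : ℕ∞) (φ ∘ fold m n N) ∧ HasCompactSupport φ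

/-- `U` is the propagator `e^{-itH}` of `i∂_t u + H u = 0`, `H = Δ_x - W`, i.e.
a unitary group solving the equation in the weak (distributional) sense. -/
structure IsPropagator (m n N : ℕ) (W : Cfg m n N → ℝ)
    (U : ℝ → L2 m n N →L[ℂ] L2 m n N) : Prop where
  unitary : ∀ (t : ℝ) (f : L2 m n N), ‖U t f‖ = ‖f‖
  init : U 0 = ContinuousLinearMap.id ℂ (L2 m n N)
  group : ∀ s t : ℝ, U (s + t) = (U s).comp (U t)
  weak : ∀ (u0 : L2 m n N) (φ : Cfg m n N → ℂ), IsTest m n N φ → ∀ t : ℝ,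
    HasDerivAt (fun s : ℝ => ∫ x : Cfg m n N, φ x * (U s u0) x)
      (Complex.I * ∫ x : Cfg m n N,
        (lap m n N φ x - (W x : ℂ) * φ x) * (U t u0) x) t

/-- The total interaction potential `∑_{α<β} V(x_α - x_β)`. -/
def pairPot (m n N : ℕ) (V : Wg m n → ℝ) : Cfg m n N → ℝ :=
  fun x => ∑ p ∈ Finset.univ.filter (fun p : Fin N × Fin N => p.1 < p.2),
    V (x p.1 - x p.2)

/-- The `L^p` functional (`p = ∞` included) of an `ℝ≥0∞`-valued function. -/
def eN {α : Type*} [MeasurableSpace α] (p : ℝ≥0∞) (μ : Measure α)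
    (f : α → ℝ≥0∞) : ℝ≥0∞ :=
  if p = ∞ then essSup f μ else (∫⁻ a, f a ^ p.toReal ∂μ) ^ (1 / p.toReal)

/-- The decreasing rearrangement of an `ℝ≥0∞`-valued function. -/
def rearr {α : Type*} [MeasurableSpace α] (μ : Measure α) (f : α → ℝ≥0∞)
    (t : ℝ≥0∞) : ℝ≥0∞ :=
  sInf {lam : ℝ≥0∞ | μ {x | lam < f x} ≤ t}

/-- The Lorentz `L^{r,s}` (quasi-)norm of an `ℝ≥0∞`-valued function. -/
def lorentz {α : Type*} [MeasurableSpace α] (r s : ℝ≥0∞) (μ : Measure α)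
    (f : α → ℝ≥0∞) : ℝ≥0∞ :=
  if s = ∞ then ⨆ t : ℝ≥0∞, t ^ (1 / r.toReal) * rearr μ f t
  else (∫⁻ t in Set.Ioi (0:ℝ),
      (ENNReal.ofReal t ^ (1 / r.toReal) * rearr μ f (ENNReal.ofReal t)) ^ s.toReal /
        ENNReal.ofReal t) ^ (1 / s.toReal)

/-- `‖V‖_{L^{r,∞}_y L^2_z}` of a potential `V` on `ℝ^m × 𝕋^n`. -/
def potNorm (m n : ℕ) (r : ℝ≥0∞) (V : Wg m n → ℝ) : ℝ≥0∞ :=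
  lorentz r ∞ volume (fun y : Fin m → ℝ =>
    eLpNorm (fun z : Torus n => V (y, z)) 2 volume)

/-- The space of the remaining `N-1` particles `x̂_α`. -/
abbrev Hat (m n N : ℕ) (α : Fin N) := {β : Fin N // β ≠ α} → Wg m n

/-- Reassembling a configuration from the `α`-th particle and the others. -/
def glue (m n N : ℕ) (α : Fin N) (w : Wg m n) (h : Hat m n N α) : Cfg m n N :=
  fun β => if hβ : β = α then w else h ⟨β, hβ⟩

/-- The mixed norm `L^q_t L^{r,s}_{y_α} L^2_{z_α} L^2_{x̂_α}` (Lorentz in `y_α`). -/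
def frozenNormL {m n N : ℕ} (q r s : ℝ≥0∞) (α : Fin N)
    (u : ℝ → Cfg m n N → ℂ) : ℝ≥0∞ :=
  eN q volume fun t =>
    lorentz r s volume fun yα : Fin m → ℝ =>
      eN 2 volume fun zα : Torus n =>
        eLpNorm (fun h : Hat m n N α => u t (glue m n N α (yα, zα) h)) 2 volume

/-- The mixed norm `L^q_t L^r_{y_α} L^2_{z_α} L^2_{x̂_α}`. -/
def frozenNorm {m n N : ℕ} (q r : ℝ≥0∞) (α : Fin N)
    (u : ℝ → Cfg m n N → ℂ) : ℝ≥0∞ :=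
  eN q volume fun t =>
    eN r volume fun yα : Fin m → ℝ =>
      eN 2 volume fun zα : Torus n =>
        eLpNorm (fun h : Hat m n N α => u t (glue m n N α (yα, zα) h)) 2 volume

/-- The spatial mixed norm `L^r_{y_α} L^2_{z_α} L^2_{x̂_α}`. -/
def frozenSpatial {m n N : ℕ} (r : ℝ≥0∞) (α : Fin N)
    (u : Cfg m n N → ℂ) : ℝ≥0∞ :=
  eN r volume fun yα : Fin m → ℝ =>
    eN 2 volume fun zα : Torus n =>
      eLpNorm (fun h : Hat m n N α => u (glue m n N α (yα, zα) h)) 2 volume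

/-- The mixed norm `L^q_t L^r_y L^2_z`, `y ∈ ℝ^{mN}` and `z ∈ 𝕋^{nN}` being the
full Euclidean resp. torus variables. -/
def fullNorm {m n N : ℕ} (q r : ℝ≥0∞) (u : ℝ → Cfg m n N → ℂ) : ℝ≥0∞ :=
  eN q volume fun t =>
    eN r volume fun Y : Fin N → Fin m → ℝ =>
      eLpNorm (fun Z : Fin N → Torus n => u t (fun β => (Y β, Z β))) 2 volume

/-- `(q, r)` is a `k`-dimensional (Strichartz) admissible pair. -/
def Admissible (k : ℕ) (q r : ℝ≥0∞) : Prop :=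
  2 ≤ q ∧ 2 ≤ r ∧ 2 / q + (k : ℝ≥0∞) / r = (k : ℝ≥0∞) / 2 ∧
    ¬(q = 2 ∧ r = ∞ ∧ k = 2)

/-- The Koch–Tataru `V^p`-norm of a curve `u : ℝ → L²_x`, adapted to the free
propagator `U0 = e^{itΔ_x}`: the supremum over all finite increasing sequences
`t_0 < ⋯ < t_J` of `(∑_j ‖e^{-it_jΔ}u(t_j) - e^{-it_{j-1}Δ}u(t_{j-1})‖^p)^{1/p}`. -/
def vpNorm {m n N : ℕ} (p : ℝ) (U0 : ℝ → L2 m n N →L[ℂ] L2 m n N)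
    (u : ℝ → L2 m n N) : ℝ≥0∞ :=
  ⨆ (J : ℕ) (t : Fin (J + 1) → ℝ) (_ : StrictMono t),
    (∑ j : Fin J,
      (‖U0 (-(t j.succ)) (u (t j.succ)) -
        U0 (-(t j.castSucc)) (u (t j.castSucc))‖₊ : ℝ≥0∞) ^ p) ^ (1 / p)

/-- The Duhamel (retarded) integral `∫_0^t U(t-s) F(s) ds`, as a space-time
function. -/
def duhamel {m n N : ℕ} (U0 : ℝ → L2 m n N →L[ℂ] L2 m n N)
    (F : ℝ → L2 m n N) : ℝ → Cfg m n N → ℂ :=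
  fun t x => (∫ s in (0:ℝ)..t, U0 (t - s) (F s)) x

end ManyBodyWaveguide


namespace ManyBodyWaveguide
section PartOne
open Finset

/-- geometric sum over the integers -/
def rho : ℝ := (2:ℝ) ^ (-(1/8:ℝ))

lemma rho_pos : 0 < rho := by unfold rho; positivity
lemma rho_lt_one : rho < 1 := by
  unfold rho; exact Real.rpow_lt_one_of_one_lt_of_neg (by norm_num) (by norm_num)

lemma rho_summable : Summable (fun n : ℤ => rho ^ n.natAbs) := by
  apply Summable.of_nat_of_neg
  · simpa using summable_geometric_of_lt_one rho_pos.le rho_lt_one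
  · simpa using summable_geometric_of_lt_one rho_pos.le rho_lt_one

def rhoS : ℝ := ∑' n : ℤ, rho ^ n.natAbs

lemma rhoS_nonneg : 0 ≤ rhoS := tsum_nonneg fun _ => by have := rho_pos; positivity

lemma rho_sum_le {ι : Type*} (s : Finset ι) (f : ι → ℤ) (hf : Function.Injective f) :
    ∑ i ∈ s, rho ^ (f i).natAbs ≤ rhoS := by
  classical
  have : ∑ i ∈ s, rho ^ (f i).natAbs = ∑ n ∈ s.map ⟨f, hf⟩, rho ^ n.natAbs := by simp
  rw [this]
  exact rho_summable.sum_le_tsum _ (fun _ _ => by have := rho_pos; positivity)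

/-- dyadic distance -/
def dlog (i i' : ℤ) : ℕ := Nat.log 2 (i - i').natAbs

lemma dlog_comm (i i' : ℤ) : dlog i i' = dlog i' i := by
  unfold dlog; rw [← Int.natAbs_neg]; congr 2; ring

lemma pow_dlog_le {i i' : ℤ} (h : i ≠ i') : (2:ℝ) ^ dlog i i' ≤ |((i - i' : ℤ) : ℝ)| := by
  have : 2 ^ dlog i i' ≤ (i - i').natAbs := Nat.pow_log_le_self 2 (by omega)
  have h2 : ((2 ^ dlog i i' : ℕ) : ℝ) ≤ ((i - i').natAbs : ℝ) := by exact_mod_cast this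
  rw [Nat.cast_natAbs] at h2
  simpa using h2

lemma card_dlog_le (I : Finset ℤ) (i : ℤ) (l : ℕ) :
    ((I.filter (fun i' => i ≠ i' ∧ dlog i i' = l)).card : ℝ) ≤ 4 * 2 ^ l := by
  have : I.filter (fun i' => i ≠ i' ∧ dlog i i' = l) ⊆
      Finset.Ioo (i - 2 ^ (l+1)) (i + 2 ^ (l+1)) := by
    intro i' h
    simp only [mem_filter, mem_Ioo] at h ⊢
    obtain ⟨_, hne, h⟩ := h
    have h1 : (i - i').natAbs < 2 ^ (l+1) := by
      rw [← h]; exact Nat.lt_pow_succ_log_self (by norm_num) _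
    have h2 : ((i - i').natAbs : ℤ) < 2 ^ (l+1) := by exact_mod_cast h1
    omega
  have h := card_le_card this
  rw [Int.card_Ioo] at h
  have : (i + 2 ^ (l+1) - (i - 2 ^ (l+1)) - 1).toNat ≤ 4 * 2 ^ l := by
    have : (2:ℤ) ^ (l+1) = 2 * 2 ^ l := by ring
    rw [this]
    have : ((4 * 2 ^ l : ℕ) : ℤ) = 4 * 2 ^ l := by push_cast; ring
    omega
  exact_mod_cast h.trans this

/-- Schur bound for windows -/
lemma schur_window (I : Finset ℤ) (l : ℕ) (a b : ℤ → ℝ) :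
    ∑ i ∈ I, ∑ i' ∈ I.filter (fun i' => i ≠ i' ∧ dlog i i' = l), a i * b i'
      ≤ (4 * 2 ^ l) * (√(∑ i ∈ I, a i ^ 2) * √(∑ i ∈ I, b i ^ 2)) := by
  classical
  have key : ∀ c : ℤ → ℝ, ∑ i ∈ I, ∑ i' ∈ I.filter (fun i' => i ≠ i' ∧ dlog i i' = l), c i ^ 2
      ≤ (4 * 2 ^ l) * ∑ i ∈ I, c i ^ 2 := by
    intro c
    rw [mul_sum]
    apply sum_le_sum
    intro i _
    rw [sum_const, nsmul_eq_mul]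
    exact mul_le_mul_of_nonneg_right (card_dlog_le I i l) (sq_nonneg _)
  have key2 : ∑ i ∈ I, ∑ i' ∈ I.filter (fun i' => i ≠ i' ∧ dlog i i' = l), b i' ^ 2
      ≤ (4 * 2 ^ l) * ∑ i ∈ I, b i ^ 2 := by
    refine le_trans (le_of_eq ?_) (key b)
    simp_rw [sum_filter]
    rw [sum_comm]
    refine sum_congr rfl fun i _ => sum_congr rfl fun i' _ => ?_
    simp only [dlog_comm i i', ne_comm (a := i) (b := i')]
  simp_rw [sum_sigma'] at key key2 ⊢
  refine (Real.sum_mul_le_sqrt_mul_sqrt _ _ _).trans ?_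
  have hp : (0:ℝ) ≤ 4 * 2 ^ l := by positivity
  calc _ ≤ √((4 * 2 ^ l) * ∑ i ∈ I, a i ^ 2) * √((4 * 2 ^ l) * ∑ i ∈ I, b i ^ 2) := by
        gcongr
        · exact key a
    _ = _ := by
        rw [Real.sqrt_mul hp, Real.sqrt_mul hp]
        have := Real.mul_self_sqrt hp
        linear_combination (√(∑ i ∈ I, a i ^ 2) * √(∑ i ∈ I, b i ^ 2)) * this

/-- decompose double sum by dyadic distance -/
lemma dyadic_split {M : Type*} [AddCommMonoid M] (I : Finset ℤ) :
    ∃ L : ℕ, ∀ F : ℤ → ℤ → M, ∑ i ∈ I, ∑ i' ∈ I, F i i' =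
      ∑ i ∈ I, F i i + ∑ l ∈ range L, ∑ i ∈ I,
        ∑ i' ∈ I.filter (fun i' => i ≠ i' ∧ dlog i i' = l), F i i' := by
  classical
  refine ⟨(I ×ˢ I).sup (fun p => dlog p.1 p.2) + 1, fun F => ?_⟩
  rw [sum_comm (s := range _), ← sum_add_distrib]
  refine sum_congr rfl fun i hi => ?_
  have h1 : ∑ i' ∈ I, F i i' = F i i + ∑ i' ∈ I.filter (fun i' => i ≠ i'), F i i' := by
    rw [← add_sum_erase _ _ hi]
    congr 1
    refine sum_congr ?_ fun _ _ => rfl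
    ext x; simp [and_comm, eq_comm]
  rw [h1]; congr 1
  rw [← sum_fiberwise_of_maps_to (s := I.filter (fun i' => i ≠ i')) (g := fun i' => dlog i i')
    (t := range ((I ×ˢ I).sup (fun p => dlog p.1 p.2) + 1))]
  · simp_rw [filter_filter]
  · intro i' hi'
    simp only [mem_filter] at hi'
    rw [mem_range, Nat.lt_succ_iff]
    exact Finset.le_sup (f := fun p : ℤ × ℤ => dlog p.1 p.2) (b := (i, i')) (by simp [hi, hi'.1])

structure KT {H : Type*} [NormedAddCommGroup H] [InnerProductSpace ℂ H] (A : ℝ)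
    (w : ℤ → ℕ → H) (b : ℤ → ℕ → ℝ) : Prop where
  one_le : 1 ≤ A
  norm_le : ∀ i j, ‖w i j‖ ≤ b i j
  inner_le : ∀ i i' j k, i ≠ i' → ‖inner ℂ (w i j) (w i' k)‖ ≤
    A * ((2:ℝ) ^ ((j:ℝ) + k) / |((i - i' : ℤ) : ℝ)|) ^ (3/2:ℝ) * (b i j * b i' k)

variable {H : Type*} [NormedAddCommGroup H] [InnerProductSpace ℂ H] {A : ℝ}
    {w : ℤ → ℕ → H} {b : ℤ → ℕ → ℝ}

lemma KT.b_nonneg (h : KT A w b) (i : ℤ) (j : ℕ) : 0 ≤ b i j :=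
  (norm_nonneg _).trans (h.norm_le i j)

lemma KT.inner_le' (h : KT A w b) {i i' : ℤ} (hi : i ≠ i') (j k : ℕ) :
    ‖inner ℂ (w i j) (w i' k)‖ ≤
    A * (2:ℝ) ^ (3/2 * ((j:ℝ) + k - dlog i i')) * (b i j * b i' k) := by
  refine (h.inner_le i i' j k hi).trans ?_
  have h1 := h.b_nonneg i j
  have h2 := h.b_nonneg i' k
  have h3 : (0:ℝ) ≤ A := by linarith [h.one_le]
  refine mul_le_mul_of_nonneg_right (mul_le_mul_of_nonneg_left ?_ h3) (by positivity)
  have h4 : (0:ℝ) < 2 ^ dlog i i' := by positivity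
  calc ((2:ℝ) ^ ((j:ℝ) + k) / |((i - i' : ℤ) : ℝ)|) ^ (3/2:ℝ)
      ≤ ((2:ℝ) ^ ((j:ℝ) + k) / 2 ^ dlog i i') ^ (3/2:ℝ) := by
        gcongr; exact pow_dlog_le hi
    _ = _ := by
        rw [← Real.rpow_natCast 2, ← Real.rpow_sub (by norm_num), ← Real.rpow_mul (by norm_num)]
        congr 1; ring

/-- the `l²` norm in time -/
def bn (I : Finset ℤ) (b : ℤ → ℕ → ℝ) (j : ℕ) : ℝ := √(∑ i ∈ I, b i j ^ 2)

lemma bn_nonneg (I : Finset ℤ) (b : ℤ → ℕ → ℝ) (j : ℕ) : 0 ≤ bn I b j := Real.sqrt_nonneg _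
lemma bn_sq (I : Finset ℤ) (b : ℤ → ℕ → ℝ) (j : ℕ) : bn I b j ^ 2 = ∑ i ∈ I, b i j ^ 2 :=
  Real.sq_sqrt (sum_nonneg fun _ _ => sq_nonneg _)

/-- single scale bound, from dispersion -/
lemma KT.bound1 (h : KT A w b) (I : Finset ℤ) (l j k : ℕ) :
    ∑ i ∈ I, ∑ i' ∈ I.filter (fun i' => i ≠ i' ∧ dlog i i' = l), ‖inner ℂ (w i j) (w i' k)‖
      ≤ 4 * A * (2:ℝ) ^ (3/2 * ((j:ℝ) + k - l) + l) * (bn I b j * bn I b k) := by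
  have h3 : (0:ℝ) ≤ A := by linarith [h.one_le]
  calc _ ≤ ∑ i ∈ I, ∑ i' ∈ I.filter (fun i' => i ≠ i' ∧ dlog i i' = l),
        (A * (2:ℝ) ^ (3/2 * ((j:ℝ) + k - l))) * (b i j * b i' k) := by
        refine sum_le_sum fun i _ => sum_le_sum fun i' hi' => ?_
        simp only [mem_filter] at hi'
        have := h.inner_le' hi'.2.1 j k
        rwa [hi'.2.2] at this
    _ ≤ (A * (2:ℝ) ^ (3/2 * ((j:ℝ) + k - l))) * ((4 * 2 ^ l) * (bn I b j * bn I b k)) := by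
        have := schur_window I l (fun i => b i j) (fun i => b i k)
        refine le_trans (le_of_eq ?_) (mul_le_mul_of_nonneg_left this (by positivity))
        simp_rw [mul_sum]
    _ = _ := by
        rw [Real.rpow_add (by norm_num), Real.rpow_natCast]; ring

/-- single scale bound, trivial -/
lemma KT.bound0 (h : KT A w b) (I : Finset ℤ) (l j k : ℕ) :
    ∑ i ∈ I, ∑ i' ∈ I.filter (fun i' => i ≠ i' ∧ dlog i i' = l), ‖inner ℂ (w i j) (w i' k)‖
      ≤ 4 * (2:ℝ) ^ (l:ℝ) * (bn I b j * bn I b k) := by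
  calc _ ≤ ∑ i ∈ I, ∑ i' ∈ I.filter (fun i' => i ≠ i' ∧ dlog i i' = l), (b i j * b i' k) := by
        refine sum_le_sum fun i _ => sum_le_sum fun i' hi' => ?_
        exact (norm_inner_le_norm _ _).trans (mul_le_mul (h.norm_le _ _) (h.norm_le _ _)
          (norm_nonneg _) (h.b_nonneg _ _))
    _ ≤ _ := by
        rw [Real.rpow_natCast]
        exact schur_window I l (fun i => b i j) (fun i => b i k)

lemma rho_pow (n : ℕ) : rho ^ n = (2:ℝ) ^ (-(n:ℝ)/8) := by
  unfold rho
  rw [← Real.rpow_natCast, ← Real.rpow_mul (by norm_num)]; congr 1; ring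

/-- Strichartz type bound for one level -/
lemma KT.level (h : KT A w b) (I : Finset ℤ) (k : ℕ) :
    ‖∑ i ∈ I, w i k‖ ^ 2 ≤ (1 + 4 * A * rhoS) * (2:ℝ) ^ (2 * (k:ℝ)) * ∑ i ∈ I, b i k ^ 2 := by
  have h3 : (0:ℝ) ≤ A := by linarith [h.one_le]
  obtain ⟨L, hL⟩ := dyadic_split (M := ℝ) I
  have e1 : ‖∑ i ∈ I, w i k‖ ^ 2 ≤ ∑ i ∈ I, ∑ i' ∈ I, ‖inner ℂ (w i k) (w i' k)‖ := by
    rw [← inner_self_eq_norm_sq (𝕜 := ℂ), sum_inner]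
    simp_rw [inner_sum]
    refine (RCLike.re_le_norm _).trans ?_
    exact (norm_sum_le _ _).trans (sum_le_sum fun i _ => norm_sum_le _ _)
  rw [hL] at e1
  refine e1.trans ?_
  rw [add_mul, add_mul, one_mul]
  have hs : 0 ≤ ∑ i ∈ I, b i k ^ 2 := sum_nonneg fun _ _ => sq_nonneg _
  refine add_le_add ?_ ?_
  · have : ∑ i ∈ I, ‖inner ℂ (w i k) (w i k)‖ ≤ ∑ i ∈ I, b i k ^ 2 := by
      refine sum_le_sum fun i _ => ?_
      rw [sq]
      exact (norm_inner_le_norm _ _).trans (mul_le_mul (h.norm_le _ _) (h.norm_le _ _)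
          (norm_nonneg _) (h.b_nonneg _ _))
    refine this.trans (le_mul_of_one_le_left hs ?_)
    exact Real.one_le_rpow (by norm_num) (by positivity)
  · have : ∀ l ∈ range L, ∑ i ∈ I, ∑ i' ∈ I.filter (fun i' => i ≠ i' ∧ dlog i i' = l),
        ‖inner ℂ (w i k) (w i' k)‖ ≤
        rho ^ ((l:ℤ) - 2 * k).natAbs * (4 * A * (2:ℝ) ^ (2 * (k:ℝ)) * ∑ i ∈ I, b i k ^ 2) := by
      intro l _
      have b0 := h.bound0 I l k k
      have b1 := h.bound1 I l k k
      rw [← sq, bn_sq] at b0 b1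
      rw [rho_pow, Nat.cast_natAbs]
      have e : (2:ℝ) ^ (-(((|(l:ℤ) - 2 * k| : ℤ)) : ℝ) / 8) *
        (4 * A * (2:ℝ) ^ (2 * (k:ℝ)) * ∑ i ∈ I, b i k ^ 2) =
        4 * A * (2:ℝ) ^ (-(((|(l:ℤ) - 2 * k| : ℤ)) : ℝ) / 8 + 2 * k) * ∑ i ∈ I, b i k ^ 2 := by
        rw [Real.rpow_add (by norm_num)]; ring
      rw [e]
      push_cast
      rcases le_total (l:ℝ) (2 * k) with hc | hc
      · refine b0.trans (mul_le_mul_of_nonneg_right ?_ hs)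
        calc 4 * (2:ℝ) ^ (l:ℝ) ≤ 4 * (A * (2:ℝ) ^ (l:ℝ)) := by
              refine mul_le_mul_of_nonneg_left (le_mul_of_one_le_left (by positivity) h.one_le) ?_
              norm_num
          _ ≤ _ := by
              rw [← mul_assoc]
              refine mul_le_mul_of_nonneg_left ?_ (by positivity)
              apply Real.rpow_le_rpow_of_exponent_le (by norm_num)
              rw [abs_of_nonpos (by linarith)]; linarith
      · refine b1.trans (mul_le_mul_of_nonneg_right ?_ hs)
        refine mul_le_mul_of_nonneg_left ?_ (by positivity)
        apply Real.rpow_le_rpow_of_exponent_le (by norm_num)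
        rw [abs_of_nonneg (by linarith)]; linarith
    refine (sum_le_sum this).trans ?_
    rw [← sum_mul]
    calc _ ≤ rhoS * (4 * A * (2:ℝ) ^ (2 * (k:ℝ)) * ∑ i ∈ I, b i k ^ 2) := by
          refine mul_le_mul_of_nonneg_right ?_ (by positivity)
          exact rho_sum_le (range L) (fun l => (l:ℤ) - 2 * k) (fun x y hxy => by simpa using hxy)
      _ = _ := by ring

/-- single scale bound, from the level bound -/
lemma KT.bound2 (h : KT A w b) (I : Finset ℤ) (l j k : ℕ) :
    ‖∑ i ∈ I, ∑ i' ∈ I.filter (fun i' => i ≠ i' ∧ dlog i i' = l), inner ℂ (w i j) (w i' k)‖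
      ≤ √(4 * (1 + 4 * A * rhoS)) * (2:ℝ) ^ ((l:ℝ)/2 + k) * (bn I b j * bn I b k) := by
  have h3 : (0:ℝ) ≤ A := by linarith [h.one_le]
  have hr := rhoS_nonneg
  set K := 1 + 4 * A * rhoS with hK
  have hK0 : 0 ≤ K := by positivity
  set W : ℤ → Finset ℤ := fun i => I.filter (fun i' => i ≠ i' ∧ dlog i i' = l) with hW
  have e1 : ‖∑ i ∈ I, ∑ i' ∈ W i, inner ℂ (w i j) (w i' k)‖ ≤
      ∑ i ∈ I, b i j * ‖∑ i' ∈ W i, w i' k‖ := by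
    refine (norm_sum_le _ _).trans (sum_le_sum fun i _ => ?_)
    rw [← inner_sum]
    exact (norm_inner_le_norm _ _).trans (mul_le_mul_of_nonneg_right (h.norm_le _ _)
      (norm_nonneg _))
  refine e1.trans ((Real.sum_mul_le_sqrt_mul_sqrt _ _ _).trans ?_)
  have e2 : ∑ i ∈ I, ‖∑ i' ∈ W i, w i' k‖ ^ 2 ≤
      (4 * K) * ((2:ℝ) ^ ((l:ℝ)/2 + k)) ^ 2 * ∑ i ∈ I, b i k ^ 2 := by
    calc _ ≤ ∑ i ∈ I, K * (2:ℝ) ^ (2 * (k:ℝ)) * ∑ i' ∈ W i, b i' k ^ 2 :=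
          sum_le_sum fun i _ => h.level (W i) k
      _ = K * (2:ℝ) ^ (2 * (k:ℝ)) * ∑ i' ∈ I, ∑ i ∈ W i', b i' k ^ 2 := by
          rw [← mul_sum]; congr 1
          simp_rw [hW, sum_filter]
          rw [sum_comm]
          refine sum_congr rfl fun i _ => sum_congr rfl fun i' _ => ?_
          simp only [dlog_comm i i', ne_comm (a := i) (b := i')]
      _ ≤ K * (2:ℝ) ^ (2 * (k:ℝ)) * ∑ i' ∈ I, (4 * 2 ^ l) * b i' k ^ 2 := by
          refine mul_le_mul_of_nonneg_left (sum_le_sum fun i _ => ?_) (by positivity)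
          rw [sum_const, nsmul_eq_mul]
          exact mul_le_mul_of_nonneg_right (card_dlog_le I i l) (sq_nonneg _)
      _ = _ := by
          rw [← mul_sum, ← Real.rpow_natCast ((2:ℝ) ^ ((l:ℝ)/2 + k)), ← Real.rpow_mul (by norm_num),
            ← Real.rpow_natCast 2]
          have : ((l:ℝ)/2 + k) * ((2:ℕ):ℝ) = 2 * k + l := by push_cast; ring
          rw [this, Real.rpow_add (by norm_num)]; ring
  calc _ ≤ bn I b j * √((4 * K) * ((2:ℝ) ^ ((l:ℝ)/2 + k)) ^ 2 * ∑ i ∈ I, b i k ^ 2) :=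
        mul_le_mul_of_nonneg_left (Real.sqrt_le_sqrt e2) (bn_nonneg _ _ _)
    _ = _ := by
        rw [Real.sqrt_mul (by positivity), Real.sqrt_mul (by positivity),
          Real.sqrt_sq (by positivity), bn, bn]; ring

lemma KT.bound3 (h : KT A w b) (I : Finset ℤ) (l j k : ℕ) :
    ‖∑ i ∈ I, ∑ i' ∈ I.filter (fun i' => i ≠ i' ∧ dlog i i' = l), inner ℂ (w i j) (w i' k)‖
      ≤ √(4 * (1 + 4 * A * rhoS)) * (2:ℝ) ^ ((l:ℝ)/2 + j) * (bn I b j * bn I b k) := by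
  have := h.bound2 I l k j
  rw [mul_comm (bn I b k)] at this
  refine le_trans (le_of_eq ?_) this
  rw [← RCLike.norm_conj, map_sum]
  simp_rw [map_sum, inner_conj_symm, sum_filter]
  rw [sum_comm]
  congr 1
  refine sum_congr rfl fun i _ => sum_congr rfl fun i' _ => ?_
  simp only [dlog_comm i i', ne_comm (a := i) (b := i')]

lemma KT.bound (h : KT A w b) (I : Finset ℤ) (l j k : ℕ) :
    (2:ℝ) ^ (-(j:ℝ) - k) *
    ‖∑ i ∈ I, ∑ i' ∈ I.filter (fun i' => i ≠ i' ∧ dlog i i' = l), inner ℂ (w i j) (w i' k)‖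
      ≤ (4 * (1 + 4 * A * rhoS)) * (rho ^ ((l:ℤ) - 2 * j).natAbs * bn I b j) *
        (rho ^ ((l:ℤ) - 2 * k).natAbs * bn I b k) := by
  have h3 : (0:ℝ) ≤ A := by linarith [h.one_le]
  have hr := rhoS_nonneg
  have hS1 : 1 ≤ rhoS := by
    have := rho_summable.sum_le_tsum {0} (fun _ _ => by have := rho_pos; positivity)
    simpa [rhoS] using this
  set K := 4 * (1 + 4 * A * rhoS) with hK
  have hK1 : 1 ≤ K := by nlinarith [mul_nonneg h3 hr]
  have hKs : √K ≤ K := by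
    rw [Real.sqrt_le_left (by linarith)]; nlinarith
  have hKA : 4 * A ≤ K := by nlinarith
  have hB : 0 ≤ bn I b j * bn I b k := mul_nonneg (bn_nonneg _ _ _) (bn_nonneg _ _ _)
  have b1 := (norm_sum_le_of_le I (fun i _ => norm_sum_le _ _)).trans (h.bound1 I l j k)
  have b2 := h.bound2 I l j k
  have b3 := h.bound3 I l j k
  rw [← hK] at b2 b3
  generalize ‖∑ i ∈ I, ∑ i' ∈ I.filter (fun i' => i ≠ i' ∧ dlog i i' = l),
    inner ℂ (w i j) (w i' k)‖ = T at b1 b2 b3 ⊢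
  have red : ∀ x c : ℝ, 0 ≤ c → c ≤ K → T ≤ c * (2:ℝ) ^ x * (bn I b j * bn I b k) →
      x - j - k ≤ -|(l:ℝ) - 2 * j| / 8 + -|(l:ℝ) - 2 * k| / 8 →
      (2:ℝ) ^ (-(j:ℝ) - k) * T ≤ K * (rho ^ ((l:ℤ) - 2 * j).natAbs * bn I b j) *
        (rho ^ ((l:ℤ) - 2 * k).natAbs * bn I b k) := by
    intro x c hc hcK hT hx
    have e : K * (rho ^ ((l:ℤ) - 2 * j).natAbs * bn I b j) *
        (rho ^ ((l:ℤ) - 2 * k).natAbs * bn I b k) =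
        K * (2:ℝ) ^ (-|(l:ℝ) - 2 * j| / 8 + -|(l:ℝ) - 2 * k| / 8) * (bn I b j * bn I b k) := by
      rw [rho_pow, rho_pow, Nat.cast_natAbs, Nat.cast_natAbs, Real.rpow_add (by norm_num)]
      push_cast; ring
    rw [e]
    calc _ ≤ (2:ℝ) ^ (-(j:ℝ) - k) * (c * (2:ℝ) ^ x * (bn I b j * bn I b k)) :=
          mul_le_mul_of_nonneg_left hT (by positivity)
      _ = c * (2:ℝ) ^ (x - j - k) * (bn I b j * bn I b k) := by
          have : x - j - k = (-(j:ℝ) - k) + x := by ring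
          rw [this, Real.rpow_add (by norm_num)]; ring
      _ ≤ _ := by
          refine mul_le_mul_of_nonneg_right ?_ hB
          refine mul_le_mul hcK ?_ (by positivity) (by linarith)
          exact Real.rpow_le_rpow_of_exponent_le (by norm_num) hx
  have hcase : (3/2 * ((j:ℝ) + k - l) + l - j - k ≤ -|(l:ℝ) - 2 * j| / 8 + -|(l:ℝ) - 2 * k| / 8) ∨
      ((l:ℝ)/2 + k - j - k ≤ -|(l:ℝ) - 2 * j| / 8 + -|(l:ℝ) - 2 * k| / 8) ∨
      ((l:ℝ)/2 + j - j - k ≤ -|(l:ℝ) - 2 * j| / 8 + -|(l:ℝ) - 2 * k| / 8) := by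
    by_contra! hcon
    obtain ⟨h1, h2, h3⟩ := hcon
    rcases abs_cases ((l:ℝ) - 2 * j) with ⟨h5, h6⟩ | ⟨h5, h6⟩ <;>
      rcases abs_cases ((l:ℝ) - 2 * k) with ⟨h7, h8⟩ | ⟨h7, h8⟩ <;>
      rw [h5, h7] at h1 h2 h3 <;> linarith
  rcases hcase with hc | hc | hc
  · exact red _ _ (by positivity) hKA b1 hc
  · exact red _ _ (by positivity) hKs b2 hc
  · exact red _ _ (by positivity) hKs b3 hc

lemma sum_sq_swap {ι κ : Type*} (I : Finset ι) (J : Finset κ) (g : ι → κ → ℝ) :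
    ∑ j ∈ J, ∑ k ∈ J, ∑ i ∈ I, g i j * g i k = ∑ i ∈ I, (∑ j ∈ J, g i j) ^ 2 := by
  simp_rw [sq, sum_mul_sum]
  rw [sum_comm (s := I)]
  refine sum_congr rfl fun j _ => ?_
  rw [sum_comm]

/-- **Discrete endpoint Keel-Tao lemma.** -/
lemma KT.main (h : KT A w b) (I : Finset ℤ) (J : Finset ℕ) :
    ‖∑ j ∈ J, ∑ i ∈ I, ((2:ℝ) ^ (-(j:ℝ)) : ℝ) • w i j‖ ^ 2 ≤
      (2 + 4 * (1 + 4 * A * rhoS) * rhoS ^ 2) * ∑ j ∈ J, ∑ i ∈ I, b i j ^ 2 := by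
  have h3 : (0:ℝ) ≤ A := by linarith [h.one_le]
  have hr := rhoS_nonneg
  have hrp := rho_pos
  obtain ⟨L, hL⟩ := dyadic_split (M := ℂ) I
  set K := 4 * (1 + 4 * A * rhoS) with hK
  have hK0 : 0 ≤ K := by positivity
  have e0 : ∀ j k : ℕ, inner ℂ (∑ i ∈ I, ((2:ℝ) ^ (-(j:ℝ)) : ℝ) • w i j)
      (∑ i ∈ I, ((2:ℝ) ^ (-(k:ℝ)) : ℝ) • w i k) =
      (((2:ℝ) ^ (-(j:ℝ) - k) : ℝ) : ℂ) * ∑ i ∈ I, ∑ i' ∈ I, inner ℂ (w i j) (w i' k) := by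
    intro j k
    rw [sub_eq_add_neg, Real.rpow_add (by norm_num)]
    rw [sum_inner, mul_sum]
    refine sum_congr rfl fun i _ => ?_
    rw [inner_sum, mul_sum]
    refine sum_congr rfl fun i' _ => ?_
    rw [← Complex.coe_smul, ← Complex.coe_smul, inner_smul_left, inner_smul_right, Complex.conj_ofReal]
    push_cast; ring
  have e1 : ‖∑ j ∈ J, ∑ i ∈ I, ((2:ℝ) ^ (-(j:ℝ)) : ℝ) • w i j‖ ^ 2 ≤
      ∑ j ∈ J, ∑ k ∈ J, (2:ℝ) ^ (-(j:ℝ) - k) * ‖∑ i ∈ I, ∑ i' ∈ I, inner ℂ (w i j) (w i' k)‖ := by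
    rw [← inner_self_eq_norm_sq (𝕜 := ℂ), sum_inner]
    simp_rw [inner_sum]
    refine (RCLike.re_le_norm _).trans ?_
    refine (norm_sum_le _ _).trans (sum_le_sum fun j _ => (norm_sum_le _ _).trans
      (sum_le_sum fun k _ => ?_))
    rw [← inner_sum, e0, norm_mul, Complex.norm_real, Real.norm_of_nonneg (by positivity)]
  have e2 : ∀ j k : ℕ, (2:ℝ) ^ (-(j:ℝ) - k) * ‖∑ i ∈ I, ∑ i' ∈ I, inner ℂ (w i j) (w i' k)‖ ≤
      ∑ i ∈ I, ((2:ℝ) ^ (-(j:ℝ)) * b i j) * ((2:ℝ) ^ (-(k:ℝ)) * b i k) +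
      ∑ l ∈ range L, K * ((rho ^ ((l:ℤ) - 2 * j).natAbs * bn I b j) *
        (rho ^ ((l:ℤ) - 2 * k).natAbs * bn I b k)) := by
    intro j k
    rw [hL]
    calc _ ≤ (2:ℝ) ^ (-(j:ℝ) - k) * (∑ i ∈ I, b i j * b i k + ∑ l ∈ range L, 
          ‖∑ i ∈ I, ∑ i' ∈ I.filter (fun i' => i ≠ i' ∧ dlog i i' = l),
            inner ℂ (w i j) (w i' k)‖) := by
          refine mul_le_mul_of_nonneg_left ?_ (by positivity)
          refine (norm_add_le _ _).trans (add_le_add ?_ (norm_sum_le _ _))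
          refine (norm_sum_le _ _).trans (sum_le_sum fun i _ => ?_)
          exact (norm_inner_le_norm _ _).trans (mul_le_mul (h.norm_le _ _) (h.norm_le _ _)
            (norm_nonneg _) (h.b_nonneg _ _))
      _ ≤ _ := by
          rw [mul_add, mul_sum, mul_sum]
          refine add_le_add (sum_le_sum fun i _ => le_of_eq ?_) (sum_le_sum fun l _ => ?_)
          · rw [sub_eq_add_neg, Real.rpow_add (by norm_num)]; ring
          · rw [← mul_assoc]; exact h.bound I l j k
  refine (e1.trans (sum_le_sum fun j _ => sum_le_sum fun k _ => e2 j k)).trans ?_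
  simp_rw [sum_add_distrib]
  rw [add_mul]
  refine add_le_add ?_ ?_
  · -- diagonal part
    calc _ = ∑ i ∈ I, (∑ j ∈ J, (2:ℝ) ^ (-(j:ℝ)) * b i j) ^ 2 := by
          exact sum_sq_swap I J fun i j => (2:ℝ) ^ (-(j:ℝ)) * b i j
      _ ≤ ∑ i ∈ I, 2 * ∑ j ∈ J, b i j ^ 2 := by
          refine sum_le_sum fun i _ => ?_
          refine (sum_mul_sq_le_sq_mul_sq _ _ _).trans ?_
          refine mul_le_mul_of_nonneg_right ?_ (sum_nonneg fun _ _ => sq_nonneg _)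
          calc ∑ j ∈ J, ((2:ℝ) ^ (-(j:ℝ))) ^ 2 ≤ ∑ j ∈ J, (1/2:ℝ) ^ j := by
                refine sum_le_sum fun j _ => ?_
                rw [Real.rpow_neg (by norm_num), Real.rpow_natCast, one_div, inv_pow (2:ℝ) j]
                have : ((2:ℝ) ^ j)⁻¹ ≤ 1 := inv_le_one_of_one_le₀ (one_le_pow₀ (by norm_num))
                have h0 : 0 ≤ ((2:ℝ) ^ j)⁻¹ := by positivity
                nlinarith
            _ ≤ ∑' j : ℕ, (1/2:ℝ) ^ j :=
                summable_geometric_two.sum_le_tsum _ (fun _ _ => by positivity)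
            _ = 2 := tsum_geometric_two
      _ = _ := by rw [← mul_sum, sum_comm]
  · calc _ = ∑ l ∈ range L, K * (∑ j ∈ J, rho ^ ((l:ℤ) - 2 * j).natAbs * bn I b j) ^ 2 := by
          rw [← mul_sum]
          rw [← sum_sq_swap (range L) J fun l j => rho ^ ((l:ℤ) - 2 * j).natAbs * bn I b j]
          simp_rw [mul_sum]
      _ ≤ ∑ l ∈ range L, K * (rhoS * ∑ j ∈ J, rho ^ ((l:ℤ) - 2 * j).natAbs * bn I b j ^ 2) := by
          refine sum_le_sum fun l _ => mul_le_mul_of_nonneg_left ?_ hK0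
          calc _ = (∑ j ∈ J, √(rho ^ ((l:ℤ) - 2 * j).natAbs) * 
                (√(rho ^ ((l:ℤ) - 2 * j).natAbs) * bn I b j)) ^ 2 := by
                congr 1
                refine sum_congr rfl fun j _ => ?_
                rw [← mul_assoc, Real.mul_self_sqrt (by positivity)]
            _ ≤ _ := by
                refine (sum_mul_sq_le_sq_mul_sq _ _ _).trans ?_
                simp_rw [mul_pow]
                have : ∀ j : ℕ, √(rho ^ ((l:ℤ) - 2 * j).natAbs) ^ 2 = rho ^ ((l:ℤ) - 2 * j).natAbs :=
                  fun j => Real.sq_sqrt (by positivity)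
                simp_rw [this]
                refine mul_le_mul_of_nonneg_right ?_ (sum_nonneg fun _ _ => by positivity)
                exact rho_sum_le J (fun j => (l:ℤ) - 2 * j) (fun x y hxy => by simpa using hxy)
      _ = K * rhoS * ∑ j ∈ J, (∑ l ∈ range L, rho ^ ((l:ℤ) - 2 * j).natAbs) * bn I b j ^ 2 := by
          simp_rw [mul_sum, sum_mul, mul_sum]
          rw [sum_comm]
          refine sum_congr rfl fun _ _ => sum_congr rfl fun _ _ => by ring
      _ ≤ K * rhoS * ∑ j ∈ J, rhoS * bn I b j ^ 2 := by
          refine mul_le_mul_of_nonneg_left (sum_le_sum fun j _ => ?_) (by positivity)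
          refine mul_le_mul_of_nonneg_right ?_ (sq_nonneg _)
          exact rho_sum_le (range L) (fun l => (l:ℤ) - 2 * j) (fun x y hxy => by simpa using hxy)
      _ = _ := by
          simp_rw [bn_sq]; rw [← mul_sum]; ring

end PartOne
end ManyBodyWaveguide

namespace ManyBodyWaveguide
section PartTwo

variable {H : Type*} [NormedAddCommGroup H] [InnerProductSpace ℂ H]

/-- abstract data: a unitary group with localisation operators and dispersive bound -/
structure Disp (m : ℕ) (A : ℝ) (U : ℝ → H →L[ℂ] H) (P : ℤ → Set (H →L[ℂ] H)) : Prop where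
  m3 : 3 ≤ m
  one_le : 1 ≤ A
  unitary : ∀ t f, ‖U t f‖ = ‖f‖
  start : ∀ f, U 0 f = f
  group : ∀ s t f, U (s + t) f = U s (U t f)
  cont : ∀ f, Continuous fun t => U t f
  ne : ∀ j, (P j).Nonempty
  proj : ∀ j, ∀ p ∈ P j, ∀ v, inner ℂ v (p v) = ((‖p v‖ ^ 2 : ℝ) : ℂ)
  disp : ∀ j k, ∀ p ∈ P j, ∀ p' ∈ P k, ∀ f g, ∀ t : ℝ, t ≠ 0 →
    ‖inner ℂ (p g) (U t (p' f))‖ ≤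
      A * ((2:ℝ) ^ ((j:ℝ) + k) / |t|) ^ ((m:ℝ) / 2) * (‖p g‖ * ‖p' f‖)

def PsiA (P : ℤ → Set (H →L[ℂ] H)) (j : ℤ) (v : H) : ℝ≥0∞ :=
  ⨆ p : P j, ‖p.1 v‖ₑ ^ 2

def KTc (A : ℝ) : ℝ := 2 + 4 * (1 + 4 * A * rhoS) * rhoS ^ 2

lemma KTc_nonneg {A : ℝ} (h : 1 ≤ A) : 0 ≤ KTc A := by
  have := rhoS_nonneg
  unfold KTc; positivity

variable {m : ℕ} {A : ℝ} {U : ℝ → H →L[ℂ] H} {P : ℤ → Set (H →L[ℂ] H)}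

lemma Disp.inner_map (h : Disp m A U P) (t : ℝ) (f g : H) :
    inner ℂ (U t f) (U t g) = inner ℂ f g := by
  let L : H →ₗᵢ[ℂ] H := ⟨(U t).toLinearMap, h.unitary t⟩
  exact L.inner_map_map f g

lemma Disp.inner_move (h : Disp m A U P) (s t : ℝ) (f g : H) :
    inner ℂ (U (-s) f) (U (-t) g) = inner ℂ f (U (s - t) g) := by
  rw [← h.inner_map s, ← h.group, ← h.group]
  simp [h.start, sub_eq_add_neg]

lemma Disp.discrete (h : Disp m A U P) (d : ℕ) (p : ℤ → ℕ → H →L[ℂ] H)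
    (hp : ∀ (i : ℤ) (j : ℕ), p i j ∈ P ((j:ℤ) - d)) (I : Finset ℤ) (J : Finset ℕ) (f : H) :
    ∑ j ∈ J, ∑ i ∈ I, ((2:ℝ) ^ (-(j:ℝ)) * ‖p i j (U (i * (4:ℝ) ^ (-(d:ℝ))) f)‖) ^ 2
      ≤ KTc A * ‖f‖ ^ 2 := by
  set δ : ℝ := (4:ℝ) ^ (-(d:ℝ)) with hδ
  have hδ0 : 0 < δ := by positivity
  set g : ℤ → ℕ → H := fun i j => p i j (U (i * δ) f) with hg
  set w : ℤ → ℕ → H := fun i j => U (-(i * δ)) (((2:ℝ) ^ (-(j:ℝ)) : ℝ) • g i j) with hw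
  set b : ℤ → ℕ → ℝ := fun i j => (2:ℝ) ^ (-(j:ℝ)) * ‖g i j‖ with hb
  have hwn : ∀ i j, ‖w i j‖ = b i j := fun i j => by
    simp only [hw, hb]
    rw [h.unitary, norm_smul, Real.norm_of_nonneg (by positivity)]
  have hb0 : ∀ i j, 0 ≤ b i j := fun i j => by rw [← hwn]; positivity
  have kt : KT A w b := by
    refine ⟨h.one_le, fun i j => (hwn i j).le, ?_⟩
    intro i i' j k hii
    have hne : (0:ℝ) < |((i - i' : ℤ) : ℝ)| := by
      rw [abs_pos]; exact_mod_cast sub_ne_zero.2 hii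
    set X : ℝ := (2:ℝ) ^ ((j:ℝ) + k) / |((i - i' : ℤ) : ℝ)| with hX
    have hX0 : 0 < X := by positivity
    have h1 : ‖inner ℂ (w i j) (w i' k)‖ ≤ b i j * b i' k := by
      refine (norm_inner_le_norm _ _).trans ?_
      rw [hwn, hwn]
    have h2 : ‖inner ℂ (w i j) (w i' k)‖ ≤ A * X ^ ((m:ℝ)/2) * (b i j * b i' k) := by
      simp only [hw]
      rw [h.inner_move, ContinuousLinearMap.map_smul_of_tower, inner_smul_left_eq_smul, inner_smul_right_eq_smul]
      rw [norm_smul, norm_smul, Real.norm_of_nonneg (by positivity), Real.norm_of_nonneg (by positivity)]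
      have := h.disp _ _ (p i j) (hp i j) (p i' k) (hp i' k) (U (i' * δ) f) (U (i * δ) f)
        (i * δ - i' * δ) (by
          rw [← sub_mul]
          refine mul_ne_zero ?_ hδ0.ne'
          exact_mod_cast sub_ne_zero.2 hii)
      have e : (2:ℝ) ^ ((((j:ℤ) - d : ℤ):ℝ) + (((k:ℤ) - d : ℤ) : ℝ)) / |i * δ - i' * δ| = X := by
        rw [← sub_mul, abs_mul, abs_of_pos hδ0, hX]
        push_cast
        have : (2:ℝ) ^ ((j:ℝ) - d + (k - d)) = (2:ℝ) ^ ((j:ℝ) + k) * δ := by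
          rw [hδ, show (4:ℝ) = 2 ^ (2:ℝ) by norm_num, ← Real.rpow_mul (by norm_num),
            ← Real.rpow_add (by norm_num)]
          congr 1; ring
        rw [this]
        field_simp
      rw [e] at this
      calc _ ≤ (2:ℝ) ^ (-(j:ℝ)) * ((2:ℝ) ^ (-(k:ℝ)) *
            (A * X ^ ((m:ℝ)/2) * (‖g i j‖ * ‖g i' k‖))) := by
              gcongr
        _ = _ := by simp only [hb]; ring
    rcases le_or_gt 1 X with hx | hx
    · refine h1.trans ?_
      have : 1 ≤ A * X ^ (3/2:ℝ) := by
        have := Real.one_le_rpow hx (show (0:ℝ) ≤ 3/2 by norm_num)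
        nlinarith [h.one_le]
      have h3 := mul_nonneg (hb0 i j) (hb0 i' k)
      nlinarith
    · refine h2.trans ?_
      have h3 := mul_nonneg (hb0 i j) (hb0 i' k)
      have hA := h.one_le
      refine mul_le_mul_of_nonneg_right ?_ h3
      refine mul_le_mul_of_nonneg_left ?_ (by linarith)
      refine Real.rpow_le_rpow_of_exponent_ge hX0 hx.le ?_
      have : (3:ℝ) ≤ m := by exact_mod_cast h.m3
      linarith
  have main := kt.main I J
  set S : ℝ := ∑ j ∈ J, ∑ i ∈ I, b i j ^ 2 with hS
  have hS0 : 0 ≤ S := Finset.sum_nonneg fun _ _ => Finset.sum_nonneg fun _ _ => sq_nonneg _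
  set Z : H := ∑ j ∈ J, ∑ i ∈ I, ((2:ℝ)^(-(j:ℝ)):ℝ) • w i j with hZ
  have hin : (inner ℂ f Z : ℂ) = (S : ℂ) := by
    rw [hZ, inner_sum, hS]
    push_cast
    refine Finset.sum_congr rfl fun j _ => ?_
    rw [inner_sum]
    refine Finset.sum_congr rfl fun i _ => ?_
    simp only [hw]
    rw [ContinuousLinearMap.map_smul_of_tower, inner_smul_right_eq_smul, inner_smul_right_eq_smul]
    have : inner ℂ f (U (-(i * δ)) (g i j)) = ((‖g i j‖ ^ 2 : ℝ) : ℂ) := by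
      rw [← h.proj _ _ (hp i j) (U (i * δ) f)]
      rw [← h.inner_map (i * δ) f]
      rw [← h.group]
      simp [h.start, hg]
    rw [this]
    simp only [hb]
    rw [Complex.real_smul, Complex.real_smul]; push_cast; ring
  have h4 : S ≤ ‖f‖ * ‖Z‖ := by
    have := norm_inner_le_norm (𝕜 := ℂ) f Z
    rw [hin, Complex.norm_real, Real.norm_of_nonneg hS0] at this
    exact this
  change S ≤ _
  rcases hS0.eq_or_lt with h0 | h0
  · rw [← h0]; have := KTc_nonneg h.one_le; positivity
  have h5 : S ^ 2 ≤ ‖f‖ ^ 2 * (KTc A * S) := by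
    calc S ^ 2 ≤ (‖f‖ * ‖Z‖) ^ 2 := by gcongr
      _ = ‖f‖ ^ 2 * ‖Z‖ ^ 2 := by ring
      _ ≤ _ := by gcongr; exact main
  have : S * S ≤ (KTc A * ‖f‖ ^ 2) * S := by nlinarith
  exact le_of_mul_le_mul_right this h0

lemma sum_iSup_le {ι : Type*} [DecidableEq ι] {κ : ι → Type*} [∀ i, Nonempty (κ i)]
    (F : ∀ i, κ i → ℝ≥0∞) (B : ℝ≥0∞) (s : Finset ι) : ∀ c : ℝ≥0∞,
    (∀ p : ∀ i, κ i, c + ∑ i ∈ s, F i (p i) ≤ B) → c + ∑ i ∈ s, ⨆ k, F i k ≤ B := by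
  induction s using Finset.induction_on with
  | empty => intro c h; simpa using h (fun i => Classical.arbitrary _)
  | insert a s ha ih =>
    intro c h
    rw [Finset.sum_insert ha, ← add_assoc, add_right_comm, ENNReal.add_iSup]
    refine iSup_le fun k => ?_
    rw [add_right_comm]
    refine ih _ fun p => ?_
    have := h (Function.update p a k)
    rw [Finset.sum_insert ha, ← add_assoc] at this
    simp only [Function.update_self] at this
    refine le_trans (le_of_eq ?_) this
    congr 1
    refine Finset.sum_congr rfl fun i hi => ?_
    rw [Function.update_of_ne (by rintro rfl; exact ha hi)]

lemma Disp.discrete' (h : Disp m A U P) (d : ℕ) (I : Finset ℤ) (J : Finset ℕ) (f : H) :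
    ∑ i ∈ I, ∑ j ∈ J, ENNReal.ofReal ((4:ℝ) ^ (-(j:ℝ))) *
        PsiA P ((j:ℤ) - d) (U (i * (4:ℝ) ^ (-(d:ℝ))) f)
      ≤ ENNReal.ofReal (KTc A) * ‖f‖ₑ ^ 2 := by
  classical
  have hne : ∀ ij : ℤ × ℕ, Nonempty (P ((ij.2:ℤ) - d)) := fun ij => (h.ne _).to_subtype
  rw [← Finset.sum_product']
  have := sum_iSup_le (κ := fun ij : ℤ × ℕ => P ((ij.2:ℤ) - d))
    (fun ij p => ENNReal.ofReal ((4:ℝ) ^ (-(ij.2:ℝ))) *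
      ‖p.1 (U (ij.1 * (4:ℝ) ^ (-(d:ℝ))) f)‖ₑ ^ 2) (ENNReal.ofReal (KTc A) * ‖f‖ₑ ^ 2)
      (I ×ˢ J) 0 ?_
  · rw [zero_add] at this
    refine le_trans (le_of_eq ?_) this
    refine Finset.sum_congr rfl fun ij _ => ?_
    rw [PsiA, ENNReal.mul_iSup]
  · intro p
    rw [zero_add]
    have := h.discrete d (fun (i : ℤ) (j : ℕ) => (p (i, j)).1) (fun (i : ℤ) (j : ℕ) => (p (i,j)).2) I J f
    have h2 := ENNReal.ofReal_le_ofReal this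
    rw [ENNReal.ofReal_mul (KTc_nonneg h.one_le), ENNReal.ofReal_pow (norm_nonneg _),
      ofReal_norm] at h2
    refine le_trans (le_of_eq ?_) h2
    rw [Finset.sum_comm, ← Finset.sum_product' (s := I) (t := J)
      (f := fun i j => ((2:ℝ) ^ (-(j:ℝ)) * ‖(p (i, j)).1 (U (i * (4:ℝ) ^ (-(d:ℝ))) f)‖) ^ 2),
      ENNReal.ofReal_sum_of_nonneg (fun _ _ => sq_nonneg _)]
    refine Finset.sum_congr rfl fun ij _ => ?_
    rw [mul_pow, ENNReal.ofReal_mul (by positivity), ENNReal.ofReal_pow (norm_nonneg _),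
      ofReal_norm]
    congr 2
    rw [show (4:ℝ) = 2 ^ (2:ℝ) by norm_num, ← Real.rpow_mul (by norm_num), ← Real.rpow_natCast,
      ← Real.rpow_mul (by norm_num)]
    congr 1; push_cast; ring

lemma Disp.measurable_Psi (h : Disp m A U P) (j : ℤ) (f : H) :
    Measurable fun t => PsiA P j (U t f) := by
  apply LowerSemicontinuous.measurable
  unfold PsiA
  apply lowerSemicontinuous_iSup
  intro p
  apply Continuous.lowerSemicontinuous
  exact (ENNReal.continuous_pow 2).comp ((p.1.continuous.comp (h.cont f)).enorm)

lemma lintegral_split (F : ℝ → ℝ≥0∞) (hF : Measurable F) {δ : ℝ} (hδ : 0 < δ) :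
    ∫⁻ t, F t = ∫⁻ s in Set.Ioc 0 δ, ∑' i : ℤ, F (i * δ + s) := by
  rw [lintegral_tsum (fun i : ℤ => (show Measurable fun s => F (i * δ + s) from
    hF.comp (measurable_const_add _)).aemeasurable)]
  rw [← setLIntegral_univ, ← iUnion_Ioc_zsmul hδ, lintegral_iUnion (fun _ => measurableSet_Ioc)
    (Set.pairwise_disjoint_Ioc_zsmul δ)]
  refine tsum_congr fun i => ?_
  have := (measurePreserving_add_left volume ((i:ℝ) * δ)).setLIntegral_comp_preimage
    (s := Set.Ioc (i • δ) ((i+1) • δ)) measurableSet_Ioc hF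
  rw [← this]
  congr 2
  simp [add_mul]

theorem Disp.strichartz (h : Disp m A U P) (f : H) :
    ∫⁻ t, ∑' j : ℤ, ENNReal.ofReal ((4:ℝ) ^ (-(j:ℝ))) * PsiA P j (U t f)
      ≤ ENNReal.ofReal (KTc A) * ‖f‖ₑ ^ 2 := by
  have hmeas : ∀ j : ℤ, Measurable fun t =>
      ENNReal.ofReal ((4:ℝ) ^ (-(j:ℝ))) * PsiA P j (U t f) := fun j =>
    (h.measurable_Psi j f).const_mul _
  rw [lintegral_tsum (fun j => (hmeas j).aemeasurable), ENNReal.tsum_eq_iSup_sum]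
  refine iSup_le fun J => ?_
  rw [← lintegral_finsetSum _ (fun j _ => hmeas j)]
  obtain ⟨d, hd⟩ : ∃ d : ℕ, ∀ j ∈ J, 0 ≤ j + d := by
    obtain ⟨B, hB⟩ := J.bddBelow
    exact ⟨B.natAbs, fun j hj => by have := hB hj; omega⟩
  set δ : ℝ := (4:ℝ) ^ (-(d:ℝ)) with hδ
  have hδ0 : 0 < δ := by positivity
  rw [lintegral_split _ (Finset.measurable_fun_sum _ fun j _ => hmeas j) hδ0]
  have key : ∀ s : ℝ, ∑' i : ℤ, ∑ j ∈ J, ENNReal.ofReal ((4:ℝ) ^ (-(j:ℝ))) *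
      PsiA P j (U (i * δ + s) f) ≤
      ENNReal.ofReal ((4:ℝ) ^ (d:ℝ)) * (ENNReal.ofReal (KTc A) * ‖f‖ₑ ^ 2) := by
    intro s
    rw [ENNReal.tsum_eq_iSup_sum]
    refine iSup_le fun I => ?_
    have h1 := h.discrete' d I (J.image fun j : ℤ => (j + d).toNat) (U s f)
    have hn : ‖U s f‖ₑ = ‖f‖ₑ := by
      rw [← ofReal_norm, h.unitary, ofReal_norm]
    rw [hn] at h1
    refine le_trans (le_of_eq ?_) (mul_le_mul_right h1 (ENNReal.ofReal ((4:ℝ) ^ (d:ℝ))))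
    rw [Finset.mul_sum]
    refine Finset.sum_congr rfl fun i _ => ?_
    rw [Finset.sum_image, Finset.mul_sum]
    · refine Finset.sum_congr rfl fun j hj => ?_
      have e : (((j + d).toNat : ℕ) : ℤ) = j + d := Int.toNat_of_nonneg (hd j hj)
      have e' : (((j + d).toNat : ℕ) : ℝ) = j + d := by exact_mod_cast e
      rw [e, e', ← mul_assoc, ← ENNReal.ofReal_mul (by positivity),
        ← Real.rpow_add (by norm_num), h.group]
      congr 3 <;> ring
    · intro a ha b hb hab
      have := hd a ha
      have := hd b hb
      simp only at hab
      omega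
  refine (lintegral_mono key).trans ?_
  rw [setLIntegral_const, Real.volume_Ioc, mul_right_comm, ← ENNReal.ofReal_mul (by positivity), sub_zero,
    hδ, ← Real.rpow_add (by norm_num)]
  simp

end PartTwo
end ManyBodyWaveguide

namespace ManyBodyWaveguide
section PartThree

lemma exists_subset_meas {m : ℕ} (hm : 1 ≤ m) (A : Set (Fin m → ℝ)) (hA : MeasurableSet A)
    {a : ℝ≥0∞} (ha : a < volume A) : ∃ E, E ⊆ A ∧ MeasurableSet E ∧ volume E = a := by
  have hat : a ≠ ∞ := ne_top_of_lt ha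
  have : Nonempty (Fin m) := ⟨⟨0, hm⟩⟩
  set φ : ℝ → ℝ := fun R => volume.real (A ∩ Metric.closedBall 0 |R|) with hφ
  set c : ℝ := volume.real (Metric.closedBall (0 : Fin m → ℝ) 1)
  set ψ : ℝ → ℝ := fun R => |R| ^ m * c with hψ
  have hψc : Continuous ψ := by fun_prop
  have hfin : ∀ R, volume (A ∩ Metric.closedBall 0 |R|) ≠ ∞ := fun R =>
    (lt_of_le_of_lt (measure_mono Set.inter_subset_right) measure_closedBall_lt_top).ne
  have hψe : ∀ R, ψ R = volume.real (Metric.closedBall (0 : Fin m → ℝ) |R|) := fun R => by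
    rw [Measure.real, Measure.addHaar_closedBall' _ _ (abs_nonneg R), ENNReal.toReal_mul,
      ENNReal.toReal_ofReal (by positivity)]
    simp [hψ, c, Measure.real]
  have key : ∀ R R' : ℝ, |R| ≤ |R'| → |φ R' - φ R| ≤ |ψ R' - ψ R| := by
    intro R R' h
    have hsub : Metric.closedBall (0 : Fin m → ℝ) |R| ⊆ Metric.closedBall 0 |R'| :=
      Metric.closedBall_subset_closedBall h
    have h1 : φ R' - φ R = volume.real ((A ∩ Metric.closedBall 0 |R'|) \ (A ∩ Metric.closedBall 0 |R|)) := by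
      rw [measureReal_sdiff (Set.inter_subset_inter_right _ hsub) (hA.inter measurableSet_closedBall) (hfin R')]
    have h2 : ψ R' - ψ R = volume.real ((Metric.closedBall (0 : Fin m → ℝ) |R'|) \ (Metric.closedBall 0 |R|)) := by
      rw [hψe, hψe, measureReal_sdiff hsub measurableSet_closedBall measure_closedBall_lt_top.ne]
    rw [h1, h2, abs_of_nonneg measureReal_nonneg, abs_of_nonneg measureReal_nonneg]
    refine measureReal_mono ?_ (lt_of_le_of_lt (measure_mono Set.sdiff_subset) measure_closedBall_lt_top).ne
    rintro x ⟨⟨hxA, hx⟩, hx'⟩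
    exact ⟨hx, fun h => hx' ⟨hxA, h⟩⟩
  have key' : ∀ R R' : ℝ, |φ R' - φ R| ≤ |ψ R' - ψ R| := by
    intro R R'
    rcases le_total |R| |R'| with h | h
    · exact key R R' h
    · rw [abs_sub_comm, abs_sub_comm (ψ R')]; exact key R' R h
  have hφc : Continuous φ := by
    rw [continuous_iff_continuousAt]
    intro R
    have h0 : Filter.Tendsto (fun R' => |ψ R' - ψ R|) (nhds R) (nhds 0) := by
      have : Continuous fun R' => |ψ R' - ψ R| := by fun_prop
      simpa using this.tendsto R
    have h1 : Filter.Tendsto (fun R' => φ R' - φ R) (nhds R) (nhds 0) :=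
      squeeze_zero_norm (fun R' => key' R R') h0
    simpa [ContinuousAt] using h1.add_const (φ R)
  have hlo : ∃ R, φ R ≤ a.toReal := ⟨0, by
    have : φ 0 = 0 := by
      simp only [hφ, Measure.real]
      have : volume (A ∩ Metric.closedBall (0: Fin m → ℝ) |0|) = 0 :=
        measure_mono_null (t := {0}) (fun x hx => by simpa using hx.2) (by simp)
      rw [this]; rfl
    rw [this]; positivity⟩
  have hhi : ∃ R, a.toReal ≤ φ R := by
    have hU : A = ⋃ k : ℕ, A ∩ Metric.closedBall 0 |(k:ℝ)| := by
      rw [← Set.inter_iUnion]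
      simp [Metric.iUnion_closedBall_nat]
    have hmono : Monotone fun k : ℕ => A ∩ Metric.closedBall (0 : Fin m → ℝ) |(k:ℝ)| := by
      intro k l h
      refine Set.inter_subset_inter_right _ (Metric.closedBall_subset_closedBall ?_)
      simpa using h
    have ht := tendsto_measure_iUnion_atTop (μ := volume) hmono
    rw [← hU] at ht
    obtain ⟨k, hk⟩ := (ht.eventually (lt_mem_nhds ha)).exists
    exact ⟨k, ENNReal.toReal_mono (hfin k) hk.le⟩
  obtain ⟨R, hR⟩ := mem_range_of_exists_le_of_exists_ge hφc hlo hhi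
  refine ⟨A ∩ Metric.closedBall 0 |R|, Set.inter_subset_left, hA.inter measurableSet_closedBall, ?_⟩
  rw [← ENNReal.toReal_eq_toReal_iff' (hfin R) hat]; exact hR

section rearrangement
variable {Y : Type*} [MeasurableSpace Y] {μ : Measure Y} {G : Y → ℝ≥0∞}

lemma rearr_anti : Antitone (rearr μ G) := by
  intro s t h
  exact sInf_le_sInf fun lam hl => le_trans hl h

lemma lt_of_lt_rearr {t lam : ℝ≥0∞} (h : lam < rearr μ G t) : t < μ {x | lam < G x} := by
  by_contra hc
  exact absurd (sInf_le (show lam ∈ {lam : ℝ≥0∞ | μ {x | lam < G x} ≤ t} from not_lt.1 hc)) (not_le.2 h)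

/-- the square functional -/
def QQ (μ : Measure Y) (G : Y → ℝ≥0∞) (ρ : ℝ) : ℝ≥0∞ :=
  ∫⁻ t in Set.Ioi (0:ℝ), ENNReal.ofReal t ^ ρ * rearr μ G (ENNReal.ofReal t) ^ (2:ℝ)

lemma measurable_rearr : Measurable fun t : ℝ => rearr μ G (ENNReal.ofReal t) :=
  (rearr_anti.measurable).comp ENNReal.measurable_ofReal

lemma lorentz_eq (r : ℝ≥0∞) :
    lorentz r 2 μ G = QQ μ G (2 / r.toReal - 1) ^ (1/2 : ℝ) := by
  unfold lorentz QQ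
  rw [if_neg (by simp)]
  congr 1
  refine setLIntegral_congr_fun measurableSet_Ioi fun t ht => ?_
  have h0 : ENNReal.ofReal t ≠ 0 := by simpa using ht
  simp only [ENNReal.toReal_ofNat]
  rw [ENNReal.mul_rpow_of_nonneg _ _ (by norm_num), ← ENNReal.rpow_mul, ENNReal.rpow_sub _ _ h0 (by simp),
    ENNReal.rpow_one, div_eq_mul_inv, div_eq_mul_inv, mul_right_comm]
  congr 3
  ring

lemma rearr_lt_top (hG : Measurable G) (h : ∫⁻ y, G y ^ (2:ℝ) ∂μ ≠ ∞) {t : ℝ≥0∞} (ht : t ≠ 0) :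
    rearr μ G t ≠ ∞ := by
  intro hr
  have h1 : ∀ k : ℕ, t < μ {x | (k:ℝ≥0∞) < G x} := fun k =>
    lt_of_lt_rearr (by rw [hr]; simp)
  have h2 : ∀ k : ℕ, (k:ℝ≥0∞) ^ (2:ℝ) * t ≤ ∫⁻ y, G y ^ (2:ℝ) ∂μ := fun k => by
    refine le_trans ?_ (mul_meas_ge_le_lintegral₀ (hG.pow_const (2:ℝ)).aemeasurable ((k:ℝ≥0∞) ^ (2:ℝ)))
    gcongr
    refine (h1 k).le.trans (measure_mono fun x hx => ?_)
    exact ENNReal.rpow_le_rpow (le_of_lt hx) (by norm_num)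
  apply h
  refine ENNReal.eq_top_of_forall_nnreal_le ?_
  intro c
  have : ((c / t : ℝ≥0∞)) ≠ ∞ := ENNReal.div_ne_top (by simp) ht
  obtain ⟨k, hk⟩ := ENNReal.exists_nat_gt this
  refine le_trans ?_ (h2 (k+1))
  have h3 : (c : ℝ≥0∞) ≤ k * t := by
    rcases eq_or_ne t ∞ with rfl | htt
    · rcases Nat.eq_zero_or_pos k with rfl | hk0
      · simp at hk
      · rw [ENNReal.mul_top (by exact_mod_cast hk0.ne')]; exact le_top
    · exact (ENNReal.div_le_iff ht htt).1 hk.le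
  refine h3.trans ?_
  gcongr
  have : (1:ℝ≥0∞) ≤ (k+1 : ℕ) := by simp
  calc (k:ℝ≥0∞) ≤ ((k+1 : ℕ):ℝ≥0∞) := by exact_mod_cast Nat.le_succ k
    _ ≤ ((k+1 : ℕ):ℝ≥0∞) * ((k+1 : ℕ):ℝ≥0∞) := le_mul_of_one_le_right (by simp) this
    _ = _ := by rw [ENNReal.rpow_two, sq]

lemma QQ_zero_le (hG : Measurable G) : QQ μ G 0 ≤ ∫⁻ y, G y ^ (2:ℝ) ∂μ := by
  by_cases h : ∫⁻ y, G y ^ (2:ℝ) ∂μ = ∞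
  · rw [h]; exact le_top
  have hfin : ∀ᵐ y ∂μ, G y ≠ ∞ := by
    filter_upwards [ae_lt_top (hG.pow_const (2:ℝ)) h] with y hy hy'
    rw [hy'] at hy; simp at hy
  have e1 : ∫⁻ y, G y ^ (2:ℝ) ∂μ = ∫⁻ y, ENNReal.ofReal ((G y).toReal ^ (2:ℝ)) ∂μ := by
    refine lintegral_congr_ae ?_
    filter_upwards [hfin] with y hy
    rw [← ENNReal.ofReal_rpow_of_nonneg ENNReal.toReal_nonneg (by norm_num), ENNReal.ofReal_toReal hy]
  have e2 : QQ μ G 0 = ∫⁻ t in Set.Ioi (0:ℝ),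
      ENNReal.ofReal ((rearr μ G (ENNReal.ofReal t)).toReal ^ (2:ℝ)) := by
    unfold QQ
    refine setLIntegral_congr_fun measurableSet_Ioi fun t ht => ?_
    have : rearr μ G (ENNReal.ofReal t) ≠ ∞ := rearr_lt_top hG h (by simpa using ht)
    simp only [ENNReal.rpow_zero, one_mul]
    rw [← ENNReal.ofReal_rpow_of_nonneg ENNReal.toReal_nonneg (by norm_num), ENNReal.ofReal_toReal this]
  rw [e1, e2, lintegral_rpow_eq_lintegral_meas_lt_mul _ (Filter.Eventually.of_forall fun _ => ENNReal.toReal_nonneg)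
    measurable_rearr.ennreal_toReal.aemeasurable (by norm_num),
    lintegral_rpow_eq_lintegral_meas_lt_mul _ (Filter.Eventually.of_forall fun _ => ENNReal.toReal_nonneg)
    hG.ennreal_toReal.aemeasurable (by norm_num)]
  refine mul_le_mul_right (setLIntegral_mono_ae' measurableSet_Ioi
    (Filter.Eventually.of_forall fun lam hlam => mul_le_mul_left ?_ _)) _
  have hl0 : 0 < lam := hlam
  rw [Measure.restrict_apply' measurableSet_Ioi]
  have hsub : {t : ℝ | lam < (rearr μ G (ENNReal.ofReal t)).toReal} ∩ Set.Ioi 0 ⊆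
      {t : ℝ | 0 < t ∧ ENNReal.ofReal t < μ {x | ENNReal.ofReal lam < G x}} := by
    rintro t ⟨h1, h2⟩
    refine ⟨h2, lt_of_lt_rearr ?_⟩
    have h3 : rearr μ G (ENNReal.ofReal t) ≠ ∞ := rearr_lt_top hG h (by simpa using h2)
    exact (ENNReal.ofReal_lt_iff_lt_toReal hl0.le h3).2 h1
  have hM : μ {x | ENNReal.ofReal lam < G x} ≤ μ {x | lam < (G x).toReal} := by
    refine measure_mono_ae ?_
    filter_upwards [hfin] with y hy hy'
    exact (ENNReal.ofReal_lt_iff_lt_toReal hl0.le hy).1 hy'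
  refine le_trans ?_ hM
  refine (measure_mono hsub).trans ?_
  generalize μ {x | ENNReal.ofReal lam < G x} = M
  rcases eq_or_ne M ∞ with rfl | hMt
  · exact le_top
  · calc volume {t : ℝ | 0 < t ∧ ENNReal.ofReal t < M} ≤ volume (Set.Ioc 0 M.toReal) := by
          refine measure_mono fun t ht => ⟨ht.1, ?_⟩
          exact ((ENNReal.ofReal_lt_iff_lt_toReal ht.1.le hMt).1 ht.2).le
      _ = M := by rw [Real.volume_Ioc, sub_zero, ENNReal.ofReal_toReal hMt]

lemma QQ_interp {θ ρ : ℝ} (h0 : 0 ≤ θ) (h1 : θ ≤ 1) :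
    QQ μ G (θ * ρ) ≤ QQ μ G 0 ^ (1 - θ) * QQ μ G ρ ^ θ := by
  have hm : Measurable fun t : ℝ => rearr μ G (ENNReal.ofReal t) ^ (2:ℝ) :=
    measurable_rearr.pow_const _
  have := ENNReal.lintegral_mul_norm_pow_le (μ := volume.restrict (Set.Ioi (0:ℝ)))
    (f := fun t : ℝ => ENNReal.ofReal t ^ (0:ℝ) * rearr μ G (ENNReal.ofReal t) ^ (2:ℝ))
    (g := fun t : ℝ => ENNReal.ofReal t ^ ρ * rearr μ G (ENNReal.ofReal t) ^ (2:ℝ))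
    ((ENNReal.measurable_ofReal.pow_const _).mul hm).aemeasurable
    ((ENNReal.measurable_ofReal.pow_const _).mul hm).aemeasurable
    (p := 1 - θ) (q := θ) (by linarith) h0 (by ring)
  refine le_trans (le_of_eq ?_) this
  unfold QQ
  refine setLIntegral_congr_fun measurableSet_Ioi fun t ht => ?_
  simp only [ENNReal.rpow_zero, one_mul]
  rw [ENNReal.mul_rpow_of_nonneg _ _ h0, mul_left_comm, ← ENNReal.rpow_add_of_nonneg _ _ (by linarith) h0,
    ← ENNReal.rpow_mul, mul_comm ρ θ]
  simp

end rearrangement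

lemma level_le {m : ℕ} (hm : 1 ≤ m) {G : (Fin m → ℝ) → ℝ≥0∞} (hG : Measurable G)
    {a : ℝ≥0∞} {B : ℝ≥0∞}
    (hB : ∀ E, MeasurableSet E → volume E ≤ a → ∫⁻ y in E, G y ^ (2:ℝ) ≤ B) :
    a * rearr volume G a ^ (2:ℝ) ≤ B := by
  have key : ∀ lam, lam < rearr volume G a → a * lam ^ (2:ℝ) ≤ B := by
    intro lam hl
    obtain ⟨E, hE, hEm, hEa⟩ := exists_subset_meas hm _ (measurableSet_lt measurable_const hG)
      (lt_of_lt_rearr hl)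
    refine le_trans ?_ (hB E hEm hEa.le)
    rw [← hEa, mul_comm, ← setLIntegral_const]
    refine setLIntegral_mono' hEm fun y hy => ?_
    exact ENNReal.rpow_le_rpow (le_of_lt (hE hy)) (by norm_num)
  rcases eq_or_ne (rearr volume G a) 0 with h0 | h0
  · rw [h0]; simp
  rcases eq_or_ne a 0 with ha | ha
  · rw [ha]; simp
  by_contra hc
  push Not at hc
  have hcont : Filter.Tendsto (fun lam : ℝ≥0∞ => a * lam ^ (2:ℝ))
      (nhdsWithin (rearr volume G a) (Set.Iio (rearr volume G a)))
      (nhds (a * rearr volume G a ^ (2:ℝ))) := by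
    refine (ENNReal.Tendsto.const_mul (ENNReal.continuous_rpow_const.tendsto _) (Or.inl ?_)).mono_left nhdsWithin_le_nhds
    simp [h0]
  have hne : (nhdsWithin (rearr volume G a) (Set.Iio (rearr volume G a))).NeBot :=
    nhdsLT_neBot_of_exists_lt ⟨0, pos_iff_ne_zero.2 h0⟩
  exact absurd (le_of_tendsto hcont (eventually_nhdsWithin_of_forall fun lam hl => key lam hl)) (not_le.2 hc)

lemma QQ_endpoint_le {m : ℕ} (hm : 1 ≤ m) {G : (Fin m → ℝ) → ℝ≥0∞} (hG : Measurable G)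
    {Ψ : ℤ → ℝ≥0∞}
    (hB : ∀ j : ℤ, ∀ E, MeasurableSet E → volume E ≤ ENNReal.ofReal ((2:ℝ) ^ ((m:ℝ) * j)) →
      ∫⁻ y in E, G y ^ (2:ℝ) ≤ Ψ j) :
    QQ volume G (-2 / m) ≤ ENNReal.ofReal (2 ^ m) *
      ∑' j : ℤ, ENNReal.ofReal ((4:ℝ) ^ (-(j:ℝ))) * Ψ j := by
  have hm0 : (0:ℝ) < m := by exact_mod_cast hm
  have hz : ∀ j : ℤ, ((2:ℝ) ^ m) ^ j = (2:ℝ) ^ ((m:ℝ) * j) := fun j => by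
    rw [Real.rpow_mul (by norm_num), Real.rpow_natCast, Real.rpow_intCast]
  have hsub : Set.Ioi (0:ℝ) ⊆ ⋃ j : ℤ, Set.Ico (((2:ℝ) ^ m) ^ j) (((2:ℝ) ^ m) ^ (j+1)) := by
    intro t ht
    obtain ⟨j, hj⟩ := exists_mem_Ico_zpow (show 0 < t from ht)
      (show (1:ℝ) < 2 ^ m from one_lt_pow₀ (by norm_num) (by omega))
    exact Set.mem_iUnion.2 ⟨j, hj⟩
  unfold QQ
  refine (lintegral_mono_set hsub).trans ((lintegral_iUnion_le _ _).trans ?_)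
  rw [← ENNReal.tsum_mul_left]
  refine ENNReal.tsum_le_tsum fun j => ?_
  set a : ℝ := ((2:ℝ) ^ m) ^ j with ha
  have ha0 : 0 < a := by positivity
  have hlev := level_le hm hG (fun E hE hEa => hB j E hE (by rw [← hz]; exact hEa))
  rw [← ha] at hlev
  calc _ ≤ ∫⁻ t in Set.Ico a (((2:ℝ) ^ m) ^ (j+1)),
        ENNReal.ofReal ((4:ℝ) ^ (-(j:ℝ))) * rearr volume G (ENNReal.ofReal a) ^ (2:ℝ) := by
        refine setLIntegral_mono' measurableSet_Ico fun t ht => ?_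
        have ht0 : 0 < t := ha0.trans_le ht.1
        refine mul_le_mul' ?_ (ENNReal.rpow_le_rpow (rearr_anti (ENNReal.ofReal_le_ofReal ht.1)) (by norm_num))
        rw [ENNReal.ofReal_rpow_of_pos ht0]
        refine ENNReal.ofReal_le_ofReal ?_
        calc t ^ (-2 / (m:ℝ)) ≤ a ^ (-2 / (m:ℝ)) := by
              refine Real.rpow_le_rpow_of_nonpos ha0 ht.1 ?_
              exact div_nonpos_of_nonpos_of_nonneg (by norm_num) hm0.le
          _ = _ := by
              rw [ha, hz, ← Real.rpow_mul (by norm_num), show (4:ℝ) = 2 ^ (2:ℝ) by norm_num,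
                ← Real.rpow_mul (by norm_num)]
              congr 1; field_simp
    _ = ENNReal.ofReal ((4:ℝ) ^ (-(j:ℝ))) * rearr volume G (ENNReal.ofReal a) ^ (2:ℝ) *
        ENNReal.ofReal (((2:ℝ) ^ m) ^ (j+1) - a) := by
        rw [setLIntegral_const, Real.volume_Ico]
    _ ≤ ENNReal.ofReal ((4:ℝ) ^ (-(j:ℝ))) * rearr volume G (ENNReal.ofReal a) ^ (2:ℝ) *
        (ENNReal.ofReal (2 ^ m) * ENNReal.ofReal a) := by
        gcongr
        rw [← ENNReal.ofReal_mul (by positivity)]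
        refine ENNReal.ofReal_le_ofReal ?_
        rw [zpow_add_one₀ (by positivity), ← ha]
        linarith [mul_comm a ((2:ℝ) ^ m)]
    _ = ENNReal.ofReal (2 ^ m) * (ENNReal.ofReal ((4:ℝ) ^ (-(j:ℝ))) *
        (ENNReal.ofReal a * rearr volume G (ENNReal.ofReal a) ^ (2:ℝ))) := by ring
    _ ≤ _ := by gcongr

end PartThree
end ManyBodyWaveguide

namespace ManyBodyWaveguide
section PartFour

section proj
variable {X : Type*} [MeasurableSpace X] {μ : Measure X}

/-- multiplication by an indicator function on `L²` -/
def PE (μ : Measure X) (S : Set X) (hS : MeasurableSet S) : Lp ℂ 2 μ →L[ℂ] Lp ℂ 2 μ :=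
  LinearMap.mkContinuous
    { toFun := fun v => ((Lp.memLp v).indicator hS).toLp (S.indicator v)
      map_add' := fun v w => by
        ext1
        filter_upwards [((Lp.memLp (v + w)).indicator hS).coeFn_toLp, ((Lp.memLp v).indicator hS).coeFn_toLp,
          ((Lp.memLp w).indicator hS).coeFn_toLp, Lp.coeFn_add v w,
          Lp.coeFn_add (((Lp.memLp v).indicator hS).toLp (S.indicator v))
            (((Lp.memLp w).indicator hS).toLp (S.indicator w))] with x h1 h2 h3 h4 h5
        rw [h1, h5, Pi.add_apply, h2, h3]
        by_cases hx : x ∈ S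
        · simp only [Set.indicator_of_mem hx]; exact h4
        · simp [hx]
      map_smul' := fun c v => by
        ext1
        filter_upwards [((Lp.memLp (c • v)).indicator hS).coeFn_toLp, ((Lp.memLp v).indicator hS).coeFn_toLp,
          Lp.coeFn_smul c v,
          Lp.coeFn_smul c (((Lp.memLp v).indicator hS).toLp (S.indicator v))] with x h1 h2 h4 h5
        simp only [RingHom.id_apply]
        rw [h1, h5, Pi.smul_apply, h2]
        by_cases hx : x ∈ S <;> simp [hx, h4] }
    1 (fun v => by
      rw [one_mul]
      refine Lp.norm_le_norm_of_ae_le ?_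
      filter_upwards [((Lp.memLp v).indicator hS).coeFn_toLp] with x hx
      simp only [LinearMap.coe_mk, AddHom.coe_mk]
      rw [hx]
      exact norm_indicator_le_norm_self _ _)

lemma PE_coe (S : Set X) (hS : MeasurableSet S) (v : Lp ℂ 2 μ) :
    (PE μ S hS v : X → ℂ) =ᵐ[μ] S.indicator v :=
  ((Lp.memLp v).indicator hS).coeFn_toLp

lemma PE_enorm_sq (S : Set X) (hS : MeasurableSet S) (v : Lp ℂ 2 μ) :
    ‖PE μ S hS v‖ₑ ^ 2 = ∫⁻ x in S, ‖v x‖ₑ ^ 2 ∂μ := by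
  rw [Lp.enorm_def, eLpNorm_eq_lintegral_rpow_enorm_toReal (by norm_num) (by norm_num), ← ENNReal.rpow_two,
    ← ENNReal.rpow_mul, ← lintegral_indicator hS]
  simp only [ENNReal.toReal_ofNat, one_div, isUnit_iff_ne_zero, ne_eq, OfNat.ofNat_ne_zero, not_false_eq_true,
    IsUnit.inv_mul_cancel, ENNReal.rpow_one, ENNReal.rpow_two]
  refine lintegral_congr_ae ?_
  filter_upwards [PE_coe S hS v] with x hx
  rw [hx]
  by_cases h : x ∈ S <;> simp [h]

lemma PE_proj (S : Set X) (hS : MeasurableSet S) (v : Lp ℂ 2 μ) :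
    inner ℂ v (PE μ S hS v) = ((‖PE μ S hS v‖ ^ 2 : ℝ) : ℂ) := by
  have : ((‖PE μ S hS v‖ ^ 2 : ℝ) : ℂ) = inner ℂ (PE μ S hS v) (PE μ S hS v) := by
    rw [inner_self_eq_norm_sq_to_K]; simp
  rw [this, L2.inner_def, L2.inner_def]
  refine integral_congr_ae ?_
  filter_upwards [PE_coe S hS v] with x hx
  rw [hx]
  by_cases h : x ∈ S <;> simp [h]

end proj

variable {m n N : ℕ}

/-- the slab over a set in the `α`-th Euclidean variable -/
def slab (n : ℕ) (α : Fin N) (E : Set (Fin m → ℝ)) : Set (Cfg m n N) := {x | (x α).1 ∈ E}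

lemma slab_meas (α : Fin N) {E : Set (Fin m → ℝ)} (hE : MeasurableSet E) :
    MeasurableSet (slab n α E) :=
  ((measurable_pi_apply α).fst) hE

/-- The localisation operators at scale `j` -/
def PP (m n N : ℕ) (α : Fin N) (j : ℤ) : Set (L2 m n N →L[ℂ] L2 m n N) :=
  {p | ∃ (E : Set (Fin m → ℝ)) (hE : MeasurableSet E),
    volume E ≤ ENNReal.ofReal ((2:ℝ) ^ ((m:ℝ) * j)) ∧ p = PE volume (slab n α E) (slab_meas α hE)}

lemma glue_mp (m n N : ℕ) (α : Fin N) :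
    MeasurePreserving (fun p : Wg m n × Hat m n N α => glue m n N α p.1 p.2) volume volume := by
  have h1 := (volume_preserving_piEquivPiSubtypeProd (fun _ : Fin N => Wg m n) (fun β => β = α)).symm
  let : Fintype {β : Fin N // β = α} := Subtype.fintype fun β => β = α
  have h2 := (volume_preserving_piUnique (fun _ : {β : Fin N // β = α} => Wg m n)).symm
  have h3 : MeasurePreserving (Prod.map (MeasurableEquiv.piUnique fun _ : {β : Fin N // β = α} => Wg m n).symm
      (id : Hat m n N α → Hat m n N α)) volume volume :=
    h2.prod (MeasurePreserving.id (volume : Measure (Hat m n N α)))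
  have h4 := MeasurePreserving.comp h1 h3
  have e : (fun p : Wg m n × Hat m n N α => glue m n N α p.1 p.2) =
      (MeasurableEquiv.piEquivPiSubtypeProd (fun _ : Fin N => Wg m n) fun β => β = α).symm ∘
      Prod.map (MeasurableEquiv.piUnique fun _ : {β : Fin N // β = α} => Wg m n).symm
        (id : Hat m n N α → Hat m n N α) := by
    funext p β
    by_cases hβ : β = α
    · subst hβ
      simp [glue, MeasurableEquiv.piEquivPiSubtypeProd, MeasurableEquiv.piUnique]
    · simp [glue, hβ, MeasurableEquiv.piEquivPiSubtypeProd, MeasurableEquiv.piUnique]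
  rw [e]
  exact h4

/-- The inner mass function -/
def GG (α : Fin N) (v : Cfg m n N → ℂ) (y : Fin m → ℝ) : ℝ≥0∞ :=
  eN 2 volume fun z : Torus n => eLpNorm (fun h : Hat m n N α => v (glue m n N α (y, z) h)) 2 volume

lemma GG_sq (α : Fin N) (v : Cfg m n N → ℂ) (y : Fin m → ℝ) :
    GG α v y ^ (2:ℝ) = ∫⁻ z : Torus n, ∫⁻ h : Hat m n N α, ‖v (glue m n N α (y, z) h)‖ₑ ^ 2 := by
  unfold GG eN
  rw [if_neg (by simp), ← ENNReal.rpow_mul]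
  simp only [ENNReal.toReal_ofNat, one_div, isUnit_iff_ne_zero, ne_eq, OfNat.ofNat_ne_zero, not_false_eq_true,
    IsUnit.inv_mul_cancel, ENNReal.rpow_one]
  refine lintegral_congr fun z => ?_
  rw [eLpNorm_eq_lintegral_rpow_enorm_toReal (by norm_num) (by norm_num), ← ENNReal.rpow_mul]
  simp

lemma lintegral_glue (α : Fin N) {F : Cfg m n N → ℝ≥0∞} (hF : Measurable F) :
    ∫⁻ x, F x = ∫⁻ y : Fin m → ℝ, ∫⁻ z : Torus n, ∫⁻ h : Hat m n N α, F (glue m n N α (y, z) h) := by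
  have hmeas := (glue_mp m n N α).measurable
  rw [← (glue_mp m n N α).lintegral_comp hF]
  have hc : Measurable fun p : Wg m n × Hat m n N α => F (glue m n N α p.1 p.2) := hF.comp hmeas
  rw [Measure.volume_eq_prod, lintegral_prod _ hc.aemeasurable, Measure.volume_eq_prod,
    lintegral_prod _ (hc.lintegral_prod_right').aemeasurable]

lemma GG_measurable (α : Fin N) {v : Cfg m n N → ℂ} (hv : Measurable v) : Measurable (GG α v) := by
  have h0 : Measurable fun y => GG α v y ^ (2:ℝ) := by
    simp_rw [GG_sq]
    have hc : Measurable fun p : Wg m n × Hat m n N α => ‖v (glue m n N α p.1 p.2)‖ₑ ^ 2 :=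
      (hv.comp (glue_mp m n N α).measurable).enorm.pow_const 2
    exact (hc.lintegral_prod_right').lintegral_prod_right'
  have : GG α v = fun y => (GG α v y ^ (2:ℝ)) ^ (1/2:ℝ) := by
    ext y; rw [← ENNReal.rpow_mul]; norm_num
  rw [this]
  exact h0.pow_const _

lemma GG_setLIntegral (α : Fin N) {v : Cfg m n N → ℂ} (hv : Measurable v) {E : Set (Fin m → ℝ)}
    (hE : MeasurableSet E) :
    ∫⁻ y in E, GG α v y ^ (2:ℝ) = ∫⁻ x in slab n α E, ‖v x‖ₑ ^ 2 := by
  rw [← lintegral_indicator (slab_meas α hE), lintegral_glue α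
    ((hv.enorm.pow_const 2).indicator (slab_meas α hE)), ← lintegral_indicator hE]
  refine lintegral_congr fun y => ?_
  have hy : ∀ z h, glue m n N α (y, z) h ∈ slab n α E ↔ y ∈ E := fun z h => by
    simp [slab, glue]
  by_cases h : y ∈ E
  · rw [Set.indicator_of_mem h, GG_sq]
    refine lintegral_congr fun z => lintegral_congr fun h' => ?_
    rw [Set.indicator_of_mem ((hy z h').2 h)]
  · rw [Set.indicator_of_notMem h]
    symm
    simp only [Set.indicator, hy, h, if_false, lintegral_zero]

lemma GG_total (α : Fin N) (v : L2 m n N) : ∫⁻ y, GG α v y ^ (2:ℝ) = ‖v‖ₑ ^ 2 := by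
  have h := GG_setLIntegral α (Lp.stronglyMeasurable v).measurable MeasurableSet.univ
  rw [setLIntegral_univ] at h
  rw [h, Lp.enorm_def, eLpNorm_eq_lintegral_rpow_enorm_toReal (by norm_num) (by norm_num), ← ENNReal.rpow_two,
    ← ENNReal.rpow_mul]
  simp [slab]

lemma GG_Psi (α : Fin N) (v : L2 m n N) (j : ℤ) (E : Set (Fin m → ℝ)) (hE : MeasurableSet E)
    (hv : volume E ≤ ENNReal.ofReal ((2:ℝ) ^ ((m:ℝ) * j))) :
    ∫⁻ y in E, GG α v y ^ (2:ℝ) ≤ PsiA (PP m n N α) j v := by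
  rw [GG_setLIntegral α (Lp.stronglyMeasurable v).measurable hE, ← PE_enorm_sq _ (slab_meas α hE)]
  exact le_iSup (fun p : PP m n N α j => ‖p.1 v‖ₑ ^ 2) ⟨_, E, hE, hv, rfl⟩

set_option maxHeartbeats 1000000 in
theorem final_of_disp (hm : 3 ≤ m) (q r : ℝ≥0∞) (hqr : Admissible m q r) (α : Fin N)
    (A : ℝ) (hD : ∀ U0, IsPropagator m n N 0 U0 → Disp m A U0 (PP m n N α)) :
    ∃ C : ℝ, 0 < C ∧
      ∀ U0 : ℝ → L2 m n N →L[ℂ] L2 m n N, IsPropagator m n N 0 U0 →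
        ∀ u0 : L2 m n N,
          frozenNormL q r 2 α (fun t x => (U0 t u0) x) ≤
            ENNReal.ofReal C * (‖u0‖₊ : ℝ≥0∞) := by
  obtain ⟨hq, hr, he, -⟩ := hqr
  have hm0 : (m:ℝ) ≠ 0 := by positivity
  have hm3 : (3:ℝ) ≤ m := by exact_mod_cast hm
  have hmE : (m:ℝ≥0∞) ≠ 0 := by exact_mod_cast (by omega : m ≠ 0)
  have hq0 : q ≠ 0 := by rintro rfl; simp at hq
  have hr0 : r ≠ 0 := by rintro rfl; simp at hr
  have hfz : ∀ (U0 : ℝ → L2 m n N →L[ℂ] L2 m n N) (u0 : L2 m n N), frozenNormL q r 2 α (fun t x => (U0 t u0) x) =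
      eN q volume fun t : ℝ => lorentz r 2 volume (GG α (U0 t u0 : Cfg m n N → ℂ)) := fun _ _ => rfl
  rcases eq_or_ne q ∞ with rfl | hqt
  · -- energy case
    have hr2 : r = 2 := by
      simp only [ENNReal.div_top, zero_add] at he
      rw [div_eq_mul_inv, div_eq_mul_inv, ENNReal.mul_right_inj hmE (by simp) ] at he
      exact inv_injective he
    subst hr2
    refine ⟨1, one_pos, fun U0 hU u0 => ?_⟩
    rw [hfz]
    unfold eN
    rw [if_pos rfl]
    refine essSup_le_of_ae_le _ (Filter.Eventually.of_forall fun t => ?_)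
    simp only [ENNReal.ofReal_one, one_mul]
    rw [lorentz_eq]
    have e : (2 / (2:ℝ≥0∞).toReal - 1) = 0 := by simp
    rw [e]
    have h1 := QQ_zero_le (μ := volume) (GG_measurable α (Lp.stronglyMeasurable (U0 t u0)).measurable)
    rw [GG_total] at h1
    have hn : ‖U0 t u0‖ₑ = ‖u0‖ₑ := by
      rw [← ofReal_norm, hU.unitary, ofReal_norm]
    rw [hn] at h1
    refine (ENNReal.rpow_le_rpow h1 (by norm_num)).trans (le_of_eq ?_)
    rw [← ENNReal.rpow_two, ← ENNReal.rpow_mul]; simp; rfl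
  have hrt : r ≠ ∞ := by
    rintro rfl
    simp only [ENNReal.div_top, add_zero] at he
    have h1 := congrArg ENNReal.toReal he
    simp only [ENNReal.toReal_div, ENNReal.toReal_ofNat, ENNReal.toReal_natCast] at h1
    have h2 : (2:ℝ) ≤ q.toReal := by
      have := ENNReal.toReal_mono hqt hq; simpa using this
    have h3 : 2 / q.toReal ≤ 1 := by rw [div_le_one (by linarith)]; exact h2
    linarith
  have h2q : (2:ℝ) ≤ q.toReal := by
    have := ENNReal.toReal_mono hqt hq; simpa using this
  have h2r : (2:ℝ) ≤ r.toReal := by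
    have := ENNReal.toReal_mono hrt hr; simpa using this
  have heR : 2 / q.toReal + m / r.toReal = m / 2 := by
    have h1 := congrArg ENNReal.toReal he
    rw [ENNReal.toReal_add (ENNReal.div_ne_top (by simp) hq0) (ENNReal.div_ne_top (by simp) hr0)] at h1
    simpa using h1
  set Q := q.toReal with hQ
  set θ : ℝ := 2 / Q with hθ
  have hθ0 : 0 ≤ θ := by positivity
  have hθ1 : θ ≤ 1 := by rw [hθ, div_le_one (by linarith)]; exact h2q
  have hexp : 2 / r.toReal - 1 = θ * (-2 / m) := by
    have h1 : (m:ℝ) / r.toReal = m / 2 - θ := by linarith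
    have h2 : 2 / r.toReal = (2 / m) * (m / r.toReal) := by field_simp
    rw [h2, h1]; field_simp; ring
  set K : ℝ≥0∞ := ENNReal.ofReal (2 ^ m) * ENNReal.ofReal (KTc A) with hK
  have hKt : K ≠ ∞ := ENNReal.mul_ne_top (by simp) (by simp)
  refine ⟨(K ^ (1 / Q)).toReal + 1, by positivity, fun U0 hU u0 => ?_⟩
  have hDU := hD U0 hU
  rw [hfz]
  unfold eN
  rw [if_neg hqt, ← hQ]
  set B : ℝ≥0∞ := ‖u0‖ₑ ^ 2 with hB
  have hBt : B ≠ ∞ := by simp [hB]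
  have hQ0 : 0 < Q := by linarith
  set Z : ℝ → ℝ≥0∞ := fun t => ∑' j : ℤ, ENNReal.ofReal ((4:ℝ) ^ (-(j:ℝ))) *
    PsiA (PP m n N α) j (U0 t u0) with hZ
  have hpt : ∀ t, lorentz r 2 volume (GG α (U0 t u0 : Cfg m n N → ℂ)) ^ Q ≤
      B ^ ((1 - θ) * (Q / 2)) * (ENNReal.ofReal (2 ^ m) * Z t) := by
    intro t
    have hmea := GG_measurable α (Lp.stronglyMeasurable (U0 t u0)).measurable
    rw [lorentz_eq, hexp, ← ENNReal.rpow_mul]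
    have h1 := QQ_zero_le (μ := volume) hmea
    rw [GG_total] at h1
    have hn : ‖U0 t u0‖ₑ = ‖u0‖ₑ := by
      rw [← ofReal_norm, hU.unitary, ofReal_norm]
    rw [hn] at h1
    have h2 := QQ_endpoint_le (by omega) hmea (GG_Psi α (U0 t u0))
    have h3 := QQ_interp (μ := volume) (G := GG α (U0 t u0 : Cfg m n N → ℂ)) (ρ := -2 / m) hθ0 hθ1
    calc _ ≤ (B ^ (1 - θ) * (ENNReal.ofReal (2 ^ m) * Z t) ^ θ) ^ (1 / 2 * Q) := by
          refine ENNReal.rpow_le_rpow (h3.trans ?_) (by positivity)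
          exact mul_le_mul' (ENNReal.rpow_le_rpow h1 (by linarith)) (ENNReal.rpow_le_rpow h2 hθ0)
      _ = _ := by
          rw [ENNReal.mul_rpow_of_nonneg _ _ (by positivity), ← ENNReal.rpow_mul, ← ENNReal.rpow_mul]
          congr 1
          · congr 1; ring
          · rw [show θ * (1 / 2 * Q) = 1 by rw [hθ]; field_simp, ENNReal.rpow_one]
  have hBp : B ^ ((1 - θ) * (Q / 2)) ≠ ∞ :=
    ENNReal.rpow_ne_top_of_nonneg (mul_nonneg (by linarith) (by positivity)) hBt
  have h_integ : ∫⁻ t, lorentz r 2 volume (GG α (U0 t u0 : Cfg m n N → ℂ)) ^ Q ≤ K * B ^ (Q / 2) := by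
    refine (lintegral_mono hpt).trans ?_
    rw [lintegral_const_mul' _ _ hBp, lintegral_const_mul' _ _ (by simp)]
    have := hDU.strichartz u0
    calc _ ≤ B ^ ((1 - θ) * (Q / 2)) * (ENNReal.ofReal (2 ^ m) * (ENNReal.ofReal (KTc A) * B)) := by
          gcongr
      _ = K * (B ^ ((1 - θ) * (Q / 2)) * B ^ (1:ℝ)) := by rw [ENNReal.rpow_one, hK]; ring
      _ = _ := by
          rw [← ENNReal.rpow_add_of_nonneg _ _ (mul_nonneg (by linarith) (by positivity)) (by norm_num)]
          congr 2
          rw [hθ]; field_simp; ring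
  refine (ENNReal.rpow_le_rpow h_integ (by positivity)).trans ?_
  rw [ENNReal.mul_rpow_of_nonneg _ _ (by positivity), ← ENNReal.rpow_mul, hB, ← ENNReal.rpow_two,
    ← ENNReal.rpow_mul, show (2 * (Q / 2 * (1 / Q))) = 1 by field_simp, ENNReal.rpow_one]
  refine mul_le_mul' ?_ le_rfl
  have hf : K ^ (1 / Q) ≠ ∞ := ENNReal.rpow_ne_top_of_nonneg (by positivity) hKt
  calc K ^ (1 / Q) = ENNReal.ofReal ((K ^ (1 / Q)).toReal) := (ENNReal.ofReal_toReal hf).symm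
    _ ≤ _ := ENNReal.ofReal_le_ofReal (by linarith)

end PartFour
end ManyBodyWaveguide

namespace ManyBodyWaveguide
section PartFive
variable {m n N : ℕ}

/-- squared Euclidean length of all Euclidean components -/
def SS (x : Cfg m n N) : ℝ := ∑ β, ∑ i, (x β).1 i ^ 2

lemma SS_nonneg (x : Cfg m n N) : 0 ≤ SS x :=
  Finset.sum_nonneg fun _ _ => Finset.sum_nonneg fun _ _ => sq_nonneg _

lemma SS_continuous : Continuous (SS : Cfg m n N → ℝ) := by
  unfold SS; fun_prop

lemma gauss_integrable_pi {ι : Type*} [Fintype ι] {c : ℝ} (hc : 0 < c) :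
    Integrable (fun y : ι → ℝ => Real.exp (-c * ∑ i, y i ^ 2)) := by
  have := Integrable.fintype_prod (f := fun (_ : ι) (x : ℝ) => Real.exp (-c * x ^ 2))
    (fun _ => integrable_exp_neg_mul_sq hc)
  refine this.congr (Filter.Eventually.of_forall fun y => ?_)
  simp only
  rw [← Real.exp_sum, Finset.mul_sum]

lemma gauss_integrable {c : ℝ} (hc : 0 < c) :
    Integrable (fun x : Cfg m n N => Real.exp (-c * SS x)) := by
  have h1 : Integrable (fun w : Wg m n => Real.exp (-c * ∑ i, w.1 i ^ 2)) := by
    have := (gauss_integrable_pi (ι := Fin m) hc).mul_prod (integrable_const (μ := (volume : Measure (Torus n))) (1:ℝ))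
    simp only [mul_one] at this
    exact this
  have := Integrable.fintype_prod (f := fun (_ : Fin N) (w : Wg m n) => Real.exp (-c * ∑ i, w.1 i ^ 2))
    (fun _ => h1)
  refine this.congr (Filter.Eventually.of_forall fun y => ?_)
  simp only [SS]
  rw [← Real.exp_sum, Finset.mul_sum]

lemma gauss_memLp {c : ℝ} (hc : 0 < c) :
    MemLp (fun x : Cfg m n N => Real.exp (-c * SS x)) 2 := by
  rw [memLp_two_iff_integrable_sq (by
    exact (Real.continuous_exp.comp (continuous_const.mul SS_continuous)).aestronglyMeasurable)]
  refine (gauss_integrable (m := m) (n := n) (N := N) (c := 2 * c) (by positivity)).congr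
    (Filter.Eventually.of_forall fun x => ?_)
  simp only
  rw [← Real.exp_nat_mul]; congr 1; push_cast; ring

lemma memLp_of_bound {f : Cfg m n N → ℂ} (hf : AEStronglyMeasurable f volume) {c C : ℝ} (hc : 0 < c)
    (h : ∀ x, ‖f x‖ ≤ C * Real.exp (-c * SS x)) : MemLp f 2 :=
  ((gauss_memLp hc).const_mul C).mono' hf (Filter.Eventually.of_forall h)

lemma norm_le_of_bound {c : ℝ} (hc : 0 < c) : ∃ B : ℝ, 0 ≤ B ∧ ∀ (f : Cfg m n N → ℂ) (hf : MemLp f 2) (C : ℝ),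
    (∀ x, ‖f x‖ ≤ C * Real.exp (-c * SS x)) → ‖hf.toLp f‖ ≤ C * B := by
  refine ⟨‖(gauss_memLp (m := m) (n := n) (N := N) hc).toLp _‖, norm_nonneg _, fun f hf C h => ?_⟩
  refine Lp.norm_le_mul_norm_of_ae_le_mul ?_
  filter_upwards [hf.coeFn_toLp, (gauss_memLp (m := m) (n := n) (N := N) hc).coeFn_toLp] with x h1 h2
  rw [h1, h2, Real.norm_of_nonneg (Real.exp_pos _).le]
  exact h x

/-- polynomial times Gaussian is dominated by a Gaussian -/
lemma poly_gauss {c : ℝ} (hc : 0 < c) : ∃ B : ℝ, 0 ≤ B ∧ ∀ S : ℝ, 0 ≤ S →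
    (1 + S) ^ 2 * Real.exp (-c * S) ≤ B * Real.exp (-(c / 2) * S) := by
  refine ⟨2 * Real.exp (c/2) * ((2/c)^2) , by positivity, fun S hS => ?_⟩
  have h1 : (1 + S) ^ 2 ≤ 2 * Real.exp (c/2) * ((2/c)^2) * Real.exp (c / 2 * S) := by
    have h2 := Real.quadratic_le_exp_of_nonneg (x := c / 2 * (1 + S)) (by positivity)
    have h3 : Real.exp (c / 2 * (1 + S)) = Real.exp (c/2) * Real.exp (c / 2 * S) := by
      rw [← Real.exp_add]; congr 1; ring
    rw [h3] at h2
    have h4 : (c / 2 * (1 + S)) ^ 2 / 2 ≤ Real.exp (c/2) * Real.exp (c / 2 * S) := by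
      have : 0 ≤ c / 2 * (1 + S) := by positivity
      linarith
    calc (1 + S) ^ 2 = 2 * (2/c)^2 * ((c / 2 * (1 + S)) ^ 2 / 2) := by field_simp
      _ ≤ 2 * (2/c)^2 * (Real.exp (c/2) * Real.exp (c / 2 * S)) := by gcongr
      _ = _ := by ring
  calc _ ≤ 2 * Real.exp (c/2) * ((2/c)^2) * Real.exp (c / 2 * S) * Real.exp (-c * S) := by gcongr
    _ = _ := by rw [mul_assoc (2 * Real.exp (c/2) * ((2/c)^2)), ← Real.exp_add]; congr 2; ring

/-- complex time parameter -/
def sP (t : ℝ) : ℂ := 1 + 2 * Complex.I * t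

lemma sP_re (t : ℝ) : (sP t).re = 1 := by simp [sP]
lemma sP_im (t : ℝ) : (sP t).im = 2 * t := by simp [sP]
lemma sP_ne (t : ℝ) : sP t ≠ 0 := fun h => by have := sP_re t; rw [h] at this; simp at this
lemma sP_slit (t : ℝ) : sP t ∈ Complex.slitPlane := Or.inl (by rw [sP_re]; norm_num)
lemma sP_zero : sP 0 = 1 := by simp [sP]
lemma sP_normSq (t : ℝ) : Complex.normSq (sP t) = 1 + 4 * t ^ 2 := by
  rw [Complex.normSq_apply, sP_re, sP_im]; ring
lemma sP_norm (t : ℝ) : 1 ≤ ‖sP t‖ := by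
  have := Complex.abs_re_le_norm (sP t); rw [sP_re] at this; simpa using this

def kap (t : ℝ) : ℝ := (1 + 4 * t ^ 2)⁻¹
lemma kap_pos (t : ℝ) : 0 < kap t := by unfold kap; positivity
lemma sP_inv (t : ℝ) : (sP t)⁻¹ = kap t * (1 - 2 * Complex.I * t) := by
  have h : sP t * (1 - 2 * Complex.I * t) = (1 + 4 * t ^ 2 : ℝ) := by
    simp only [sP]; push_cast; ring_nf; simp
  have h1 : ((1 + 4 * t ^ 2 : ℝ) : ℂ) ≠ 0 := by
    have : (1 + 4 * t ^ 2 : ℝ) ≠ 0 := by positivity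
    exact_mod_cast this
  rw [kap, Complex.ofReal_inv, ← h]
  have h2 := sP_ne t
  have h3 : (1 - 2 * Complex.I * t) ≠ 0 := fun h0 => by rw [h0, mul_zero] at h; exact h1 h.symm
  field_simp

/-- one particle Gaussian -/
def gP (t : ℝ) (ξ y : Fin m → ℝ) : ℂ :=
  Complex.exp (-((m:ℂ)/2) * Complex.log (sP t) - (2 * sP t)⁻¹ * ∑ i, ((y i : ℂ) - Complex.I * ξ i) ^ 2)

/-- one particle torus mode -/
def tP (t : ℝ) (k : Fin n → ℤ) (z : Torus n) : ℂ :=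
  Complex.exp (-(4 * Real.pi ^ 2 * Complex.I * t * ∑ j, (k j : ℂ) ^ 2)) * ∏ j, fourier (k j) (z j)

/-- wave packets -/
def Pk (t : ℝ) (ξ : Fin N → Fin m → ℝ) (k : Fin N → Fin n → ℤ) (x : Cfg m n N) : ℂ :=
  ∏ β, (gP t (ξ β) (x β).1 * tP t (k β) (x β).2)

lemma gP_re (t : ℝ) (ξ y : Fin m → ℝ) :
    (-((m:ℂ)/2) * Complex.log (sP t) - (2 * sP t)⁻¹ * ∑ i, ((y i : ℂ) - Complex.I * ξ i) ^ 2).re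
      = -(m/2) * Real.log ‖sP t‖ - kap t / 2 * ∑ i, (y i ^ 2 - ξ i ^ 2 - 4 * t * y i * ξ i) := by
  rw [Complex.sub_re]
  congr 1
  · have : (-((m:ℂ)/2) * Complex.log (sP t)) = ((-(m/2) : ℝ) : ℂ) * Complex.log (sP t) := by push_cast; ring
    rw [this, Complex.re_ofReal_mul, Complex.log_re]
  · rw [mul_inv, sP_inv, Finset.mul_sum, Finset.mul_sum, Complex.re_sum]
    refine Finset.sum_congr rfl fun i _ => ?_
    have : (2:ℂ)⁻¹ * (kap t * (1 - 2 * Complex.I * t)) * ((y i : ℂ) - Complex.I * ξ i) ^ 2 =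
      ((kap t / 2 : ℝ) : ℂ) * (((y i ^ 2 - ξ i ^ 2 - 4 * t * y i * ξ i : ℝ) : ℂ) +
        ((-2 * y i * ξ i - 2 * t * (y i ^ 2 - ξ i ^ 2) : ℝ) : ℂ) * Complex.I) := by
      push_cast
      ring_nf
      simp only [Complex.I_sq, Complex.I_pow_three]
      ring
    rw [this, Complex.re_ofReal_mul, Complex.add_re, Complex.ofReal_re, Complex.re_ofReal_mul, Complex.I_re]; ring

lemma gP_norm_le (t : ℝ) (ξ y : Fin m → ℝ) :
    ‖gP t ξ y‖ ≤ Real.exp (∑ i, ξ i ^ 2) * Real.exp (-(kap t / 4) * ∑ i, y i ^ 2) := by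
  rw [gP, Complex.norm_exp, gP_re, ← Real.exp_add]
  refine Real.exp_le_exp.2 ?_
  have h1 : 0 ≤ (m/2:ℝ) * Real.log ‖sP t‖ := by
    have := Real.log_nonneg (sP_norm t); positivity
  have h2 : -(kap t / 2) * ∑ i, (y i ^ 2 - ξ i ^ 2 - 4 * t * y i * ξ i) ≤
      ∑ i, (ξ i ^ 2 + -(kap t / 4) * y i ^ 2) := by
    rw [Finset.mul_sum]
    refine Finset.sum_le_sum fun i _ => ?_
    have hk := kap_pos t
    have hk2 : kap t * (1 + 4 * t ^ 2) = 1 := inv_mul_cancel₀ (by positivity)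
    nlinarith [mul_nonneg hk.le (sq_nonneg (y i - 4 * t * ξ i)), mul_nonneg hk.le (sq_nonneg (ξ i)), sq_nonneg (ξ i),
      congrArg (fun w => w * ξ i ^ 2) hk2]
  rw [Finset.sum_add_distrib, ← Finset.mul_sum] at h2
  linarith

lemma tP_norm (t : ℝ) (k : Fin n → ℤ) (z : Torus n) : ‖tP t k z‖ = 1 := by
  unfold tP
  rw [norm_mul, norm_prod, Complex.norm_exp]
  have h : ∀ j, ‖(fourier (k j) : C(AddCircle (1:ℝ), ℂ)) (z j)‖ = 1 := fun j => by
    rw [fourier_apply]; exact Circle.norm_coe _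
  simp only [h, Finset.prod_const_one, mul_one]
  have : -(4 * (Real.pi:ℂ) ^ 2 * Complex.I * t * ∑ j, (k j : ℂ) ^ 2) =
    ((-(4 * Real.pi ^ 2 * t * ∑ j, (k j : ℝ) ^ 2) : ℝ) : ℂ) * Complex.I := by push_cast; ring
  rw [this, Complex.re_ofReal_mul]; simp

lemma gP_ne (t : ℝ) (ξ y : Fin m → ℝ) : gP t ξ y ≠ 0 := Complex.exp_ne_zero _

def xis (ξ : Fin N → Fin m → ℝ) : ℝ := Real.exp (∑ β, ∑ i, ξ β i ^ 2)

lemma Pk_norm_le (t : ℝ) (ξ : Fin N → Fin m → ℝ) (k : Fin N → Fin n → ℤ) (x : Cfg m n N) :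
    ‖Pk t ξ k x‖ ≤ xis ξ * Real.exp (-(kap t / 4) * SS x) := by
  unfold Pk xis SS
  rw [norm_prod, Real.exp_sum, Finset.mul_sum, Real.exp_sum, ← Finset.prod_mul_distrib]
  refine Finset.prod_le_prod (fun _ _ => norm_nonneg _) fun β _ => ?_
  rw [norm_mul, tP_norm, mul_one]
  exact gP_norm_le _ _ _

lemma gP_continuous (t : ℝ) (ξ : Fin m → ℝ) : Continuous (gP t ξ) := by
  unfold gP; fun_prop
lemma tP_continuous (t : ℝ) (k : Fin n → ℤ) : Continuous (tP t k) := by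
  unfold tP; fun_prop
lemma Pk_continuous (t : ℝ) (ξ : Fin N → Fin m → ℝ) (k : Fin N → Fin n → ℤ) :
    Continuous (Pk t ξ k) := by
  unfold Pk
  refine continuous_finsetProd _ fun β _ => ?_
  exact ((gP_continuous t (ξ β)).comp (continuous_fst.comp (continuous_apply β))).mul
    ((tP_continuous t (k β)).comp (continuous_snd.comp (continuous_apply β)))

lemma Pk_memLp (t : ℝ) (ξ : Fin N → Fin m → ℝ) (k : Fin N → Fin n → ℤ) :
    MemLp (Pk t ξ k) 2 :=
  memLp_of_bound (Pk_continuous t ξ k).aestronglyMeasurable (c := kap t / 4) (by have := kap_pos t; positivity)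
    (Pk_norm_le t ξ k)

/-- packets in `L²` -/
def pkL (t : ℝ) (ξ : Fin N → Fin m → ℝ) (k : Fin N → Fin n → ℤ) : L2 m n N :=
  (Pk_memLp t ξ k).toLp (Pk t ξ k)

end PartFive
end ManyBodyWaveguide

namespace ManyBodyWaveguide
section PartSix
open BoundedContinuousFunction

section gen
variable {E ι : Type*} [PseudoEMetricSpace E] [MeasurableSpace E] [BorelSpace E] [CompleteSpace E]
  [SecondCountableTopology E]

/-- the star algebra spanned by a star-closed monoid of bounded functions -/
def spanAlg (χ : ι → E →ᵇ ℂ) (hone : ∃ i, χ i = 1) (hmul : ∀ i j, ∃ k, χ k = χ i * χ j)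
    (hstar : ∀ i, ∃ k, χ k = star (χ i)) : StarSubalgebra ℂ (E →ᵇ ℂ) where
  carrier := Submodule.span ℂ (Set.range χ)
  mul_mem' := by
    intro a b ha hb
    simp only [SetLike.mem_coe] at ha hb ⊢
    have h := Submodule.mul_mem_mul ha hb
    rw [Submodule.span_mul_span] at h
    refine Submodule.span_mono ?_ h
    rintro _ ⟨_, ⟨i, rfl⟩, _, ⟨j, rfl⟩, rfl⟩
    obtain ⟨k, hk⟩ := hmul i j
    exact ⟨k, hk⟩
  one_mem' := by
    obtain ⟨i, hi⟩ := hone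
    rw [← hi]; exact Submodule.subset_span ⟨i, rfl⟩
  add_mem' := fun ha hb => Submodule.add_mem _ ha hb
  zero_mem' := Submodule.zero_mem _
  algebraMap_mem' := by
    intro r
    obtain ⟨i, hi⟩ := hone
    rw [Algebra.algebraMap_eq_smul_one, ← hi]
    exact Submodule.smul_mem _ _ (Submodule.subset_span ⟨i, rfl⟩)
  star_mem' := by
    intro a ha
    simp only [SetLike.mem_coe] at ha ⊢
    induction ha using Submodule.span_induction with
    | mem x hx =>
      obtain ⟨i, rfl⟩ := hx
      obtain ⟨k, hk⟩ := hstar i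
      rw [← hk]; exact Submodule.subset_span ⟨k, rfl⟩
    | zero => rw [star_zero]; exact Submodule.zero_mem _
    | add x y _ _ hx hy => rw [star_add]; exact Submodule.add_mem _ hx hy
    | smul c x _ hx => rw [star_smul]; exact Submodule.smul_mem _ _ hx

lemma gen_zero_real {μ : Measure E} {A : StarSubalgebra ℂ (E →ᵇ ℂ)}
    (hA : (A.map (toContinuousMapStarₐ ℂ)).SeparatesPoints)
    {f : E → ℝ} (hf : Integrable f μ) (h : ∀ a ∈ A, ∫ x, a x * (f x : ℂ) ∂μ = 0) : f =ᵐ[μ] 0 := by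
  have hfp := hf.real_toNNReal
  have key : ∀ (g : E → ℝ), Integrable g μ → ∀ a : E →ᵇ ℂ,
      ∫ x, a x ∂(μ.withDensity (fun x => ENNReal.ofReal (g x))) = ∫ x, a x * ((max (g x) 0 : ℝ) : ℂ) ∂μ := by
    intro g hg a
    rw [integral_withDensity_eq_integral_toReal_smul₀ hg.aestronglyMeasurable.aemeasurable.ennreal_ofReal (by simp)]
    refine integral_congr_ae (Filter.Eventually.of_forall fun x => ?_)
    simp only [ENNReal.toReal_ofReal', Complex.real_smul]
    ring
  have fin : ∀ (g : E → ℝ), Integrable g μ → IsFiniteMeasure (μ.withDensity (fun x => ENNReal.ofReal (g x))) := by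
    intro g hg
    refine isFiniteMeasure_withDensity_ofReal hg.2
  have := fin f hf
  have := fin _ hf.neg
  have hm : μ.withDensity (fun x => ENNReal.ofReal (f x)) = μ.withDensity (fun x => ENNReal.ofReal ((-f) x)) := by
    refine ext_of_forall_mem_subalgebra_integral_eq_of_pseudoEMetric_complete_countable hA fun a ha => ?_
    rw [key f hf, key _ hf.neg, ← sub_eq_zero]
    have h_integ : ∀ g : E → ℝ, Integrable g μ → Integrable (fun x => a x * ((max (g x) 0 : ℝ) : ℂ)) μ := by
      intro g hg
      refine Integrable.bdd_mul (c := ‖a‖) (hg.pos_part.ofReal) a.continuous.aestronglyMeasurable ?_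
      exact Filter.Eventually.of_forall a.norm_coe_le_norm
    rw [← integral_sub (h_integ f hf) (h_integ _ hf.neg), ← h a ha]
    refine integral_congr_ae (Filter.Eventually.of_forall fun x => ?_)
    simp only [Pi.neg_apply]
    rw [← mul_sub, ← Complex.ofReal_sub]
    congr 2
    rcases le_total 0 (f x) with h0 | h0
    · rw [max_eq_left h0, max_eq_right (by linarith)]; ring
    · rw [max_eq_right h0, max_eq_left (by linarith)]; ring
  have h2 := (withDensity_eq_iff hf.aestronglyMeasurable.aemeasurable.ennreal_ofReal
    hf.neg.aestronglyMeasurable.aemeasurable.ennreal_ofReal hf.lintegral_lt_top.ne).1 hm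
  filter_upwards [h2] with x hx
  simp only [Pi.neg_apply, Pi.zero_apply] at hx ⊢
  rcases le_total 0 (f x) with h0 | h0
  · rw [ENNReal.ofReal_of_nonpos (p := - f x) (by linarith), ENNReal.ofReal_eq_zero] at hx; linarith
  · rw [ENNReal.ofReal_of_nonpos h0, eq_comm, ENNReal.ofReal_eq_zero] at hx; linarith

lemma gen_zero {μ : Measure E} (χ : ι → E →ᵇ ℂ) (hone : ∃ i, χ i = 1) (hmul : ∀ i j, ∃ k, χ k = χ i * χ j)
    (hstar : ∀ i, ∃ k, χ k = star (χ i)) (hsep : ∀ x y, x ≠ y → ∃ i, χ i x ≠ χ i y)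
    {g : E → ℂ} (hg : Integrable g μ) (h : ∀ i, ∫ x, χ i x * g x ∂μ = 0) : g =ᵐ[μ] 0 := by
  set A := spanAlg χ hone hmul hstar with hA
  have hsepA : (A.map (toContinuousMapStarₐ ℂ)).SeparatesPoints := by
    intro x y hxy
    obtain ⟨i, hi⟩ := hsep x y hxy
    use χ i
    simp only [StarSubalgebra.coe_toSubalgebra, StarSubalgebra.coe_map, Set.mem_image,
      SetLike.mem_coe, exists_exists_and_eq_and, ne_eq]
    exact ⟨⟨χ i, Submodule.subset_span ⟨i, rfl⟩, rfl⟩, hi⟩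
  have h_integ : ∀ a : E →ᵇ ℂ, ∀ f : E → ℂ, Integrable f μ → Integrable (fun x => a x * f x) μ := by
    intro a f hf
    refine Integrable.bdd_mul (c := ‖a‖) hf a.continuous.aestronglyMeasurable ?_
    exact Filter.Eventually.of_forall a.norm_coe_le_norm
  have hall : ∀ a ∈ A, ∫ x, a x * g x ∂μ = 0 := by
    intro a ha
    change a ∈ Submodule.span ℂ (Set.range χ) at ha
    induction ha using Submodule.span_induction with
    | mem x hx => obtain ⟨i, rfl⟩ := hx; exact h i
    | zero => simp
    | add x y _ _ hx hy =>
      simp only [BoundedContinuousFunction.add_apply, add_mul]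
      rw [integral_add (h_integ _ _ hg) (h_integ _ _ hg), hx, hy, add_zero]
    | smul c x _ hx =>
      simp only [BoundedContinuousFunction.smul_apply, smul_eq_mul, mul_assoc]
      rw [integral_const_mul, hx, mul_zero]
  have hconj : ∀ a ∈ A, ∫ x, a x * (starRingEnd ℂ) (g x) ∂μ = 0 := by
    intro a ha
    have := hall (star a) (star_mem ha)
    have h2 := congrArg (starRingEnd ℂ) this
    rw [← integral_conj] at h2
    simpa using h2
  have hre := gen_zero_real hsepA hg.re (fun a ha => by
    have : ∀ x, a x * ((RCLike.re (g x) : ℝ) : ℂ) = (1/2 : ℂ) * (a x * g x + a x * (starRingEnd ℂ) (g x)) := by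
      intro x
      have := Complex.re_eq_add_conj (g x)
      simp only [RCLike.re_eq_complex_re]
      rw [this]; ring
    simp only [this]
    rw [integral_const_mul, integral_add (h_integ _ _ hg) (h_integ a (fun x => (starRingEnd ℂ) (g x)) (by
      exact Complex.conjLIE.toContinuousLinearEquiv.toContinuousLinearMap.integrable_comp hg)), hall a ha, hconj a ha]; simp)
  have him := gen_zero_real hsepA hg.im (fun a ha => by
    have : ∀ x, a x * ((RCLike.im (g x) : ℝ) : ℂ) = (1/(2 * Complex.I) : ℂ) * (a x * g x - a x * (starRingEnd ℂ) (g x)) := by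
      intro x
      have := Complex.im_eq_sub_conj (g x)
      simp only [RCLike.im_eq_complex_im]
      rw [this]; ring
    simp only [this]
    rw [integral_const_mul, integral_sub (h_integ _ _ hg) (h_integ a (fun x => (starRingEnd ℂ) (g x)) (by
      exact Complex.conjLIE.toContinuousLinearEquiv.toContinuousLinearMap.integrable_comp hg)), hall a ha, hconj a ha]; simp)
  filter_upwards [hre, him] with x h1 h2
  exact Complex.ext h1 h2
end gen

variable {m n N : ℕ}

/-- characters of the configuration space -/
def chr (ξ : Fin N → Fin m → ℝ) (k : Fin N → Fin n → ℤ) (x : Cfg m n N) : ℂ :=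
  ∏ β, (Complex.exp (Complex.I * ∑ i, (ξ β i : ℂ) * (x β).1 i) * ∏ j, fourier (k β j) ((x β).2 j))

lemma fourier_norm' (k : ℤ) (z : AddCircle (1:ℝ)) : ‖(fourier k : C(AddCircle (1:ℝ), ℂ)) z‖ = 1 := by
  rw [fourier_apply]; exact Circle.norm_coe _

lemma chr_norm (ξ : Fin N → Fin m → ℝ) (k : Fin N → Fin n → ℤ) (x : Cfg m n N) : ‖chr ξ k x‖ = 1 := by
  unfold chr
  rw [norm_prod]
  refine Finset.prod_eq_one fun β _ => ?_
  rw [norm_mul, norm_prod]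
  simp only [fourier_norm', Finset.prod_const_one, mul_one]
  have : (Complex.I * ∑ i, (ξ β i : ℂ) * (x β).1 i) = ((∑ i, ξ β i * (x β).1 i : ℝ) : ℂ) * Complex.I := by
    push_cast; ring
  rw [this, Complex.norm_exp_ofReal_mul_I]

lemma chr_continuous (ξ : Fin N → Fin m → ℝ) (k : Fin N → Fin n → ℤ) :
    Continuous (chr ξ k : Cfg m n N → ℂ) := by
  unfold chr
  refine continuous_finsetProd _ fun β _ => ?_
  refine Continuous.mul (by fun_prop) ?_
  refine continuous_finsetProd _ fun j _ => ?_
  exact (fourier (k β j)).continuous.comp (by fun_prop)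

def chrB (p : (Fin N → Fin m → ℝ) × (Fin N → Fin n → ℤ)) : Cfg m n N →ᵇ ℂ :=
  BoundedContinuousFunction.ofNormedAddCommGroup (chr p.1 p.2) (chr_continuous _ _) 1
    (fun x => (chr_norm _ _ x).le)

lemma chrB_apply (p : (Fin N → Fin m → ℝ) × (Fin N → Fin n → ℤ)) (x : Cfg m n N) :
  chrB p x = chr p.1 p.2 x := rfl

lemma chr_mul (ξ η : Fin N → Fin m → ℝ) (k l : Fin N → Fin n → ℤ) (x : Cfg m n N) :
    chr (ξ + η) (k + l) x = chr ξ k x * chr η l x := by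
  unfold chr
  rw [← Finset.prod_mul_distrib]
  refine Finset.prod_congr rfl fun β _ => ?_
  simp only [Pi.add_apply, Complex.ofReal_add, add_mul, Finset.sum_add_distrib, mul_add, Complex.exp_add,
    fourier_add, Finset.prod_mul_distrib]
  ring

lemma chr_star (ξ : Fin N → Fin m → ℝ) (k : Fin N → Fin n → ℤ) (x : Cfg m n N) :
    chr (-ξ) (-k) x = (starRingEnd ℂ) (chr ξ k x) := by
  unfold chr
  simp only [map_prod, map_mul, ← Complex.exp_conj, map_sum, Pi.neg_apply, fourier_neg, Complex.conj_I, Complex.conj_ofReal]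
  refine Finset.prod_congr rfl fun β _ => ?_
  congr 2
  simp

lemma chr_sep (x y : Cfg m n N) (h : ∀ ξ k, chr ξ k x = chr ξ k y) : x = y := by
  funext β
  refine Prod.ext ?_ ?_
  · funext i
    have h1 : ∀ s : ℝ, Complex.exp (Complex.I * (s * (x β).1 i)) = Complex.exp (Complex.I * (s * (y β).1 i)) := by
      intro s
      have := h (Pi.single β (Pi.single i s)) 0
      unfold chr at this
      have key : ∀ w : Cfg m n N, (∏ γ, (Complex.exp (Complex.I * ∑ a, ((Pi.single β (Pi.single i s) : Fin N → Fin m → ℝ) γ a : ℂ) * (w γ).1 a) * ∏ j, (fourier ((0 : Fin N → Fin n → ℤ) γ j) : C(AddCircle (1:ℝ), ℂ)) ((w γ).2 j))) = Complex.exp (Complex.I * (s * (w β).1 i)) := by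
        intro w
        rw [Finset.prod_eq_single β]
        · simp only [Pi.single_eq_same, Pi.zero_apply, fourier_zero, Finset.prod_const_one, mul_one]
          rw [Finset.sum_eq_single i]
          · simp
          · intro a _ ha; simp [ha]
          · simp
        · intro γ _ hγ; simp [hγ]
        · simp
      rw [key, key] at this
      exact this
    by_contra hne
    have hd : (x β).1 i - (y β).1 i ≠ 0 := sub_ne_zero.2 hne
    have := h1 (Real.pi / ((x β).1 i - (y β).1 i))
    have h2 : Complex.exp (Complex.I * ((Real.pi / ((x β).1 i - (y β).1 i) : ℝ) * (x β).1 i) - Complex.I * ((Real.pi / ((x β).1 i - (y β).1 i) : ℝ) * (y β).1 i)) = 1 := by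
      rw [Complex.exp_sub, this, div_self (Complex.exp_ne_zero _)]
    have h3 : (Complex.I * ((Real.pi / ((x β).1 i - (y β).1 i) : ℝ) * (x β).1 i) - Complex.I * ((Real.pi / ((x β).1 i - (y β).1 i) : ℝ) * (y β).1 i)) = Real.pi * Complex.I := by
      have : (((x β).1 i : ℂ) - (y β).1 i) ≠ 0 := by exact_mod_cast hd
      push_cast
      field_simp
    rw [h3, Complex.exp_pi_mul_I] at h2
    norm_num at h2
  · funext j
    have := h 0 (Pi.single β (Pi.single j 1))
    have key : ∀ w : Cfg m n N, chr 0 (Pi.single β (Pi.single j 1)) w = (fourier 1 : C(AddCircle (1:ℝ), ℂ)) ((w β).2 j) := by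
      intro w
      unfold chr
      rw [Finset.prod_eq_single β]
      · rw [Finset.prod_eq_single j]
        · simp
        · intro a _ ha; simp [ha]
        · simp
      · intro γ _ hγ; simp [hγ]
      · simp
    rw [key, key, fourier_one, fourier_one] at this
    exact AddCircle.injective_toCircle one_ne_zero (Circle.coe_injective this)

lemma wg_borel : BorelSpace (Wg m n) := inferInstance
lemma wg_sct : SecondCountableTopology (Wg m n) := inferInstance
instance cfg_borel : BorelSpace (Cfg m n N) :=
  @Pi.borelSpace (Fin N) (fun _ => Wg m n) _ _ _ (fun _ => wg_sct) (fun _ => wg_borel)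

lemma chr_zero_of {g : Cfg m n N → ℂ} (hg : Integrable g) (h : ∀ ξ k, ∫ x, chr ξ k x * g x = 0) :
    g =ᵐ[volume] 0 := by
  refine gen_zero (chrB (m := m) (n := n) (N := N)) ⟨(0, 0), ?_⟩ ?_ ?_ ?_ hg (fun p => h p.1 p.2)
  · ext x; rw [chrB_apply]; simp [chr]
  · intro p q; refine ⟨p + q, ?_⟩; ext x
    simp only [chrB_apply, BoundedContinuousFunction.mul_apply]; exact chr_mul _ _ _ _ _
  · intro p; refine ⟨-p, ?_⟩; ext x
    simp only [chrB_apply, BoundedContinuousFunction.star_apply]; exact chr_star _ _ _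
  · intro x y hxy
    by_contra! hcon
    exact hxy (chr_sep x y fun ξ k => hcon (ξ, k))

end PartSix
end ManyBodyWaveguide

namespace ManyBodyWaveguide
section PartSeven
variable {m n N : ℕ}

lemma wchr_memLp {W : Cfg m n N → ℝ} (hW : MemLp W 2) (ξ : Fin N → Fin m → ℝ) (k : Fin N → Fin n → ℤ) :
    MemLp (fun x => (W x : ℂ) * chr ξ k x) 2 := by
  have hW' : MemLp (fun x => (W x : ℂ)) 2 := hW.ofReal
  refine hW'.of_le (hW'.1.mul (chr_continuous ξ k).aestronglyMeasurable) ?_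
  refine Filter.Eventually.of_forall fun x => ?_
  rw [norm_mul, chr_norm, mul_one]

def wchr {W : Cfg m n N → ℝ} (hW : MemLp W 2) (p : (Fin N → Fin m → ℝ) × (Fin N → Fin n → ℤ)) : L2 m n N :=
  (wchr_memLp hW p.1 p.2).toLp _

lemma wchr_dense {W : Cfg m n N → ℝ} (hW : MemLp W 2) (hpos : ∀ x, 0 < W x) :
    (Submodule.span ℂ (Set.range (wchr hW))).topologicalClosure = ⊤ := by
  rw [Submodule.topologicalClosure_eq_top_iff, Submodule.eq_bot_iff]
  intro v hv
  have hv2 : ∀ p, inner ℂ v (wchr hW p) = 0 := fun p =>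
    (Submodule.mem_orthogonal' _ v).1 hv _ (Submodule.subset_span ⟨p, rfl⟩)
  have h_integ : Integrable (fun x => (W x : ℂ) * (starRingEnd ℂ) (v x)) := by
    have hv' : MemLp (fun x => (starRingEnd ℂ) (v x)) 2 := by
      refine (Lp.memLp v).of_le (Complex.continuous_conj.comp_aestronglyMeasurable (Lp.aestronglyMeasurable v)) ?_
      exact Filter.Eventually.of_forall fun x => by simp
    have hW' : MemLp (fun x => (W x : ℂ)) 2 := hW.ofReal
    exact hW'.integrable_mul hv'
  have := chr_zero_of h_integ (fun ξ k => by
    rw [← hv2 (ξ, k), MeasureTheory.L2.inner_def]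
    refine integral_congr_ae ?_
    filter_upwards [(wchr_memLp hW ξ k).coeFn_toLp] with x hx
    rw [wchr, hx]
    simp only [RCLike.inner_apply]
    ring)
  refine Lp.ext ?_
  filter_upwards [this, Lp.coeFn_zero ℂ 2 (volume : Measure (Cfg m n N))] with x hx h0
  rw [h0]
  simp only [Pi.zero_apply, mul_eq_zero, Complex.ofReal_eq_zero, (hpos x).ne', false_or, map_eq_zero] at hx
  simpa using hx

lemma secondDeriv_eq {E : Type*} [NormedAddCommGroup E] [NormedSpace ℝ E] {f : E → ℂ} (hf : ContDiff ℝ 2 f)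
    {x v : E} {h1 : ℝ → ℂ} {h2 : ℂ} (h : ∀ τ, HasDerivAt (fun τ : ℝ => f (x + τ • v)) (h1 τ) τ)
    (hh : HasDerivAt h1 h2 0) : secondDeriv f x v = h2 := by
  have hline : ∀ τ : ℝ, HasDerivAt (fun τ : ℝ => x + τ • v) v τ := fun τ => by
    simpa using ((hasDerivAt_id τ).smul_const v).const_add x
  have e1 : ∀ τ : ℝ, fderiv ℝ f (x + τ • v) v = h1 τ := fun τ =>
    (((hf.differentiable (by norm_num)) _).hasFDerivAt.comp_hasDerivAt τ (hline τ)).unique (h τ)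
  have hd : Differentiable ℝ (fun y => fderiv ℝ f y v) := by
    have : ContDiff ℝ 1 (fderiv ℝ f) := hf.fderiv_right (by norm_num)
    exact ((this.clm_apply contDiff_const)).differentiable (by norm_num)
  have e2 : HasDerivAt (fun τ : ℝ => fderiv ℝ f (x + τ • v) v) (secondDeriv f x v) 0 := by
    have := ((hd (x + (0:ℝ) • v)).hasFDerivAt.comp_hasDerivAt (0:ℝ) (hline 0))
    unfold secondDeriv
    simpa [Function.comp_def] using this
  simp only [e1] at e2
  exact e2.unique hh

/-- the cutoff profile -/
def rhoC (u : ℝ) : ℝ := Real.smoothTransition (2 - u)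
lemma rhoC_contDiff {k : ℕ∞} : ContDiff ℝ k rhoC := by
  unfold rhoC; exact Real.smoothTransition.contDiff.comp (by fun_prop)
lemma rhoC_one {u : ℝ} (h : u ≤ 1) : rhoC u = 1 := Real.smoothTransition.one_of_one_le (by linarith)
lemma rhoC_zero {u : ℝ} (h : 2 ≤ u) : rhoC u = 0 := Real.smoothTransition.zero_of_nonpos (by linarith)
lemma rhoC_sub {u : ℝ} (h : 0 ≤ u) : |rhoC u - 1| ≤ u := by
  rcases le_total u 1 with h1 | h1
  · rw [rhoC_one h1]; simpa using h
  · have := Real.smoothTransition.nonneg (2 - u)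
    have := Real.smoothTransition.le_one (2 - u)
    unfold rhoC
    rw [abs_le]; constructor <;> linarith
lemma rhoC_hd (u : ℝ) : HasDerivAt rhoC (deriv rhoC u) u :=
  ((rhoC_contDiff (k := 1)).differentiable (by norm_num) u).hasDerivAt
lemma rhoC_hd2 (u : ℝ) : HasDerivAt (deriv rhoC) (deriv (deriv rhoC) u) u := by
  have : ContDiff ℝ 1 (deriv rhoC) := by
    have h := (rhoC_contDiff (k := 2))
    have h' : ContDiff ℝ (1 + 1) rhoC := by norm_num; exact_mod_cast h
    exact (contDiff_succ_iff_deriv.1 h').2.2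
  exact (this.differentiable (by norm_num) u).hasDerivAt
lemma rhoC_bdd : ∃ C : ℝ, 0 ≤ C ∧ ∀ u, |deriv rhoC u| ≤ C ∧ |deriv (deriv rhoC) u| ≤ C := by
  have h2 : ContDiff ℝ 1 (deriv rhoC) := by
    have h := (rhoC_contDiff (k := 2))
    have h' : ContDiff ℝ (1 + 1) rhoC := by norm_num; exact_mod_cast h
    exact (contDiff_succ_iff_deriv.1 h').2.2
  have c1 : Continuous (deriv rhoC) := h2.continuous
  have c2 : Continuous (deriv (deriv rhoC)) := h2.continuous_deriv (by norm_num)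
  have lo : ∀ u < 1, deriv rhoC u = 0 := fun u hu => by
    have : rhoC =ᶠ[nhds u] fun _ => 1 := by
      filter_upwards [Iio_mem_nhds hu] with w hw using rhoC_one (le_of_lt hw)
    rw [this.deriv_eq]; simp
  have hi : ∀ u > 2, deriv rhoC u = 0 := fun u hu => by
    have : rhoC =ᶠ[nhds u] fun _ => 0 := by
      filter_upwards [Ioi_mem_nhds hu] with w hw using rhoC_zero (le_of_lt hw)
    rw [this.deriv_eq]; simp
  have lo2 : ∀ u < 1, deriv (deriv rhoC) u = 0 := fun u hu => by
    have : deriv rhoC =ᶠ[nhds u] fun _ => 0 := by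
      filter_upwards [Iio_mem_nhds hu] with w hw using lo w hw
    rw [this.deriv_eq]; simp
  have hi2 : ∀ u > 2, deriv (deriv rhoC) u = 0 := fun u hu => by
    have : deriv rhoC =ᶠ[nhds u] fun _ => 0 := by
      filter_upwards [Ioi_mem_nhds hu] with w hw using hi w hw
    rw [this.deriv_eq]; simp
  obtain ⟨A, hA⟩ := (isCompact_Icc (a := (1:ℝ)) (b := 2)).exists_bound_of_continuousOn c1.continuousOn
  obtain ⟨B, hB⟩ := (isCompact_Icc (a := (1:ℝ)) (b := 2)).exists_bound_of_continuousOn c2.continuousOn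
  refine ⟨max (max A B) 0, le_max_right _ _, fun u => ?_⟩
  by_cases h1 : u < 1
  · rw [lo u h1, lo2 u h1]; simp
  by_cases h3 : u > 2
  · rw [hi u h3, hi2 u h3]; simp
  have hu : u ∈ Set.Icc (1:ℝ) 2 := ⟨not_lt.1 h1, not_lt.1 h3⟩
  exact ⟨(hA u hu).trans ((le_max_left _ _).trans (le_max_left _ _)),
    (hB u hu).trans ((le_max_right _ _).trans (le_max_left _ _))⟩

/-- one dimensional second derivative computation -/
lemma oneD (δ S y c : ℝ) (Φ b a : ℂ) :
    (∀ τ : ℝ, HasDerivAt (fun τ : ℝ => ((rhoC (δ * (S + 2 * y * τ + c * τ ^ 2)) : ℝ) : ℂ) * Complex.exp (Φ + (b * τ - a * τ ^ 2)))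
      ((((deriv rhoC (δ * (S + 2 * y * τ + c * τ ^ 2)) * (δ * (2 * y + 2 * c * τ)) : ℝ) : ℂ)
        + ((rhoC (δ * (S + 2 * y * τ + c * τ ^ 2)) : ℝ) : ℂ) * (b - 2 * a * τ)) * Complex.exp (Φ + (b * τ - a * τ ^ 2))) τ) ∧
    HasDerivAt (fun τ : ℝ => ((((deriv rhoC (δ * (S + 2 * y * τ + c * τ ^ 2)) * (δ * (2 * y + 2 * c * τ)) : ℝ) : ℂ)
        + ((rhoC (δ * (S + 2 * y * τ + c * τ ^ 2)) : ℝ) : ℂ) * (b - 2 * a * τ)) * Complex.exp (Φ + (b * τ - a * τ ^ 2))))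
      ((((rhoC (δ * S) : ℝ) : ℂ) * (b ^ 2 - 2 * a) + ((deriv rhoC (δ * S) : ℝ) : ℂ) * δ * (2 * c + 4 * y * b)
        + ((deriv (deriv rhoC) (δ * S) : ℝ) : ℂ) * δ ^ 2 * (4 * y ^ 2)) * Complex.exp Φ) 0 := by
  have hin : ∀ τ : ℝ, HasDerivAt (fun τ : ℝ => δ * (S + 2 * y * τ + c * τ ^ 2)) (δ * (2 * y + 2 * c * τ)) τ := by
    intro τ
    have h1 := (((hasDerivAt_id τ).const_mul (2 * y)).const_add S).add (((hasDerivAt_id τ).pow 2).const_mul c)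
    refine (h1.const_mul δ).congr_deriv ?_
    simp only [id, Nat.cast_ofNat, Nat.add_one_sub_one, pow_one]; ring
  have hr : ∀ τ : ℝ, HasDerivAt (fun τ : ℝ => ((rhoC (δ * (S + 2 * y * τ + c * τ ^ 2)) : ℝ) : ℂ))
      ((deriv rhoC (δ * (S + 2 * y * τ + c * τ ^ 2)) * (δ * (2 * y + 2 * c * τ)) : ℝ) : ℂ) τ := fun τ =>
    ((rhoC_hd _).comp τ (hin τ)).ofReal_comp
  have hid : ∀ τ : ℝ, HasDerivAt (fun τ : ℝ => (τ : ℂ)) 1 τ := fun τ => by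
    simpa using (hasDerivAt_id τ).ofReal_comp
  have he : ∀ τ : ℝ, HasDerivAt (fun τ : ℝ => Complex.exp (Φ + (b * τ - a * τ ^ 2)))
      (Complex.exp (Φ + (b * τ - a * τ ^ 2)) * (b - 2 * a * τ)) τ := by
    intro τ
    have h1 := (((hid τ).const_mul b).sub (((hid τ).pow 2).const_mul a)).const_add Φ
    refine h1.cexp.congr_deriv ?_
    simp; ring_nf
  constructor
  · intro τ
    refine ((hr τ).mul (he τ)).congr_deriv ?_
    ring
  · have hr2 : HasDerivAt (fun τ : ℝ => ((deriv rhoC (δ * (S + 2 * y * τ + c * τ ^ 2)) * (δ * (2 * y + 2 * c * τ)) : ℝ) : ℂ))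
      ((deriv (deriv rhoC) (δ * (S + 2 * y * 0 + c * 0 ^ 2)) * (δ * (2 * y + 2 * c * 0)) * (δ * (2 * y + 2 * c * 0))
        + deriv rhoC (δ * (S + 2 * y * 0 + c * 0 ^ 2)) * (δ * (2 * c)) : ℝ) : ℂ) 0 := by
      have h2 : HasDerivAt (fun τ : ℝ => δ * (2 * y + 2 * c * τ)) (δ * (2 * c)) 0 := by
        have := (((hasDerivAt_id (0:ℝ)).const_mul (2 * c)).const_add (2 * y)).const_mul δ
        refine this.congr_deriv ?_
        simp
      exact (((rhoC_hd2 _).comp 0 (hin 0)).mul h2).ofReal_comp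
    have hl : HasDerivAt (fun τ : ℝ => b - 2 * a * τ) (-(2 * a)) 0 := by
      refine (((hid 0).const_mul (2 * a)).const_sub b).congr_deriv ?_
      ring
    refine ((hr2.add ((hr 0).mul hl)).mul (he 0)).congr_deriv ?_
    simp
    ring

/-- phase of a packet on the unfolded space -/
def phi (t : ℝ) (ξ : Fin N → Fin m → ℝ) (k : Fin N → Fin n → ℤ) (x : CfgE m n N) : ℂ :=
  (∑ β : Fin N, (-((m:ℂ)/2) * Complex.log (sP t) + -(4 * Real.pi ^ 2 * Complex.I * t * ∑ j, (k β j : ℂ) ^ 2)))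
   - (2 * sP t)⁻¹ * ∑ β, ∑ i, (((x β).1 i : ℂ) - Complex.I * ξ β i) ^ 2
   + ∑ β, ∑ j, 2 * Real.pi * Complex.I * k β j * (x β).2 j

lemma Pk_fold (t : ℝ) (ξ : Fin N → Fin m → ℝ) (k : Fin N → Fin n → ℤ) (x : CfgE m n N) :
    Pk t ξ k (fold m n N x) = Complex.exp (phi t ξ k x) := by
  unfold Pk phi gP tP fold
  rw [Finset.mul_sum, ← Finset.sum_sub_distrib, ← Finset.sum_add_distrib, Complex.exp_sum]
  refine Finset.prod_congr rfl fun β _ => ?_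
  simp only [fourier_coe_apply]
  rw [← Complex.exp_sum, ← Complex.exp_add, ← Complex.exp_add]
  congr 1
  have : ∀ j, 2 * (Real.pi:ℂ) * Complex.I * (k β j) * ((x β).2 j) / ((1:ℝ):ℂ) = 2 * Real.pi * Complex.I * (k β j) * ((x β).2 j) := by
    intro j; simp
  simp only [this]
  ring

lemma eY_fst (α : Fin N) (i : Fin m) (β : Fin N) (l : Fin m) :
    (eY m n N α i β).1 l = if β = α then (if l = i then 1 else 0) else 0 := by
  unfold eY
  by_cases h : β = α
  · subst h; simp [Pi.single_apply]
  · simp [h]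
lemma eY_snd (α : Fin N) (i : Fin m) (β : Fin N) : (eY m n N α i β).2 = 0 := by
  unfold eY
  by_cases h : β = α
  · subst h; simp
  · simp [h]
lemma eZ_snd (α : Fin N) (i : Fin n) (β : Fin N) (l : Fin n) :
    (eZ m n N α i β).2 l = if β = α then (if l = i then 1 else 0) else 0 := by
  unfold eZ
  by_cases h : β = α
  · subst h; simp [Pi.single_apply]
  · simp [h]
lemma eZ_fst (α : Fin N) (i : Fin n) (β : Fin N) : (eZ m n N α i β).1 = 0 := by
  unfold eZ
  by_cases h : β = α
  · subst h; simp
  · simp [h]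

lemma sum_shift {R : Type*} [CommRing R] (A : Fin N → Fin m → R) (α : Fin N) (i : Fin m) (τ : R) :
    ∑ β, ∑ l, (A β l + τ * (if β = α then (if l = i then 1 else 0) else 0)) ^ 2
      = (∑ β, ∑ l, A β l ^ 2) + 2 * A α i * τ + τ ^ 2 := by
  have : ∀ β l, (A β l + τ * (if β = α then (if l = i then 1 else 0) else 0)) ^ 2 =
     A β l ^ 2 + (if β = α then (if l = i then (2 * A β l * τ + τ ^ 2) else 0) else 0) := by
    intro β l; split_ifs <;> ring
  simp only [this, Finset.sum_add_distrib]
  rw [add_assoc]; congr 1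
  rw [Finset.sum_eq_single α]
  · simp
  · intro b _ hb; simp [hb]
  · simp

lemma phi_eY (t : ℝ) (ξ : Fin N → Fin m → ℝ) (k : Fin N → Fin n → ℤ) (x : CfgE m n N) (α : Fin N) (i : Fin m) (τ : ℝ) :
    phi t ξ k (x + τ • eY m n N α i) = phi t ξ k x +
      ((-(((x α).1 i : ℂ) - Complex.I * ξ α i) / sP t) * τ - (2 * sP t)⁻¹ * τ ^ 2) := by
  unfold phi
  have h1 : ∀ β l, ((((x + τ • eY m n N α i) β).1 l : ℂ) - Complex.I * ξ β l) ^ 2 =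
    ((((x β).1 l : ℂ) - Complex.I * ξ β l) + (τ : ℂ) * (if β = α then (if l = i then 1 else 0) else 0)) ^ 2 := by
    intro β l
    simp only [Pi.add_apply, Pi.smul_apply, Prod.fst_add, Prod.smul_fst, eY_fst, smul_eq_mul]
    congr 1
    split_ifs <;> push_cast <;> ring
  simp only [h1]
  rw [sum_shift]
  simp only [Pi.add_apply, Pi.smul_apply, Prod.snd_add, Prod.smul_snd, eY_snd, smul_zero, Pi.zero_apply, add_zero]
  have := sP_ne t
  field_simp
  ring

lemma phi_eZ (t : ℝ) (ξ : Fin N → Fin m → ℝ) (k : Fin N → Fin n → ℤ) (x : CfgE m n N) (α : Fin N) (i : Fin n) (τ : ℝ) :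
    phi t ξ k (x + τ • eZ m n N α i) = phi t ξ k x + (2 * Real.pi * Complex.I * k α i * τ - 0 * τ ^ 2) := by
  unfold phi
  have h1 : ∀ β l, 2 * (Real.pi:ℂ) * Complex.I * k β l * (((x + τ • eZ m n N α i) β).2 l : ℝ) =
    2 * (Real.pi:ℂ) * Complex.I * k β l * ((x β).2 l) + (if β = α then (if l = i then 2 * (Real.pi:ℂ) * Complex.I * k β l * τ else 0) else 0) := by
    intro β l
    simp only [Pi.add_apply, Pi.smul_apply, Prod.snd_add, Prod.smul_snd, eZ_snd, smul_eq_mul]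
    split_ifs <;> push_cast <;> ring
  simp only [h1, Finset.sum_add_distrib]
  have h2 : ∑ β, ∑ l, (if β = α then (if l = i then 2 * (Real.pi:ℂ) * Complex.I * k β l * τ else 0) else 0) = 2 * (Real.pi:ℂ) * Complex.I * k α i * τ := by
    rw [Finset.sum_eq_single α]
    · simp
    · intro b _ hb; simp [hb]
    · simp
  rw [h2]
  simp only [Pi.add_apply, Pi.smul_apply, Prod.fst_add, Prod.smul_fst, eZ_fst, smul_zero, Pi.zero_apply, add_zero]
  ring

lemma SS_eY (x : CfgE m n N) (α : Fin N) (i : Fin m) (τ : ℝ) :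
    SS (fold m n N (x + τ • eY m n N α i)) = SS (fold m n N x) + 2 * (x α).1 i * τ + 1 * τ ^ 2 := by
  unfold SS fold
  have h1 : ∀ β l, ((x + τ • eY m n N α i) β).1 l ^ 2 =
    ((x β).1 l + τ * (if β = α then (if l = i then 1 else 0) else 0)) ^ 2 := by
    intro β l
    simp only [Pi.add_apply, Pi.smul_apply, Prod.fst_add, Prod.smul_fst, eY_fst, smul_eq_mul]
  simp only [h1]
  rw [sum_shift, one_mul]

lemma SS_eZ (x : CfgE m n N) (α : Fin N) (i : Fin n) (τ : ℝ) :
    SS (fold m n N (x + τ • eZ m n N α i)) = SS (fold m n N x) + 2 * 0 * τ + 0 * τ ^ 2 := by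
  unfold SS fold
  simp only [Pi.add_apply, Pi.smul_apply, Prod.fst_add, Prod.smul_fst, eZ_fst, smul_zero, Pi.zero_apply, add_zero, mul_zero, zero_mul]

lemma fold_lift (x : Cfg m n N) : fold m n N (liftCfg m n N x) = x := by
  unfold fold liftCfg
  funext α
  refine Prod.ext rfl ?_
  funext j
  exact AddCircle.coe_equivIco

/-- truncated packets -/
def Fc (δ t : ℝ) (ξ : Fin N → Fin m → ℝ) (k : Fin N → Fin n → ℤ) (x : Cfg m n N) : ℂ :=
  (rhoC (δ * SS x) : ℝ) * Pk t ξ k x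

lemma Fc_contDiff (δ t : ℝ) (ξ : Fin N → Fin m → ℝ) (k : Fin N → Fin n → ℤ) {j : ℕ∞} :
    ContDiff ℝ j (Fc δ t ξ k ∘ fold m n N) := by
  have h : Fc δ t ξ k ∘ fold m n N = fun x => ((rhoC (δ * SS (fold m n N x)) : ℝ) : ℂ) * Complex.exp (phi t ξ k x) := by
    funext x; simp only [Function.comp, Fc, Pk_fold]
  rw [h]
  refine ContDiff.mul ?_ ?_
  · refine Complex.ofRealCLM.contDiff.comp (rhoC_contDiff.comp (contDiff_const.mul ?_))
    unfold SS fold; fun_prop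
  · refine ContDiff.cexp ?_
    unfold phi
    have h1 : ∀ β i, ContDiff ℝ j (fun x : CfgE m n N => (((x β).1 i : ℝ) : ℂ)) := fun β i =>
      Complex.ofRealCLM.contDiff.comp (by fun_prop)
    have h2 : ∀ β i, ContDiff ℝ j (fun x : CfgE m n N => (((x β).2 i : ℝ) : ℂ)) := fun β i =>
      Complex.ofRealCLM.contDiff.comp (by fun_prop)
    refine ContDiff.add (ContDiff.sub contDiff_const (contDiff_const.mul ?_)) ?_
    · refine ContDiff.sum fun β _ => ContDiff.sum fun i _ => ContDiff.pow ((h1 β i).sub contDiff_const) _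
    · refine ContDiff.sum fun β _ => ContDiff.sum fun i _ => contDiff_const.mul (h2 β i)

lemma Fc_test {δ : ℝ} (hδ : 0 < δ) (t : ℝ) (ξ : Fin N → Fin m → ℝ) (k : Fin N → Fin n → ℤ) :
    IsTest m n N (Fc δ t ξ k) := by
  refine ⟨Fc_contDiff _ _ _ _, ?_⟩
  refine HasCompactSupport.intro (K := Set.pi Set.univ fun _ : Fin N =>
    (Set.pi Set.univ fun _ : Fin m => Set.Icc (-(2/δ+1)) (2/δ+1)) ×ˢ (Set.univ : Set (Torus n))) ?_ ?_
  · refine isCompact_univ_pi fun _ => (isCompact_univ_pi fun _ => isCompact_Icc).prod isCompact_univ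
  · intro x hx
    simp only [Set.mem_pi, Set.mem_univ, true_implies, Set.mem_prod, and_true, not_forall] at hx
    obtain ⟨β, i, hi⟩ := hx
    have h1 : 2/δ + 1 < |(x β).1 i| := by
      rw [Set.mem_Icc, ← abs_le, not_le] at hi; exact hi
    have h2 : (x β).1 i ^ 2 ≤ SS x := by
      unfold SS
      refine le_trans ?_ (Finset.single_le_sum (f := fun β => ∑ i, (x β).1 i ^ 2) (fun _ _ => Finset.sum_nonneg fun _ _ => sq_nonneg _) (Finset.mem_univ β))
      exact Finset.single_le_sum (f := fun i => (x β).1 i ^ 2) (fun _ _ => sq_nonneg _) (Finset.mem_univ i)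
    have h3 : 2 / δ ≤ (x β).1 i ^ 2 := by
      rw [← sq_abs]
      have : 0 < 2/δ := by positivity
      nlinarith
    have h4 : 2 ≤ δ * SS x := by
      have := h3.trans h2
      rw [div_le_iff₀ hδ] at this; linarith
    rw [Fc, rhoC_zero h4]; simp

/-- spectral multiplier on packets -/
def qP (t : ℝ) (ξ : Fin N → Fin m → ℝ) (k : Fin N → Fin n → ℤ) (x : Cfg m n N) : ℂ :=
  ∑ β, ((∑ i, ((-(((x β).1 i : ℂ) - Complex.I * ξ β i) / sP t) ^ 2 - 2 * (2 * sP t)⁻¹)) +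
    ∑ j, (2 * Real.pi * Complex.I * (k β j)) ^ 2)

/-- cutoff error -/
def errP (δ t : ℝ) (ξ : Fin N → Fin m → ℝ) (x : Cfg m n N) : ℂ :=
  ∑ β, ∑ i, (((deriv rhoC (δ * SS x) : ℝ) : ℂ) * δ * (2 * (1:ℝ) + 4 * (x β).1 i * (-(((x β).1 i : ℂ) - Complex.I * ξ β i) / sP t))
        + ((deriv (deriv rhoC) (δ * SS x) : ℝ) : ℂ) * δ ^ 2 * (4 * (x β).1 i ^ 2))

lemma lap_Fc (δ t : ℝ) (ξ : Fin N → Fin m → ℝ) (k : Fin N → Fin n → ℤ) (x : Cfg m n N) :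
    lap m n N (Fc δ t ξ k) x = ((rhoC (δ * SS x) : ℝ) * qP t ξ k x + errP δ t ξ x) * Pk t ξ k x := by
  unfold lap laplacianE
  set X := liftCfg m n N x with hX
  have hfX : fold m n N X = x := fold_lift x
  have hc : ContDiff ℝ 2 (Fc δ t ξ k ∘ fold m n N) := by exact_mod_cast Fc_contDiff δ t ξ k (j := 2)
  have hP : Complex.exp (phi t ξ k X) = Pk t ξ k x := by rw [← Pk_fold, hfX]
  have hx1 : ∀ β i, (X β).1 i = (x β).1 i := fun β i => rfl
  have hY : ∀ β i, secondDeriv (Fc δ t ξ k ∘ fold m n N) X (eY m n N β i) =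
      ((((rhoC (δ * SS x) : ℝ) : ℂ) * ((-(((x β).1 i : ℂ) - Complex.I * ξ β i) / sP t) ^ 2 - 2 * (2 * sP t)⁻¹) +
       ((deriv rhoC (δ * SS x) : ℝ) : ℂ) * δ * (2 * (1:ℝ) + 4 * (x β).1 i * (-(((x β).1 i : ℂ) - Complex.I * ξ β i) / sP t))
        + ((deriv (deriv rhoC) (δ * SS x) : ℝ) : ℂ) * δ ^ 2 * (4 * (x β).1 i ^ 2))) * Pk t ξ k x := by
    intro β i
    have h := oneD δ (SS x) ((x β).1 i) 1 (phi t ξ k X) (-(((x β).1 i : ℂ) - Complex.I * ξ β i) / sP t) ((2 * sP t)⁻¹)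
    rw [← hP]
    refine secondDeriv_eq hc (fun τ => ?_) h.2
    refine (h.1 τ).congr_of_eventuallyEq (Filter.Eventually.of_forall fun τ => ?_)
    simp only [Function.comp, Fc, Pk_fold, phi_eY, SS_eY, hfX, hx1]
  have hZ : ∀ β j, secondDeriv (Fc δ t ξ k ∘ fold m n N) X (eZ m n N β j) =
      (((rhoC (δ * SS x) : ℝ) : ℂ) * (2 * Real.pi * Complex.I * (k β j)) ^ 2) * Pk t ξ k x := by
    intro β i
    have h := oneD δ (SS x) 0 0 (phi t ξ k X) (2 * Real.pi * Complex.I * (k β i)) 0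
    rw [← hP]
    refine (secondDeriv_eq hc (fun τ => ?_) h.2).trans (by simp)
    refine (h.1 τ).congr_of_eventuallyEq (Filter.Eventually.of_forall fun τ => ?_)
    simp only [Function.comp, Fc, Pk_fold, phi_eZ, SS_eZ, hfX]
  simp only [hY, hZ]
  unfold qP errP
  simp only [Finset.sum_add_distrib, Finset.mul_sum, Finset.sum_mul, add_mul, mul_add]
  ring

end PartSeven
end ManyBodyWaveguide

namespace ManyBodyWaveguide
section PartEight
variable {m n N : ℕ}

lemma conj_memLp {f : Cfg m n N → ℂ} (hf : MemLp f 2) : MemLp (fun x => (starRingEnd ℂ) (f x)) 2 := by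
  refine hf.of_le (Complex.continuous_conj.comp_aestronglyMeasurable hf.1) ?_
  exact Filter.Eventually.of_forall fun x => by simp

lemma inner_toLp {f : Cfg m n N → ℂ} (hf : MemLp f 2) (v : L2 m n N) :
    inner ℂ (hf.toLp f) v = ∫ x, (starRingEnd ℂ) (f x) * v x := by
  rw [MeasureTheory.L2.inner_def]
  refine integral_congr_ae ?_
  filter_upwards [hf.coeFn_toLp] with x hx
  rw [hx, RCLike.inner_apply, mul_comm]

lemma int_bound {c : ℝ} (hc : 0 < c) : ∃ B : ℝ, 0 ≤ B ∧ ∀ (f : Cfg m n N → ℂ) (C : ℝ), AEStronglyMeasurable f volume →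
    (∀ x, ‖f x‖ ≤ C * Real.exp (-c * SS x)) → ∀ v : L2 m n N, ‖∫ x, f x * v x‖ ≤ C * B * ‖v‖ := by
  obtain ⟨B, hB, h⟩ := norm_le_of_bound (m := m) (n := n) (N := N) hc
  refine ⟨B, hB, fun f C hf hb v => ?_⟩
  have hf2 : MemLp f 2 := memLp_of_bound hf hc hb
  have h1 := h _ (conj_memLp hf2) C (fun x => by simpa using hb x)
  have h2 := inner_toLp (conj_memLp hf2) v
  simp only [Complex.conj_conj] at h2
  rw [← h2]
  exact (norm_inner_le_norm _ _).trans (by gcongr)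

lemma sP_inv_norm (t : ℝ) : ‖(sP t)⁻¹‖ ≤ 1 := by
  rw [norm_inv]; exact inv_le_one_of_one_le₀ (sP_norm t)

lemma ysq_bound (y ξ : ℝ) : ‖(y : ℂ) - Complex.I * ξ‖ ^ 2 ≤ 2 * y ^ 2 + 2 * ξ ^ 2 := by
  have h1 : ‖(y : ℂ) - Complex.I * ξ‖ ≤ |y| + |ξ| := by
    refine (norm_sub_le _ _).trans (by simp)
  have h2 : ‖(y : ℂ) - Complex.I * ξ‖ ^ 2 ≤ (|y| + |ξ|) ^ 2 := by gcongr
  nlinarith [sq_nonneg (|y| - |ξ|), sq_abs y, sq_abs ξ]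

lemma b_bound (t y ξ : ℝ) : ‖-((y : ℂ) - Complex.I * ξ) / sP t‖ ≤ ‖(y : ℂ) - Complex.I * ξ‖ := by
  rw [div_eq_mul_inv, norm_mul, norm_neg]
  exact mul_le_of_le_one_right (norm_nonneg _) (sP_inv_norm t)

/-- a generic constant for the packets -/
def cst (n : ℕ) (ξ : Fin N → Fin m → ℝ) (k : Fin N → Fin n → ℤ) : ℝ :=
  ∑ β, ((∑ i, (4 * (2 * ξ β i ^ 2) + 2)) + ∑ j, ‖(2 * Real.pi * Complex.I * (k β j) : ℂ) ^ 2‖) + 10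

lemma cst_nonneg (ξ : Fin N → Fin m → ℝ) (k : Fin N → Fin n → ℤ) : 0 ≤ cst n ξ k := by
  unfold cst; positivity

lemma qP_bound (t : ℝ) (ξ : Fin N → Fin m → ℝ) (k : Fin N → Fin n → ℤ) (x : Cfg m n N) :
    ‖qP t ξ k x‖ ≤ cst n ξ k * (1 + SS x) := by
  have h : ‖qP t ξ k x‖ ≤ ∑ β, ((∑ i, (2 * (x β).1 i ^ 2 + (4 * (2 * ξ β i ^ 2) + 2))) + ∑ j, ‖(2 * Real.pi * Complex.I * (k β j) : ℂ) ^ 2‖) := by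
    unfold qP
    refine (norm_sum_le _ _).trans (Finset.sum_le_sum fun β _ => (norm_add_le _ _).trans (add_le_add ?_ (norm_sum_le _ _)))
    refine (norm_sum_le _ _).trans (Finset.sum_le_sum fun i _ => (norm_sub_le _ _).trans ?_)
    have h1 : ‖(-(((x β).1 i : ℂ) - Complex.I * ξ β i) / sP t) ^ 2‖ ≤ 2 * (x β).1 i ^ 2 + 2 * ξ β i ^ 2 := by
      rw [norm_pow]
      exact (pow_le_pow_left₀ (norm_nonneg _) (b_bound _ _ _) 2).trans (ysq_bound _ _)
    have h2 : ‖2 * (2 * sP t)⁻¹‖ ≤ 1 := by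
      have : 2 * (2 * sP t)⁻¹ = (sP t)⁻¹ := by have := sP_ne t; field_simp
      rw [this]; exact sP_inv_norm t
    nlinarith [sq_nonneg (ξ β i)]
  refine h.trans ?_
  have e : ∑ β, ((∑ i, (2 * (x β).1 i ^ 2 + (4 * (2 * ξ β i ^ 2) + 2))) + ∑ j, ‖(2 * Real.pi * Complex.I * (k β j) : ℂ) ^ 2‖)
    = 2 * SS x + (cst n ξ k - 10) := by
    unfold SS cst
    simp only [Finset.sum_add_distrib, Finset.mul_sum]; ring
  rw [e]
  have : 10 ≤ cst n ξ k := by unfold cst; simp only [le_add_iff_nonneg_left]; positivity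
  nlinarith [SS_nonneg x]

lemma errP_bound : ∃ K : ℝ, 0 ≤ K ∧ ∀ (δ t : ℝ) (ξ : Fin N → Fin m → ℝ) (k : Fin N → Fin n → ℤ) (x : Cfg m n N),
    0 < δ → δ ≤ 1 → ‖errP δ t ξ x‖ ≤ δ * K * cst n ξ k * (1 + SS x) := by
  obtain ⟨K, hK, hb⟩ := rhoC_bdd
  refine ⟨K, hK, fun δ t ξ k x h0 h1 => ?_⟩
  have h : ‖errP δ t ξ x‖ ≤ ∑ β, ∑ i, δ * K * (10 * (x β).1 i ^ 2 + (4 * (2 * ξ β i ^ 2) + 2)) := by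
    unfold errP
    refine (norm_sum_le _ _).trans (Finset.sum_le_sum fun β _ => ?_)
    refine (norm_sum_le _ _).trans (Finset.sum_le_sum fun i _ => (norm_add_le _ _).trans ?_)
    set y := (x β).1 i
    set b : ℂ := -((y : ℂ) - Complex.I * ξ β i) / sP t with hbdef
    have hbb : ‖b‖ ≤ |y| + |ξ β i| := by
      refine (b_bound _ _ _).trans ((norm_sub_le _ _).trans (by simp))
    have e1 : ‖((deriv rhoC (δ * SS x) : ℝ) : ℂ) * δ * (2 * (1:ℝ) + 4 * y * b)‖ ≤ K * δ * (2 + 4 * |y| * (|y| + |ξ β i|)) := by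
      rw [norm_mul, norm_mul, Complex.norm_real, Complex.norm_real, Real.norm_eq_abs, Real.norm_eq_abs, abs_of_pos h0]
      have : ‖(2 * (1:ℝ) + 4 * y * b : ℂ)‖ ≤ 2 + 4 * |y| * (|y| + |ξ β i|) := by
        refine (norm_add_le _ _).trans (add_le_add (by simp) ?_)
        rw [norm_mul, norm_mul, Complex.norm_real]
        simp only [Complex.norm_ofNat, Real.norm_eq_abs]
        gcongr
      gcongr
      exact (hb _).1
    have e2 : ‖((deriv (deriv rhoC) (δ * SS x) : ℝ) : ℂ) * δ ^ 2 * (4 * y ^ 2)‖ ≤ K * δ * (4 * y ^ 2) := by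
      have : (((deriv (deriv rhoC) (δ * SS x) : ℝ) : ℂ) * δ ^ 2 * (4 * y ^ 2)) = ((deriv (deriv rhoC) (δ * SS x) * δ ^ 2 * (4 * y ^ 2) : ℝ) : ℂ) := by
        push_cast; ring
      rw [this, Complex.norm_real, norm_mul, norm_mul, Real.norm_eq_abs, Real.norm_of_nonneg (by positivity), Real.norm_of_nonneg (by positivity : 0 ≤ 4 * y ^ 2)]
      have hδ2 : δ ^ 2 ≤ δ := by nlinarith
      gcongr
      exact (hb _).2
    refine (add_le_add e1 e2).trans ?_
    have h3 : (2 + 4 * |y| * (|y| + |ξ β i|)) + 4 * y ^ 2 ≤ 10 * y ^ 2 + (4 * (2 * ξ β i ^ 2) + 2) := by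
      nlinarith [sq_nonneg (|y| - |ξ β i|), sq_abs y, sq_abs (ξ β i), sq_nonneg (ξ β i), sq_nonneg y]
    have hKδ : 0 ≤ K * δ := by positivity
    nlinarith [mul_le_mul_of_nonneg_left h3 hKδ]
  refine h.trans ?_
  simp only [← Finset.mul_sum]
  rw [mul_assoc (δ * K)]
  refine mul_le_mul_of_nonneg_left ?_ (by positivity)
  have e : ∑ β, ∑ i, (10 * (x β).1 i ^ 2 + (4 * (2 * ξ β i ^ 2) + 2)) ≤ 10 * SS x + (cst n ξ k - 10) := by
    unfold SS cst
    simp only [Finset.sum_add_distrib, Finset.mul_sum]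
    have : 0 ≤ ∑ β, ∑ j, ‖(2 * Real.pi * Complex.I * (k β j) : ℂ) ^ 2‖ := by positivity
    linarith
  refine e.trans ?_
  have : 10 ≤ cst n ξ k := by unfold cst; simp only [le_add_iff_nonneg_left]; positivity
  nlinarith [SS_nonneg x]

lemma qP_continuous (t : ℝ) (ξ : Fin N → Fin m → ℝ) (k : Fin N → Fin n → ℤ) : Continuous (qP t ξ k) := by
  unfold qP
  have := sP_ne t
  fun_prop (disch := assumption)

/-- Gaussian bound for packets with polynomial weight, with constants locally uniform in time. -/
lemma Pk_poly_bound (t0 : ℝ) : ∃ c B : ℝ, 0 < c ∧ 0 ≤ B ∧ ∀ t, |t| ≤ t0 → ∀ (ξ : Fin N → Fin m → ℝ) (k : Fin N → Fin n → ℤ) (x : Cfg m n N),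
    (1 + SS x) ^ 2 * ‖Pk t ξ k x‖ ≤ B * xis ξ * Real.exp (-c * SS x) := by
  obtain ⟨B, hB, h⟩ := poly_gauss (c := kap t0 / 4) (by have := kap_pos t0; positivity)
  refine ⟨kap t0 / 4 / 2, B, by have := kap_pos t0; positivity, hB, fun t ht ξ k x => ?_⟩
  have hk : kap t0 ≤ kap t := by
    unfold kap
    have : t ^ 2 ≤ t0 ^ 2 := by rw [← sq_abs t]; gcongr
    gcongr
  have h1 : ‖Pk t ξ k x‖ ≤ xis ξ * Real.exp (-(kap t0 / 4) * SS x) := by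
    refine (Pk_norm_le t ξ k x).trans ?_
    have : 0 < xis ξ := Real.exp_pos _
    have hS := SS_nonneg x
    refine mul_le_mul_of_nonneg_left (Real.exp_le_exp.2 ?_) this.le
    nlinarith
  have hx : 0 < xis ξ := Real.exp_pos _
  calc _ ≤ (1 + SS x) ^ 2 * (xis ξ * Real.exp (-(kap t0 / 4) * SS x)) := by gcongr
    _ = xis ξ * ((1 + SS x) ^ 2 * Real.exp (-(kap t0 / 4) * SS x)) := by ring
    _ ≤ xis ξ * (B * Real.exp (-(kap t0 / 4 / 2) * SS x)) := mul_le_mul_of_nonneg_left (h _ (SS_nonneg x)) hx.le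
    _ = _ := by ring

lemma Fc_continuous (δ t : ℝ) (ξ : Fin N → Fin m → ℝ) (k : Fin N → Fin n → ℤ) : Continuous (Fc δ t ξ k) := by
  unfold Fc
  exact (Complex.continuous_ofReal.comp ((rhoC_contDiff (k := 0)).continuous.comp (continuous_const.mul SS_continuous))).mul
    (Pk_continuous t ξ k)

lemma rhoC_deriv_cont : Continuous (deriv rhoC) ∧ Continuous (deriv (deriv rhoC)) := by
  have h2 : ContDiff ℝ 1 (deriv rhoC) := by
    have h := (rhoC_contDiff (k := 2))
    have h' : ContDiff ℝ (1 + 1) rhoC := by norm_num; exact_mod_cast h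
    exact (contDiff_succ_iff_deriv.1 h').2.2
  exact ⟨h2.continuous, h2.continuous_deriv (by norm_num)⟩

lemma errP_continuous (δ t : ℝ) (ξ : Fin N → Fin m → ℝ) : Continuous (errP (n := n) δ t ξ) := by
  have h1 : Continuous (fun x : Cfg m n N => ((deriv rhoC (δ * SS x) : ℝ) : ℂ)) :=
    Complex.continuous_ofReal.comp (rhoC_deriv_cont.1.comp (continuous_const.mul SS_continuous))
  have h2 : Continuous (fun x : Cfg m n N => ((deriv (deriv rhoC) (δ * SS x) : ℝ) : ℂ)) :=
    Complex.continuous_ofReal.comp (rhoC_deriv_cont.2.comp (continuous_const.mul SS_continuous))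
  unfold errP
  have := sP_ne t
  refine continuous_finsetSum _ fun β _ => continuous_finsetSum _ fun i _ => ?_
  refine ((h1.mul continuous_const).mul ?_).add ((h2.mul continuous_const).mul ?_)
  · fun_prop (disch := assumption)
  · fun_prop

lemma qPk_memLp (t : ℝ) (ξ : Fin N → Fin m → ℝ) (k : Fin N → Fin n → ℤ) :
    MemLp (fun x => qP t ξ k x * Pk t ξ k x) 2 := by
  obtain ⟨c, B, hc, hB, h⟩ := Pk_poly_bound (m := m) (n := n) (N := N) |t|
  refine memLp_of_bound ((qP_continuous t ξ k).mul (Pk_continuous t ξ k)).aestronglyMeasurable hc (C := cst n ξ k * (B * xis ξ)) (fun x => ?_)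
  have := h t le_rfl ξ k x
  have hC := cst_nonneg ξ k
  rw [norm_mul]
  have hS := SS_nonneg x
  calc _ ≤ cst n ξ k * (1 + SS x) * ‖Pk t ξ k x‖ := by gcongr; exact qP_bound _ _ _ _
    _ ≤ cst n ξ k * ((1 + SS x) ^ 2 * ‖Pk t ξ k x‖) := by
      rw [mul_assoc]; gcongr; nlinarith
    _ ≤ cst n ξ k * (B * xis ξ * Real.exp (-c * SS x)) := by gcongr
    _ = _ := by ring

lemma weak_Pk {U : ℝ → L2 m n N →L[ℂ] L2 m n N} (hU : IsPropagator m n N 0 U) (u : L2 m n N)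
    (t : ℝ) (ξ : Fin N → Fin m → ℝ) (k : Fin N → Fin n → ℤ) (s : ℝ) :
    HasDerivAt (fun s : ℝ => ∫ x, Pk t ξ k x * (U s u) x)
      (Complex.I * ∫ x, (qP t ξ k x * Pk t ξ k x) * (U s u) x) s := by
  obtain ⟨c, B, hc, hB, h⟩ := Pk_poly_bound (m := m) (n := n) (N := N) |t|
  obtain ⟨D, hD, h_integ⟩ := int_bound (m := m) (n := n) (N := N) hc
  obtain ⟨K, hK, herr⟩ := errP_bound (m := m) (n := n) (N := N)
  have hC := cst_nonneg ξ k
  have hxi : 0 < xis ξ := Real.exp_pos _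
  have hfM : ∀ δ, 0 < δ → MemLp (Fc δ t ξ k) 2 := fun δ hδ => by
    refine (Pk_memLp t ξ k).of_le (Fc_continuous δ t ξ k).aestronglyMeasurable (Filter.Eventually.of_forall fun x => ?_)
    rw [Fc, norm_mul, Complex.norm_real]
    refine mul_le_of_le_one_left (norm_nonneg _) ?_
    unfold rhoC
    rw [Real.norm_eq_abs, abs_of_nonneg (Real.smoothTransition.nonneg _)]
    exact Real.smoothTransition.le_one _
  have hlapc : ∀ δ, Continuous (lap m n N (Fc δ t ξ k)) := fun δ => by
    have : lap m n N (Fc δ t ξ k) = fun x => ((rhoC (δ * SS x) : ℝ) * qP t ξ k x + errP δ t ξ x) * Pk t ξ k x :=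
      funext fun x => lap_Fc δ t ξ k x
    rw [this]
    exact (((Complex.continuous_ofReal.comp ((rhoC_contDiff (k := 0)).continuous.comp (continuous_const.mul SS_continuous))).mul
      (qP_continuous t ξ k)).add (errP_continuous δ t ξ)).mul (Pk_continuous t ξ k)
  have b1 : ∀ δ, 0 < δ → ∀ x, ‖Pk t ξ k x - Fc δ t ξ k x‖ ≤ δ * (B * xis ξ) * Real.exp (-c * SS x) := by
    intro δ hδ x
    have e : Pk t ξ k x - Fc δ t ξ k x = -((rhoC (δ * SS x) - 1 : ℝ) : ℂ) * Pk t ξ k x := by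
      rw [Fc]; push_cast; ring
    have hS := SS_nonneg x
    rw [e, norm_mul, norm_neg, Complex.norm_real, Real.norm_eq_abs]
    calc _ ≤ (δ * SS x) * ‖Pk t ξ k x‖ := by gcongr; exact rhoC_sub (by positivity)
      _ ≤ δ * ((1 + SS x) ^ 2 * ‖Pk t ξ k x‖) := by
        rw [mul_assoc]; gcongr; nlinarith
      _ ≤ δ * (B * xis ξ * Real.exp (-c * SS x)) := mul_le_mul_of_nonneg_left (h t le_rfl ξ k x) hδ.le
      _ = _ := by ring
  have b2 : ∀ δ, 0 < δ → δ ≤ 1 → ∀ x, ‖qP t ξ k x * Pk t ξ k x - lap m n N (Fc δ t ξ k) x‖ ≤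
      δ * ((cst n ξ k + K * cst n ξ k) * (B * xis ξ)) * Real.exp (-c * SS x) := by
    intro δ hδ hδ1 x
    have hS := SS_nonneg x
    have e : qP t ξ k x * Pk t ξ k x - lap m n N (Fc δ t ξ k) x =
      (-((rhoC (δ * SS x) - 1 : ℝ) : ℂ) * qP t ξ k x - errP δ t ξ x) * Pk t ξ k x := by
      rw [lap_Fc]; push_cast; ring
    rw [e, norm_mul]
    have e1 : ‖-((rhoC (δ * SS x) - 1 : ℝ) : ℂ) * qP t ξ k x - errP δ t ξ x‖ ≤
        δ * ((cst n ξ k + K * cst n ξ k) * (1 + SS x) ^ 2) := by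
      refine (norm_sub_le _ _).trans ?_
      rw [norm_mul, norm_neg, Complex.norm_real, Real.norm_eq_abs]
      have a1 : |rhoC (δ * SS x) - 1| * ‖qP t ξ k x‖ ≤ (δ * SS x) * (cst n ξ k * (1 + SS x)) := by
        gcongr
        · exact rhoC_sub (by positivity)
        · exact qP_bound _ _ _ _
      have a2 := herr δ t ξ k x hδ hδ1
      have a3 : (δ * SS x) * (cst n ξ k * (1 + SS x)) ≤ δ * (cst n ξ k * (1 + SS x) ^ 2) := by
        have : SS x * (1 + SS x) ≤ (1 + SS x) ^ 2 := by nlinarith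
        calc _ = δ * (cst n ξ k * (SS x * (1 + SS x))) := by ring
          _ ≤ _ := by gcongr
      have a4 : δ * K * cst n ξ k * (1 + SS x) ≤ δ * (K * cst n ξ k * (1 + SS x) ^ 2) := by
        have : (1 + SS x) ≤ (1 + SS x) ^ 2 := by nlinarith
        calc _ = δ * (K * cst n ξ k * (1 + SS x)) := by ring
          _ ≤ _ := by gcongr
      linarith
    calc _ ≤ δ * ((cst n ξ k + K * cst n ξ k) * (1 + SS x) ^ 2) * ‖Pk t ξ k x‖ := by gcongr
      _ = δ * (cst n ξ k + K * cst n ξ k) * ((1 + SS x) ^ 2 * ‖Pk t ξ k x‖) := by ring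
      _ ≤ δ * (cst n ξ k + K * cst n ξ k) * (B * xis ξ * Real.exp (-c * SS x)) :=
        mul_le_mul_of_nonneg_left (h t le_rfl ξ k x) (by positivity)
      _ = _ := by ring
  have hlapM : ∀ δ, 0 < δ → δ ≤ 1 → MemLp (lap m n N (Fc δ t ξ k)) 2 := fun δ hδ hδ1 => by
    have h1 : MemLp (fun x => qP t ξ k x * Pk t ξ k x - lap m n N (Fc δ t ξ k) x) 2 :=
      memLp_of_bound (((qP_continuous t ξ k).mul (Pk_continuous t ξ k)).sub (hlapc δ)).aestronglyMeasurable hc (b2 δ hδ hδ1)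
    have := (qPk_memLp t ξ k).sub h1
    refine this.ae_eq (Filter.Eventually.of_forall fun x => ?_)
    simp
  have hI : ∀ f : Cfg m n N → ℂ, MemLp f 2 → ∀ v : L2 m n N, Integrable (fun x => f x * v x) := fun f hf v =>
    hf.integrable_mul (Lp.memLp v)
  have hev : ∀ᶠ δ : ℝ in nhdsWithin 0 (Set.Ioi 0), 0 < δ ∧ δ ≤ 1 := by
    filter_upwards [Ioc_mem_nhdsGT (zero_lt_one (α := ℝ))] with δ hδ using hδ
  have small : ∀ C ε : ℝ, 0 < ε → ∀ᶠ δ : ℝ in nhdsWithin 0 (Set.Ioi 0), δ * C < ε := by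
    intro C ε hε
    have : Filter.Tendsto (fun δ : ℝ => δ * C) (nhdsWithin 0 (Set.Ioi 0)) (nhds 0) := by
      have := (Continuous.tendsto (by fun_prop : Continuous (fun δ : ℝ => δ * C)) 0)
      rw [zero_mul] at this
      exact this.mono_left nhdsWithin_le_nhds
    exact this.eventually_lt_const hε
  refine hasDerivAt_of_tendstoUniformly (l := nhdsWithin (0:ℝ) (Set.Ioi 0))
    (f := fun δ s => ∫ x, Fc δ t ξ k x * (U s u) x)
    (f' := fun δ s => Complex.I * ∫ x, (lap m n N (Fc δ t ξ k) x - (((0 : Cfg m n N → ℝ) x : ℝ) : ℂ) * Fc δ t ξ k x) * (U s u) x)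
    (g := fun s : ℝ => ∫ x, Pk t ξ k x * (U s u) x)
    (g' := fun s => Complex.I * ∫ x, (qP t ξ k x * Pk t ξ k x) * (U s u) x) ?_ ?_ ?_ s
  · rw [Metric.tendstoUniformly_iff]
    intro ε hε
    filter_upwards [hev, small (((cst n ξ k + K * cst n ξ k) * (B * xis ξ)) * D * ‖u‖) ε hε] with δ ⟨hδ, hδ1⟩ hs s
    rw [dist_eq_norm, ← mul_sub, norm_mul, Complex.norm_I, one_mul]
    simp only [Pi.zero_apply, Complex.ofReal_zero, zero_mul, sub_zero]
    rw [← integral_sub (hI _ (qPk_memLp t ξ k) _) (hI _ (hlapM δ hδ hδ1) _)]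
    simp only [← sub_mul]
    have := h_integ _ _ (((qP_continuous t ξ k).mul (Pk_continuous t ξ k)).sub (hlapc δ)).aestronglyMeasurable (b2 δ hδ hδ1) (U s u)
    rw [hU.unitary] at this
    refine lt_of_le_of_lt (this.trans (le_of_eq ?_)) hs
    ring
  · filter_upwards [hev] with δ ⟨hδ, hδ1⟩ s
    exact hU.weak u _ (Fc_test hδ t ξ k) s
  · intro s
    rw [Metric.tendsto_nhds]
    intro ε hε
    filter_upwards [hev, small ((B * xis ξ) * D * ‖u‖) ε hε] with δ ⟨hδ, hδ1⟩ hs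
    rw [dist_comm, dist_eq_norm, ← integral_sub (hI _ (Pk_memLp t ξ k) _) (hI _ (hfM δ hδ) _)]
    simp only [← sub_mul]
    have := h_integ _ _ ((Pk_continuous t ξ k).sub (Fc_continuous δ t ξ k)).aestronglyMeasurable (b1 δ hδ) (U s u)
    rw [hU.unitary] at this
    refine lt_of_le_of_lt (this.trans (le_of_eq ?_)) hs
    ring

end PartEight
end ManyBodyWaveguide

namespace ManyBodyWaveguide
section PartNine
variable {m n N : ℕ}

lemma conj_two : (starRingEnd ℂ) 2 = 2 := map_ofNat _ 2
lemma conj_four : (starRingEnd ℂ) 4 = 4 := map_ofNat _ 4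

lemma hda_congr {f g : ℝ → ℂ} {f' g' : ℂ} {t : ℝ} (h : HasDerivAt f f' t) (h1 : ∀ s, g s = f s) (h2 : g' = f') :
    HasDerivAt g g' t := by
  rw [funext h1, h2]; exact h

lemma sP_conj (t : ℝ) : (starRingEnd ℂ) (sP t) = sP (-t) := by
  simp [sP, conj_two]

lemma gP_conj (t : ℝ) (ξ y : Fin m → ℝ) : (starRingEnd ℂ) (gP t ξ y) = gP (-t) (-ξ) y := by
  unfold gP
  rw [← Complex.exp_conj]
  congr 1
  rw [map_sub, map_mul, map_mul, map_sum, map_inv₀, map_mul, sP_conj,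
    ← Complex.log_conj _ (Complex.slitPlane_arg_ne_pi (sP_slit t)), sP_conj]
  simp [conj_two]

lemma tP_conj (t : ℝ) (k : Fin n → ℤ) (z : Torus n) : (starRingEnd ℂ) (tP t k z) = tP (-t) (-k) z := by
  unfold tP
  rw [map_mul, ← Complex.exp_conj, map_prod]
  congr 1
  · congr 1
    simp [conj_four]
  · refine Finset.prod_congr rfl fun j _ => ?_
    rw [Pi.neg_apply, fourier_neg]

lemma Pk_conj (t : ℝ) (ξ : Fin N → Fin m → ℝ) (k : Fin N → Fin n → ℤ) (x : Cfg m n N) :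
    (starRingEnd ℂ) (Pk t ξ k x) = Pk (-t) (-ξ) (-k) x := by
  unfold Pk
  rw [map_prod]
  refine Finset.prod_congr rfl fun β _ => ?_
  rw [map_mul, gP_conj, tP_conj]; rfl

lemma qP_conj (t : ℝ) (ξ : Fin N → Fin m → ℝ) (k : Fin N → Fin n → ℤ) (x : Cfg m n N) :
    (starRingEnd ℂ) (qP t ξ k x) = qP (-t) (-ξ) (-k) x := by
  unfold qP
  simp only [map_sum, map_add, map_sub, map_mul, map_inv₀, map_pow, map_div₀, map_neg, sP_conj, conj_two]
  simp

/-- time generator applied to packets -/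
def dL (t : ℝ) (ξ : Fin N → Fin m → ℝ) (k : Fin N → Fin n → ℤ) : L2 m n N :=
  (qPk_memLp t ξ k).toLp _

lemma weak_inner {U : ℝ → L2 m n N →L[ℂ] L2 m n N} (hU : IsPropagator m n N 0 U) (u : L2 m n N)
    (t : ℝ) (ξ : Fin N → Fin m → ℝ) (k : Fin N → Fin n → ℤ) (s : ℝ) :
    HasDerivAt (fun s : ℝ => inner ℂ (pkL t ξ k) (U s u))
      (Complex.I * inner ℂ (dL t ξ k) (U s u)) s := by
  have := weak_Pk hU u (-t) (-ξ) (-k) s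
  unfold pkL dL
  simp only [inner_toLp, map_mul, Pk_conj, qP_conj]
  exact this

/-- time derivative of `qP` -/
def qD (t : ℝ) (ξ : Fin N → Fin m → ℝ) (x : Cfg m n N) : ℂ :=
  ∑ β, ∑ i, (-4 * Complex.I * (((x β).1 i : ℂ) - Complex.I * ξ β i) ^ 2 * (sP t)⁻¹ ^ 3 + 2 * Complex.I * (sP t)⁻¹ ^ 2)

lemma sP_deriv (t : ℝ) : HasDerivAt sP (2 * Complex.I) t := by
  unfold sP
  have h := ((hasDerivAt_id t).ofReal_comp).const_mul (2 * Complex.I)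
  simpa using h.const_add 1

lemma sP_inv_deriv (t : ℝ) : HasDerivAt (fun t => (sP t)⁻¹) (-(2 * Complex.I) * (sP t)⁻¹ ^ 2) t := by
  have := (sP_deriv t).inv (sP_ne t)
  refine hda_congr this (fun s => rfl) ?_
  have := sP_ne t
  field_simp

lemma qP_deriv (t : ℝ) (ξ : Fin N → Fin m → ℝ) (k : Fin N → Fin n → ℤ) (x : Cfg m n N) :
    HasDerivAt (fun t => qP t ξ k x) (qD t ξ x) t := by
  unfold qP qD
  refine HasDerivAt.fun_sum fun β _ => ?_
  refine (HasDerivAt.fun_sum fun i _ => ?_).add_const _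
  have h := sP_inv_deriv t
  have h1 := ((h.pow 2).const_mul ((((x β).1 i : ℂ) - Complex.I * ξ β i) ^ 2)).sub h
  refine hda_congr h1 (fun s => ?_) ?_
  · have := sP_ne s
    simp
    field_simp
    ring
  · simp; ring

lemma qD_bound (t : ℝ) (ξ : Fin N → Fin m → ℝ) (k : Fin N → Fin n → ℤ) (x : Cfg m n N) :
    ‖qD t ξ x‖ ≤ cst n ξ k * (1 + SS x) := by
  have h : ‖qD t ξ x‖ ≤ ∑ β, ∑ i, (8 * (x β).1 i ^ 2 + (4 * (2 * ξ β i ^ 2) + 2)) := by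
    unfold qD
    refine (norm_sum_le _ _).trans (Finset.sum_le_sum fun β _ => (norm_sum_le _ _).trans (Finset.sum_le_sum fun i _ => (norm_add_le _ _).trans ?_))
    have h0 := sP_inv_norm t
    have h0' := norm_nonneg (sP t)⁻¹
    have h3 : ‖(sP t)⁻¹‖ ^ 3 ≤ 1 := pow_le_one₀ h0' h0
    have h2 : ‖(sP t)⁻¹‖ ^ 2 ≤ 1 := pow_le_one₀ h0' h0
    have h1 := ysq_bound ((x β).1 i) (ξ β i)
    simp only [norm_mul, norm_neg, norm_pow, Complex.norm_I, Complex.norm_ofNat, mul_one]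
    have h4 : ‖((x β).1 i : ℂ) - Complex.I * ξ β i‖ ^ 2 * ‖(sP t)⁻¹‖ ^ 3 ≤ ‖((x β).1 i : ℂ) - Complex.I * ξ β i‖ ^ 2 :=
      mul_le_of_le_one_right (by positivity) h3
    nlinarith
  have hS := SS_nonneg x
  have h5 : ∑ β, ∑ i, (8 * (x β).1 i ^ 2 + (4 * (2 * ξ β i ^ 2) + 2)) = 8 * SS x + ∑ β : Fin N, ∑ i : Fin m, (4 * (2 * ξ β i ^ 2) + 2) := by
    simp only [Finset.sum_add_distrib, SS, Finset.mul_sum]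
  have h6 : ∑ β : Fin N, ∑ i : Fin m, (4 * (2 * ξ β i ^ 2) + 2) + 10 ≤ cst n ξ k := by
    unfold cst
    rw [Finset.sum_add_distrib]
    have : (0:ℝ) ≤ ∑ β, ∑ j, ‖(2 * Real.pi * Complex.I * (k β j) : ℂ) ^ 2‖ := by positivity
    linarith
  have h7 : (0:ℝ) ≤ ∑ β : Fin N, ∑ i : Fin m, (4 * (2 * ξ β i ^ 2) + 2) := by positivity
  nlinarith

lemma Pk_deriv (t : ℝ) (ξ : Fin N → Fin m → ℝ) (k : Fin N → Fin n → ℤ) (x : Cfg m n N) :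
    HasDerivAt (fun t => Pk t ξ k x) (Complex.I * (qP t ξ k x * Pk t ξ k x)) t := by
  have h : ∀ β ∈ Finset.univ, HasDerivAt (fun t => -((m:ℂ)/2) * Complex.log (sP t) - (2 * sP t)⁻¹ * ∑ i, (((x β).1 i : ℂ) - Complex.I * ξ β i) ^ 2
      + -(4 * Real.pi ^ 2 * Complex.I * t * ∑ j, (k β j : ℂ) ^ 2))
      (Complex.I * ((∑ i, ((-(((x β).1 i : ℂ) - Complex.I * ξ β i) / sP t) ^ 2 - 2 * (2 * sP t)⁻¹)) + ∑ j, (2 * Real.pi * Complex.I * (k β j) : ℂ) ^ 2)) t := by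
    intro β _
    have h1 : HasDerivAt (fun t => Complex.log (sP t)) (2 * Complex.I / sP t) t :=
      (sP_deriv t).clog_real (sP_slit t)
    have h2 := (sP_inv_deriv t).mul_const ((1/2 : ℂ) * ∑ i, (((x β).1 i : ℂ) - Complex.I * ξ β i) ^ 2)
    have h3 := (((hasDerivAt_id t).ofReal_comp).const_mul (4 * Real.pi ^ 2 * Complex.I)).mul_const (∑ j, (k β j : ℂ) ^ 2)
    have h4 := ((h1.const_mul (-((m:ℂ)/2))).sub h2).add h3.neg
    refine hda_congr h4 (fun s => ?_) ?_
    · simp only [Pi.add_apply, Pi.sub_apply, Pi.neg_apply, mul_inv, id]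
      ring
    · have := sP_ne t
      simp only [Finset.sum_sub_distrib, div_pow, neg_sq, ← Finset.sum_div, mul_pow, ← Finset.mul_sum, Finset.sum_const,
        Finset.card_univ, Fintype.card_fin, Complex.I_sq, nsmul_eq_mul, Complex.ofReal_one]
      field_simp
      ring
  have h2 := ((HasDerivAt.fun_sum h).cexp).mul_const (∏ β, ∏ j, (fourier (k β j) : C(AddCircle (1:ℝ), ℂ)) ((x β).2 j))
  have e : ∀ s, Pk s ξ k x = Complex.exp (∑ β, (-((m:ℂ)/2) * Complex.log (sP s) - (2 * sP s)⁻¹ * ∑ i, (((x β).1 i : ℂ) - Complex.I * ξ β i) ^ 2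
      + -(4 * Real.pi ^ 2 * Complex.I * s * ∑ j, (k β j : ℂ) ^ 2))) * ∏ β, ∏ j, (fourier (k β j) : C(AddCircle (1:ℝ), ℂ)) ((x β).2 j) := by
    intro s
    unfold Pk gP tP
    rw [Complex.exp_sum, ← Finset.prod_mul_distrib]
    refine Finset.prod_congr rfl fun β _ => ?_
    rw [Complex.exp_add]; ring
  refine hda_congr h2 e ?_
  rw [e t]
  unfold qP
  rw [← Finset.mul_sum]; ring

lemma pkL_deriv (t : ℝ) (ξ : Fin N → Fin m → ℝ) (k : Fin N → Fin n → ℤ) :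
    HasDerivAt (fun t => pkL t ξ k : ℝ → L2 m n N) (Complex.I • dL t ξ k) t := by
  obtain ⟨c, B, hc, hB, h⟩ := Pk_poly_bound (m := m) (n := n) (N := N) (|t| + 1)
  obtain ⟨D, hD, hn⟩ := norm_le_of_bound (m := m) (n := n) (N := N) hc
  have hC := cst_nonneg ξ k
  have hxi : 0 < xis ξ := Real.exp_pos _
  set M := (cst n ξ k + cst n ξ k ^ 2) * (B * xis ξ) with hM
  have hM0 : 0 ≤ M := by positivity
  have key : ∀ s, |s - t| ≤ 1 → ∀ x, ‖Pk s ξ k x - Pk t ξ k x - (s - t : ℝ) * (Complex.I * (qP t ξ k x * Pk t ξ k x))‖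
      ≤ (M * |s - t| ^ 2) * Real.exp (-c * SS x) := by
    intro s hs x
    set E := Real.exp (-c * SS x)
    have hE : 0 < E := Real.exp_pos _
    have hS := SS_nonneg x
    have hd2 : ∀ r, HasDerivAt (fun r => Complex.I * (qP r ξ k x * Pk r ξ k x))
        (Complex.I * (qD r ξ x * Pk r ξ k x + qP r ξ k x * (Complex.I * (qP r ξ k x * Pk r ξ k x)))) r := fun r =>
      ((qP_deriv r ξ k x).mul (Pk_deriv r ξ k x)).const_mul _
    have hsub : ∀ r ∈ Set.uIcc t s, |r| ≤ |t| + 1 ∧ |r - t| ≤ |s - t| := by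
      intro r hr
      have h1 := Set.abs_sub_left_of_mem_uIcc hr
      refine ⟨?_, h1⟩
      have := abs_add_le (r - t) t
      rw [sub_add_cancel] at this
      linarith
    have b2 : ∀ r ∈ Set.uIcc t s, ‖Complex.I * (qD r ξ x * Pk r ξ k x + qP r ξ k x * (Complex.I * (qP r ξ k x * Pk r ξ k x)))‖ ≤ M * E := by
      intro r hr
      have h1 := h r (hsub r hr).1 ξ k x
      rw [norm_mul, Complex.norm_I, one_mul]
      have e : qD r ξ x * Pk r ξ k x + qP r ξ k x * (Complex.I * (qP r ξ k x * Pk r ξ k x)) =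
        (qD r ξ x + Complex.I * qP r ξ k x ^ 2) * Pk r ξ k x := by ring
      rw [e, norm_mul]
      have e1 : ‖qD r ξ x + Complex.I * qP r ξ k x ^ 2‖ ≤ (cst n ξ k + cst n ξ k ^ 2) * (1 + SS x) ^ 2 := by
        refine (norm_add_le _ _).trans ?_
        rw [norm_mul, Complex.norm_I, one_mul, norm_pow]
        have a1 := qD_bound r ξ k x
        have a2 : ‖qP r ξ k x‖ ^ 2 ≤ (cst n ξ k * (1 + SS x)) ^ 2 := by gcongr; exact qP_bound _ _ _ _
        have a3 : cst n ξ k * (1 + SS x) ≤ cst n ξ k * (1 + SS x) ^ 2 := by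
          refine mul_le_mul_of_nonneg_left ?_ hC; nlinarith
        nlinarith
      calc _ ≤ (cst n ξ k + cst n ξ k ^ 2) * (1 + SS x) ^ 2 * ‖Pk r ξ k x‖ := by gcongr
        _ = (cst n ξ k + cst n ξ k ^ 2) * ((1 + SS x) ^ 2 * ‖Pk r ξ k x‖) := by ring
        _ ≤ (cst n ξ k + cst n ξ k ^ 2) * (B * xis ξ * E) := mul_le_mul_of_nonneg_left h1 (by positivity)
        _ = _ := by rw [hM]; ring
    have b1 : ∀ r ∈ Set.uIcc t s, ‖Complex.I * (qP r ξ k x * Pk r ξ k x) - Complex.I * (qP t ξ k x * Pk t ξ k x)‖ ≤ M * E * |s - t| := by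
      intro r hr
      have := (convex_uIcc t s).norm_image_sub_le_of_norm_hasDerivWithin_le (fun r _ => (hd2 r).hasDerivWithinAt) b2 Set.left_mem_uIcc hr
      refine this.trans ?_
      rw [Real.norm_eq_abs]
      exact mul_le_mul_of_nonneg_left (hsub r hr).2 (by positivity)
    have hd1 : ∀ r ∈ Set.uIcc t s, HasDerivWithinAt (fun r : ℝ => Pk r ξ k x - ((r : ℝ) : ℂ) * (Complex.I * (qP t ξ k x * Pk t ξ k x)))
        (Complex.I * (qP r ξ k x * Pk r ξ k x) - Complex.I * (qP t ξ k x * Pk t ξ k x)) (Set.uIcc t s) r := fun r _ => by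
      have := (Pk_deriv r ξ k x).sub (((hasDerivAt_id r).ofReal_comp).mul_const (Complex.I * (qP t ξ k x * Pk t ξ k x)))
      refine (hda_congr this (fun s => ?_) ?_).hasDerivWithinAt <;> simp
    have := (convex_uIcc t s).norm_image_sub_le_of_norm_hasDerivWithin_le hd1 b1 Set.left_mem_uIcc Set.right_mem_uIcc
    rw [Real.norm_eq_abs] at this
    calc _ = _ := by congr 1; push_cast; ring
      _ ≤ _ := this
      _ = _ := by ring
  rw [hasDerivAt_iff_isLittleO]
  have hO : (fun s => pkL s ξ k - pkL t ξ k - (s - t) • Complex.I • dL t ξ k : ℝ → L2 m n N) =O[nhds t] fun s => (s - t) ^ 2 := by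
    refine Asymptotics.IsBigO.of_bound (M * D) ?_
    filter_upwards [Metric.closedBall_mem_nhds t one_pos] with s hs
    rw [Metric.mem_closedBall, Real.dist_eq] at hs
    have hmem : MemLp (fun x => Pk s ξ k x - Pk t ξ k x - (s - t : ℝ) * (Complex.I * (qP t ξ k x * Pk t ξ k x))) 2 (volume : Measure (Cfg m n N)) :=
      ((Pk_memLp s ξ k).sub (Pk_memLp t ξ k)).sub (((qPk_memLp t ξ k).const_mul _).const_mul _)
    have e : pkL s ξ k - pkL t ξ k - (s - t) • Complex.I • dL t ξ k = hmem.toLp _ := by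
      have e1 : (s - t) • Complex.I • dL t ξ k = ((s - t : ℝ) : ℂ) • Complex.I • dL t ξ k := (Complex.coe_smul _ _).symm
      rw [e1]; rfl
    rw [e]
    refine (hn _ hmem _ (key s hs)).trans (le_of_eq ?_)
    rw [norm_pow, Real.norm_eq_abs]; ring
  refine hO.trans_isLittleO ?_
  refine Asymptotics.IsLittleO.of_bound fun ε hε => ?_
  filter_upwards [Metric.closedBall_mem_nhds t hε] with s hs
  rw [Metric.mem_closedBall, Real.dist_eq] at hs
  rw [norm_pow, sq, Real.norm_eq_abs]
  gcongr

end PartNine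
end ManyBodyWaveguide

namespace ManyBodyWaveguide
section PartTen
variable {m n N : ℕ}

lemma gP_zero (ξ y : Fin m → ℝ) : gP 0 ξ y = ((Real.exp (∑ i, ξ i ^ 2 / 2) : ℝ) : ℂ) * (((Real.exp (-(1/2) * ∑ i, y i ^ 2) : ℝ) : ℂ) *
    Complex.exp (Complex.I * ∑ i, (ξ i : ℂ) * y i)) := by
  unfold gP
  rw [sP_zero, Complex.log_one, Complex.ofReal_exp, Complex.ofReal_exp, ← Complex.exp_add, ← Complex.exp_add]
  congr 1
  push_cast
  simp only [Finset.mul_sum, ← Finset.sum_add_distrib, mul_zero, zero_sub, ← Finset.sum_neg_distrib]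
  refine Finset.sum_congr rfl fun i _ => ?_
  linear_combination (-(ξ i : ℂ) ^ 2 / 2) * Complex.I_sq

lemma Pk_zero (ξ : Fin N → Fin m → ℝ) (k : Fin N → Fin n → ℤ) (x : Cfg m n N) :
    Pk 0 ξ k x = ((Real.exp (∑ β, ∑ i, ξ β i ^ 2 / 2) : ℝ) : ℂ) * (((Real.exp (-(1/2) * SS x) : ℝ) : ℂ) * chr ξ k x) := by
  unfold Pk chr SS tP
  simp only [gP_zero]
  rw [Real.exp_sum, Finset.mul_sum, Real.exp_sum]
  push_cast
  rw [← Finset.prod_mul_distrib, ← Finset.prod_mul_distrib]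
  refine Finset.prod_congr rfl fun β _ => ?_
  simp
  ring

lemma pkL_zero (ξ : Fin N → Fin m → ℝ) (k : Fin N → Fin n → ℤ) :
    pkL 0 ξ k = ((Real.exp (∑ β, ∑ i, ξ β i ^ 2 / 2) : ℝ) : ℂ) • wchr (gauss_memLp (m := m) (n := n) (N := N) (c := 1/2) (by norm_num)) (ξ, k) := by
  unfold pkL wchr
  rw [← MemLp.toLp_const_smul]
  congr 1
  funext x
  exact Pk_zero ξ k x

lemma pkL_dense : (Submodule.span ℂ (Set.range fun p : (Fin N → Fin m → ℝ) × (Fin N → Fin n → ℤ) => pkL 0 p.1 p.2)).topologicalClosure = ⊤ := by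
  have h := wchr_dense (gauss_memLp (m := m) (n := n) (N := N) (c := 1/2) (by norm_num)) (fun x => Real.exp_pos _)
  rw [eq_top_iff, ← h]
  refine Submodule.topologicalClosure_mono (Submodule.span_le.2 ?_)
  rintro _ ⟨⟨ξ, k⟩, rfl⟩
  have e : wchr (gauss_memLp (m := m) (n := n) (N := N) (c := 1/2) (by norm_num)) (ξ, k) =
    ((Real.exp (∑ β, ∑ i, ξ β i ^ 2 / 2) : ℝ) : ℂ)⁻¹ • pkL 0 ξ k := by
    rw [pkL_zero, smul_smul, inv_mul_cancel₀, one_smul]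
    exact_mod_cast (Real.exp_pos _).ne'
  rw [SetLike.mem_coe, e]
  exact Submodule.smul_mem _ _ (Submodule.subset_span ⟨(ξ, k), rfl⟩)

lemma approx_span {S : Submodule ℂ (L2 m n N)} (hS : S.topologicalClosure = ⊤) (v : L2 m n N) {ε : ℝ} (hε : 0 < ε) :
    ∃ w ∈ S, ‖v - w‖ < ε := by
  have : v ∈ closure (S : Set (L2 m n N)) := by
    have : v ∈ S.topologicalClosure := by rw [hS]; trivial
    exact this
  obtain ⟨w, hw, h⟩ := Metric.mem_closure_iff.1 this ε hε
  exact ⟨w, hw, by rwa [dist_eq_norm] at h⟩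

variable {U : ℝ → L2 m n N →L[ℂ] L2 m n N}

lemma U_inner (hU : IsPropagator m n N 0 U) (t : ℝ) (u v : L2 m n N) : inner ℂ (U t u) (U t v) = inner ℂ u v := by
  let L : L2 m n N →ₗᵢ[ℂ] L2 m n N := ⟨(U t).toLinearMap, hU.unitary t⟩
  exact L.inner_map_map u v

lemma U_inner_cont (hU : IsPropagator m n N 0 U) (u v : L2 m n N) : Continuous fun t => inner ℂ v (U t u) := by
  have h1 : ∀ w ∈ Submodule.span ℂ (Set.range fun p : (Fin N → Fin m → ℝ) × (Fin N → Fin n → ℤ) => pkL 0 p.1 p.2),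
      Continuous fun t => inner ℂ w (U t u) := by
    intro w hw
    induction hw using Submodule.span_induction with
    | mem x hx =>
      obtain ⟨p, rfl⟩ := hx
      exact continuous_iff_continuousAt.2 fun t => (weak_inner hU u 0 p.1 p.2 t).continuousAt
    | zero => simp only [inner_zero_left]; exact continuous_const
    | add x y _ _ hx hy => simp only [inner_add_left]; exact hx.add hy
    | smul a x _ hx => simp only [inner_smul_left]; exact continuous_const.mul hx
  refine continuous_of_uniform_approx_of_continuous fun V hV => ?_
  obtain ⟨ε, hε, hV⟩ := Metric.mem_uniformity_dist.1 hV
  obtain ⟨w, hw, h⟩ := approx_span pkL_dense v (ε := ε / (‖u‖ + 1)) (by positivity)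
  refine ⟨_, h1 w hw, fun t => hV ?_⟩
  rw [dist_eq_norm, ← inner_sub_left]
  refine (norm_inner_le_norm _ _).trans_lt ?_
  rw [hU.unitary]
  rw [lt_div_iff₀ (by positivity)] at h
  have := norm_nonneg (v - w)
  have := norm_nonneg u
  nlinarith

lemma U_cont (hU : IsPropagator m n N 0 U) (u : L2 m n N) : Continuous fun t => U t u := by
  refine continuous_iff_continuousAt.2 fun t0 => ?_
  rw [ContinuousAt, tendsto_iff_norm_sub_tendsto_zero]
  have h1 : ∀ t, ‖U t u - U t0 u‖ = Real.sqrt (2 * ‖u‖ ^ 2 - 2 * (inner ℂ (U t0 u) (U t u)).re) := by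
    intro t
    have h := norm_sub_sq (𝕜 := ℂ) (U t0 u) (U t u)
    rw [norm_sub_rev, hU.unitary, hU.unitary] at h
    rw [← Real.sqrt_sq (norm_nonneg (U t u - U t0 u)), h]
    congr 1
    simp only [RCLike.re_to_complex]; ring
  simp_rw [h1]
  have h2 : Continuous fun t => Real.sqrt (2 * ‖u‖ ^ 2 - 2 * (inner ℂ (U t0 u) (U t u)).re) :=
    Real.continuous_sqrt.comp (continuous_const.sub (continuous_const.mul (Complex.continuous_re.comp (U_inner_cont hU u _))))
  have h3 := h2.tendsto t0
  have h4 : 2 * ‖u‖ ^ 2 - 2 * (inner ℂ (U t0 u) (U t0 u)).re = 0 := by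
    have h5 := inner_self_eq_norm_sq (𝕜 := ℂ) (U t0 u)
    rw [hU.unitary] at h5
    rw [← h5]; simp
  rw [h4, Real.sqrt_zero] at h3
  exact h3

lemma U_pk (hU : IsPropagator m n N 0 U) (t : ℝ) (ξ : Fin N → Fin m → ℝ) (k : Fin N → Fin n → ℤ) :
    U t (pkL 0 ξ k) = pkL t ξ k := by
  have hd : ∀ u : L2 m n N, ∀ t0, HasDerivAt (fun t => inner ℂ (pkL t ξ k) (U t u)) 0 t0 := by
    intro u t0
    have h1 := weak_inner hU u t0 ξ k t0
    have h2 : HasDerivAt (fun t => inner ℂ (pkL t ξ k - pkL t0 ξ k) (U t u)) (inner ℂ (Complex.I • dL t0 ξ k) (U t0 u)) t0 := by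
      rw [hasDerivAt_iff_tendsto_slope]
      have h3 := hasDerivAt_iff_tendsto_slope.1 (pkL_deriv t0 ξ k)
      have h4 : Filter.Tendsto (fun t => U t u) (nhdsWithin t0 {t0}ᶜ) (nhds (U t0 u)) :=
        ((U_cont hU u).tendsto t0).mono_left nhdsWithin_le_nhds
      refine (h3.inner h4).congr fun s => ?_
      simp only [slope_def_module, sub_self, inner_zero_left, sub_zero]
      have e : (s - t0)⁻¹ • (pkL s ξ k - pkL t0 ξ k) = (((s - t0)⁻¹ : ℝ) : ℂ) • (pkL s ξ k - pkL t0 ξ k) :=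
        (Complex.coe_smul _ _).symm
      rw [e, inner_smul_left, Complex.conj_ofReal, Complex.real_smul]
    refine hda_congr (h1.add h2) (fun s => ?_) ?_
    · simp only [Pi.add_apply, inner_sub_left]; ring
    · rw [inner_smul_left]; simp
  have hc : ∀ u : L2 m n N, inner ℂ (pkL t ξ k) (U t u) = inner ℂ (pkL 0 ξ k) u := by
    intro u
    have := is_const_of_deriv_eq_zero (fun s => (hd u s).differentiableAt) (fun s => (hd u s).deriv) t 0
    simpa [IsPropagator.init hU] using this
  refine (ext_inner_right ℂ fun w => ?_).symm
  have e : w = U t (U (-t) w) := by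
    have := hU.group t (-t)
    rw [add_neg_cancel, IsPropagator.init hU] at this
    exact DFunLike.congr_fun this w
  rw [e, hc, U_inner hU]

end PartTen
end ManyBodyWaveguide

namespace ManyBodyWaveguide
section PartEleven
variable {m n N : ℕ}

lemma enorm_sq_toLp {f : Cfg m n N → ℂ} (hf : MemLp f 2) : ‖hf.toLp f‖ₑ ^ 2 = ∫⁻ x, ‖f x‖ₑ ^ 2 := by
  rw [Lp.enorm_def, eLpNorm_congr_ae hf.coeFn_toLp, eLpNorm_eq_lintegral_rpow_enorm_toReal (by norm_num) (by norm_num), ← ENNReal.rpow_two,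
    ← ENNReal.rpow_mul]
  simp

/-- mass of the centred Gaussian -/
def JJ (m : ℕ) (t : ℝ) : ℝ≥0∞ := ∫⁻ y : Fin m → ℝ, ‖gP t 0 y‖ₑ ^ 2

lemma JJ_eq (t : ℝ) : JJ m t = ENNReal.ofReal (Real.sqrt Real.pi ^ m) := by
  have hs : 0 < ‖sP t‖ := norm_pos_iff.2 (sP_ne t)
  have h1 : ∀ y : Fin m → ℝ, ‖gP t 0 y‖ₑ ^ 2 = ENNReal.ofReal (∏ i, (‖sP t‖⁻¹ * Real.exp (-kap t * y i ^ 2))) := by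
    intro y
    rw [← ofReal_norm, ← ENNReal.ofReal_pow (norm_nonneg _), gP, Complex.norm_exp, gP_re]
    congr 1
    rw [Finset.prod_mul_distrib, ← Real.exp_sum, Finset.prod_const, Finset.card_univ, Fintype.card_fin, ← Real.exp_nat_mul]
    have : ‖sP t‖⁻¹ ^ m = Real.exp (-m * Real.log ‖sP t‖) := by
      rw [neg_mul, Real.exp_neg, Real.exp_nat_mul, Real.exp_log hs, inv_pow]
    rw [this, ← Real.exp_add, ← Finset.mul_sum]
    congr 1
    simp
    ring
  unfold JJ
  simp_rw [h1]
  have h_integ : Integrable (fun y : Fin m → ℝ => ∏ i, (‖sP t‖⁻¹ * Real.exp (-kap t * y i ^ 2))) :=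
    Integrable.fintype_prod (f := fun (_ : Fin m) (x : ℝ) => ‖sP t‖⁻¹ * Real.exp (-kap t * x ^ 2))
      (fun _ => (integrable_exp_neg_mul_sq (kap_pos t)).const_mul _)
  rw [← ofReal_integral_eq_lintegral_ofReal h_integ (Filter.Eventually.of_forall fun y => by positivity)]
  congr 1
  rw [integral_fintype_prod_volume_eq_pow (fun x : ℝ => ‖sP t‖⁻¹ * Real.exp (-kap t * x ^ 2)), Fintype.card_fin, integral_const_mul, integral_gaussian]
  congr 1
  have : Real.pi / kap t = Real.pi * ‖sP t‖ ^ 2 := by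
    rw [← Complex.normSq_eq_norm_sq, sP_normSq, kap, div_inv_eq_mul]
  rw [this, Real.sqrt_mul Real.pi_pos.le, Real.sqrt_sq hs.le]
  field_simp

lemma Pk_swap (α : Fin N) (t : ℝ) (ξ : Fin N → Fin m → ℝ) (k : Fin N → Fin n → ℤ) (y y' : Fin m → ℝ) (z : Torus n)
    (h : Hat m n N α) :
    gP t (ξ α) y * Pk t (Function.update ξ α 0) k (glue m n N α (y', z) h) =
      gP t 0 y' * Pk t ξ k (glue m n N α (y, z) h) := by
  unfold Pk
  rw [← Finset.mul_prod_erase _ _ (Finset.mem_univ α), ← Finset.mul_prod_erase Finset.univ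
    (fun β => gP t (ξ β) (glue m n N α (y, z) h β).1 * tP t (k β) (glue m n N α (y, z) h β).2) (Finset.mem_univ α)]
  have e : ∏ β ∈ Finset.univ.erase α, (gP t (Function.update ξ α 0 β) (glue m n N α (y', z) h β).1 * tP t (k β) (glue m n N α (y', z) h β).2)
    = ∏ β ∈ Finset.univ.erase α, (gP t (ξ β) (glue m n N α (y, z) h β).1 * tP t (k β) (glue m n N α (y, z) h β).2) := by
    refine Finset.prod_congr rfl fun β hβ => ?_
    have hβ' : β ≠ α := (Finset.mem_erase.1 hβ).1
    rw [Function.update_of_ne hβ']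
    simp only [glue, dif_neg hβ']
  rw [e, Function.update_self]
  simp only [glue, dif_pos]
  ring

/-- packet with vanishing frequency at particle `α` -/
def omL (α : Fin N) (t : ℝ) (p : (Fin N → Fin m → ℝ) × (Fin N → Fin n → ℤ)) : L2 m n N :=
  pkL t (Function.update p.1 α 0) p.2

/-- superposition of packets -/
def Fs (s : Finset ((Fin N → Fin m → ℝ) × (Fin N → Fin n → ℤ))) (c : (Fin N → Fin m → ℝ) × (Fin N → Fin n → ℤ) → ℂ) (t : ℝ) (x : Cfg m n N) : ℂ :=
  ∑ p ∈ s, c p * Pk t p.1 p.2 x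

lemma Fs_continuous (s : Finset ((Fin N → Fin m → ℝ) × (Fin N → Fin n → ℤ))) (c : (Fin N → Fin m → ℝ) × (Fin N → Fin n → ℤ) → ℂ) (t : ℝ) :
    Continuous (Fs s c t) :=
  continuous_finsetSum _ fun p _ => continuous_const.mul (Pk_continuous t p.1 p.2)

lemma sum_toLp (s : Finset ((Fin N → Fin m → ℝ) × (Fin N → Fin n → ℤ))) (c : (Fin N → Fin m → ℝ) × (Fin N → Fin n → ℤ) → ℂ)
    (f : (Fin N → Fin m → ℝ) × (Fin N → Fin n → ℤ) → Cfg m n N → ℂ) (hf : ∀ p, MemLp (f p) 2) :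
    ∃ h : MemLp (fun x => ∑ p ∈ s, c p * f p x) 2, ∑ p ∈ s, c p • (hf p).toLp (f p) = h.toLp _ := by
  have h : MemLp (fun x => ∑ p ∈ s, c p * f p x) 2 := memLp_finsetSum s fun p _ => (hf p).const_mul (c p)
  refine ⟨h, ?_⟩
  ext1
  refine (Lp.coeFn_finsetSum s _).trans ?_
  have h1 : ∀ᵐ x, ∀ p ∈ s, (c p • (hf p).toLp (f p)) x = c p * f p x := by
    rw [Filter.eventually_all_finset]
    intro p _
    filter_upwards [Lp.coeFn_smul (c p) ((hf p).toLp (f p)), (hf p).coeFn_toLp] with x h1 h2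
    rw [h1, Pi.smul_apply, h2, smul_eq_mul]
  filter_upwards [h1, h.coeFn_toLp] with x h2 h3
  rw [h3, Finset.sum_apply]
  exact Finset.sum_congr rfl h2

lemma GG_om (α : Fin N) (s : Finset ((Fin N → Fin m → ℝ) × (Fin N → Fin n → ℤ))) (c : (Fin N → Fin m → ℝ) × (Fin N → Fin n → ℤ) → ℂ)
    (t : ℝ) (y : Fin m → ℝ) :
    JJ m t * GG α (Fs s c t) y ^ (2:ℝ) = ‖∑ p ∈ s, (c p * gP t (p.1 α) y) • omL α t p‖ₑ ^ 2 := by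
  obtain ⟨h, e⟩ := sum_toLp s (fun p => c p * gP t (p.1 α) y) (fun p => Pk t (Function.update p.1 α 0) p.2)
    (fun p => Pk_memLp t _ p.2)
  unfold omL pkL
  rw [e, enorm_sq_toLp, lintegral_glue α, JJ, GG_sq]
  · have e2 : ∀ y' z h, ‖∑ p ∈ s, (c p * gP t (p.1 α) y) * Pk t (Function.update p.1 α 0) p.2 (glue m n N α (y', z) h)‖ₑ ^ 2
      = ‖gP t 0 y'‖ₑ ^ 2 * ‖Fs s c t (glue m n N α (y, z) h)‖ₑ ^ 2 := by
      intro y' z h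
      rw [← mul_pow, ← enorm_mul, Fs, Finset.mul_sum]
      congr 2
      refine Finset.sum_congr rfl fun p _ => ?_
      rw [mul_assoc, Pk_swap]; ring
    simp_rw [e2]
    rw [← lintegral_mul_const _ ((gP_continuous t 0).measurable.enorm.pow_const 2)]
    refine lintegral_congr fun y' => ?_
    rw [← lintegral_const_mul' _ _ (by finiteness)]
    refine lintegral_congr fun z => ?_
    rw [← lintegral_const_mul' _ _ (by finiteness)]
  · refine Measurable.pow_const (Measurable.enorm ?_) 2
    refine Finset.measurable_fun_sum _ fun p _ => ?_
    exact measurable_const.mul (Pk_continuous t _ p.2).measurable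

/-- free kernel phase -/
def kern (t : ℝ) (y y' : Fin m → ℝ) : ℂ := Complex.exp (((∑ i, (y i - y' i) ^ 2 / (4 * t) : ℝ) : ℂ) * Complex.I)

lemma kern_enorm (t : ℝ) (y y' : Fin m → ℝ) : ‖kern t y y'‖ₑ = 1 := by
  rw [← ofReal_norm, kern, Complex.norm_exp_ofReal_mul_I, ENNReal.ofReal_one]

def bP (t : ℝ) : ℂ := 1 / 2 - Complex.I / (4 * t)

lemma bP_re (t : ℝ) : 0 < (bP t).re := by
  have : Complex.I / (4 * t) = ((1 / (4 * t) : ℝ) : ℂ) * Complex.I := by push_cast; ring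
  rw [bP, this, Complex.sub_re, Complex.re_ofReal_mul]
  simp

lemma bP_eq {t : ℝ} (ht : t ≠ 0) : bP t = -Complex.I * sP t / (4 * t) := by
  have : (t : ℂ) ≠ 0 := by exact_mod_cast ht
  unfold bP sP
  field_simp
  linear_combination (4 * (t : ℂ)) * Complex.I_sq

def CP (m : ℕ) (t : ℝ) : ℂ := Complex.exp (-((m:ℂ)/2) * Complex.log (sP t)) / (Real.pi / bP t) ^ ((Fintype.card (Fin m) : ℂ) / 2)

lemma piB_ne {t : ℝ} : (Real.pi / bP t : ℂ) ≠ 0 := by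
  refine div_ne_zero (by exact_mod_cast Real.pi_ne_zero) fun h => ?_
  have := bP_re t
  rw [h] at this; simp at this

lemma kern_gP {t : ℝ} (ht : t ≠ 0) (ξ y y' : Fin m → ℝ) : kern t y y' * gP 0 ξ y' =
    Complex.exp (∑ i, (Complex.I * (y i : ℂ) ^ 2 / (4 * t) + (ξ i : ℂ) ^ 2 / 2)) *
    Complex.exp (-bP t * ∑ i, (y' i : ℂ) ^ 2 + ∑ i, (-Complex.I * y i / (2 * t) + Complex.I * ξ i) * y' i) := by
  have ht' : (t : ℂ) ≠ 0 := by exact_mod_cast ht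
  unfold kern gP
  rw [sP_zero, Complex.log_one, ← Complex.exp_add, ← Complex.exp_add]
  congr 1
  push_cast
  simp only [Finset.mul_sum, Finset.sum_mul, mul_zero, zero_sub, ← Finset.sum_neg_distrib, ← Finset.sum_add_distrib]
  refine Finset.sum_congr rfl fun i _ => ?_
  unfold bP
  field_simp
  linear_combination (-4 * (t : ℂ) * (ξ i : ℂ) ^ 2 ) * Complex.I_sq

lemma kern_int {t : ℝ} (ht : t ≠ 0) (ξ y : Fin m → ℝ) : Integrable (fun y' => kern t y y' * gP 0 ξ y') := by
  simp_rw [kern_gP ht]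
  exact (GaussianFourier.integrable_cexp_neg_mul_sum_add (bP_re t) _).const_mul _

lemma kern_integral {t : ℝ} (ht : t ≠ 0) (ξ y : Fin m → ℝ) : gP t ξ y = CP m t * ∫ y', kern t y y' * gP 0 ξ y' := by
  have ht' : (t : ℂ) ≠ 0 := by exact_mod_cast ht
  simp_rw [kern_gP ht]
  rw [integral_const_mul, GaussianFourier.integral_cexp_neg_mul_sum_add (bP_re t)]
  have h0 : (Real.pi / bP t : ℂ) ^ ((Fintype.card (Fin m) : ℂ) / 2) ≠ 0 := by
    rw [Complex.cpow_def_of_ne_zero piB_ne]; exact Complex.exp_ne_zero _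
  have e : ∀ X Y Z P : ℂ, P ≠ 0 → X / P * (Y * (P * Z)) = X * (Y * Z) := by
    intro X Y Z P hP; field_simp
  rw [CP, e _ _ _ _ h0, ← Complex.exp_add, ← Complex.exp_add, gP]
  congr 1
  rw [sub_eq_add_neg]
  congr 1
  rw [Finset.sum_div, ← Finset.sum_add_distrib, Finset.mul_sum, ← Finset.sum_neg_distrib]
  refine Finset.sum_congr rfl fun i _ => ?_
  rw [bP_eq ht]
  have hs := sP_ne t
  have hI := Complex.I_ne_zero
  field_simp
  simp only [sP]
  ring_nf
  simp only [Complex.I_sq]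
  ring

lemma CP_norm {t : ℝ} (ht : t ≠ 0) : ‖CP m t‖ ≤ (1 / |t|) ^ ((m:ℝ) / 2) := by
  have hs : 0 < ‖sP t‖ := norm_pos_iff.2 (sP_ne t)
  have ht0 : 0 < |t| := abs_pos.2 ht
  have e0 : ((Fintype.card (Fin m) : ℂ) / 2) = (((m:ℝ)/2 : ℝ) : ℂ) := by simp
  have e1 : ‖Complex.exp (-((m:ℂ)/2) * Complex.log (sP t))‖ = (‖sP t‖⁻¹) ^ ((m:ℝ)/2) := by
    rw [Complex.norm_exp]
    have : (-((m:ℂ)/2) * Complex.log (sP t)).re = Real.log (‖sP t‖⁻¹) * ((m:ℝ)/2) := by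
      have : -((m:ℂ)/2) = ((-((m:ℝ)/2) : ℝ) : ℂ) := by push_cast; rfl
      rw [this, Complex.re_ofReal_mul, Complex.log_re, Real.log_inv]; ring
    rw [this, Real.rpow_def_of_pos (inv_pos.2 hs)]
  rw [CP, norm_div, e1, e0, Complex.norm_cpow_of_ne_zero piB_ne, Complex.ofReal_re, Complex.ofReal_im, mul_zero, Real.exp_zero, div_one,
    bP_eq ht, norm_div, norm_div, norm_mul, norm_neg, Complex.norm_I, norm_mul, Complex.norm_real, Complex.norm_real, Complex.norm_ofNat,
    ← Real.div_rpow (by positivity) (by positivity)]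
  refine Real.rpow_le_rpow (by positivity) ?_ (by positivity)
  rw [Real.norm_eq_abs, Real.norm_eq_abs, abs_of_pos Real.pi_pos]
  have e2 : ‖sP t‖⁻¹ / (Real.pi / (1 * ‖sP t‖ / (4 * |t|))) = 1 / (4 * Real.pi * |t|) := by
    field_simp
  rw [e2]
  have := Real.pi_gt_three
  gcongr
  nlinarith

lemma disp_GG {U : ℝ → L2 m n N →L[ℂ] L2 m n N} (hU : IsPropagator m n N 0 U) (α : Fin N)
    (s : Finset ((Fin N → Fin m → ℝ) × (Fin N → Fin n → ℤ))) (c : (Fin N → Fin m → ℝ) × (Fin N → Fin n → ℤ) → ℂ)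
    {t : ℝ} (ht : t ≠ 0) (y : Fin m → ℝ) :
    GG α (Fs s c t) y ≤ ENNReal.ofReal ((1 / |t|) ^ ((m:ℝ) / 2)) * ∫⁻ y', GG α (Fs s c 0) y' := by
  set J := ENNReal.ofReal (Real.sqrt Real.pi ^ m) with hJ
  have hJ0 : J ≠ 0 := by
    rw [hJ, Ne, ENNReal.ofReal_eq_zero, not_le]
    have := Real.sqrt_pos.2 Real.pi_pos
    positivity
  have hJt : J ≠ ∞ := ENNReal.ofReal_ne_top
  have hR0 : J ^ (1/2:ℝ) ≠ 0 := by simp [hJ0, hJt]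
  have hRt : J ^ (1/2:ℝ) ≠ ∞ := ENNReal.rpow_ne_top_of_nonneg (by norm_num) hJt
  have hsq : ∀ (t : ℝ) (y : Fin m → ℝ), J ^ (1/2:ℝ) * GG α (Fs s c t) y = ‖∑ p ∈ s, (c p * gP t (p.1 α) y) • omL α t p‖ₑ := by
    intro t y
    have h := GG_om α s c t y
    rw [JJ_eq, ← hJ] at h
    have h2 := congrArg (fun r : ℝ≥0∞ => r ^ (1/2:ℝ)) h
    rw [ENNReal.mul_rpow_of_nonneg _ _ (by norm_num), ← ENNReal.rpow_mul, ← ENNReal.rpow_two, ← ENNReal.rpow_mul] at h2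
    norm_num at h2
    rw [← h2]
  have hUn : ‖∑ p ∈ s, (c p * gP t (p.1 α) y) • omL α t p‖ₑ = ‖∑ p ∈ s, (c p * gP t (p.1 α) y) • omL α 0 p‖ₑ := by
    have : ∑ p ∈ s, (c p * gP t (p.1 α) y) • omL α t p = U t (∑ p ∈ s, (c p * gP t (p.1 α) y) • omL α 0 p) := by
      rw [map_sum]
      refine Finset.sum_congr rfl fun p _ => ?_
      rw [map_smul, omL, omL, U_pk hU]
    rw [this, ← ofReal_norm, hU.unitary, ofReal_norm]
  have hV : ∑ p ∈ s, (c p * gP t (p.1 α) y) • omL α 0 p =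
      CP m t • ∫ y', kern t y y' • ∑ p ∈ s, (c p * gP 0 (p.1 α) y') • omL α 0 p := by
    have e1 : ∀ y', kern t y y' • ∑ p ∈ s, (c p * gP 0 (p.1 α) y') • omL α 0 p
      = ∑ p ∈ s, (c p * (kern t y y' * gP 0 (p.1 α) y')) • omL α 0 p := by
      intro y'
      rw [Finset.smul_sum]
      refine Finset.sum_congr rfl fun p _ => ?_
      rw [smul_smul]; congr 1; ring
    simp_rw [e1]
    rw [integral_finsetSum _ fun p _ => ((kern_int ht (p.1 α) y).const_mul _).smul_const _, Finset.smul_sum]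
    refine Finset.sum_congr rfl fun p _ => ?_
    rw [integral_smul_const, integral_const_mul, smul_smul, kern_integral ht (p.1 α) y]
    congr 1; ring
  rw [← ENNReal.mul_le_mul_iff_right hR0 hRt, hsq, hUn, hV, enorm_smul]
  have hC : ‖CP m t‖ₑ ≤ ENNReal.ofReal ((1 / |t|) ^ ((m:ℝ) / 2)) := by
    rw [← ofReal_norm]; exact ENNReal.ofReal_le_ofReal (CP_norm ht)
  calc _ ≤ ENNReal.ofReal ((1 / |t|) ^ ((m:ℝ) / 2)) * ∫⁻ y', ‖kern t y y' • ∑ p ∈ s, (c p * gP 0 (p.1 α) y') • omL α 0 p‖ₑ := by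
        gcongr; exact enorm_integral_le_lintegral_enorm _
    _ = ENNReal.ofReal ((1 / |t|) ^ ((m:ℝ) / 2)) * ∫⁻ y', J ^ (1/2:ℝ) * GG α (Fs s c 0) y' := by
      congr 1
      refine lintegral_congr fun y' => ?_
      rw [enorm_smul, kern_enorm, one_mul, hsq]
    _ = _ := by
      rw [lintegral_const_mul' _ _ hRt]; ring

end PartEleven
end ManyBodyWaveguide

namespace ManyBodyWaveguide
section PartTwelve
variable {m n N : ℕ}

lemma half_sq (a : ℝ≥0∞) : (a ^ (2:ℝ)) ^ (1/2:ℝ) = a := by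
  rw [← ENNReal.rpow_mul]; norm_num

lemma half_sq' (a : ℝ≥0∞) : (a ^ 2) ^ (1/2:ℝ) = a := by
  rw [← ENNReal.rpow_two, half_sq]

lemma GG_prod (α : Fin N) {v : Cfg m n N → ℂ} (hv : Measurable v) (y : Fin m → ℝ) :
    GG α v y = eLpNorm (fun p : Torus n × Hat m n N α => v (glue m n N α (y, p.1) p.2)) 2 (volume.prod volume) := by
  have hc : Measurable fun p : Torus n × Hat m n N α => v (glue m n N α (y, p.1) p.2) :=
    hv.comp ((glue_mp m n N α).measurable.comp (by fun_prop : Measurable fun p : Torus n × Hat m n N α => (((y, p.1) : Wg m n), p.2)))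
  rw [← half_sq (GG α v y), GG_sq, eLpNorm_eq_lintegral_rpow_enorm_toReal (by norm_num) (by norm_num),
    lintegral_prod _ (hc.enorm.pow_const _).aemeasurable]
  simp

lemma GG_add (α : Fin N) {v w : Cfg m n N → ℂ} (hv : Measurable v) (hw : Measurable w) (y : Fin m → ℝ) :
    GG α (fun x => v x + w x) y ≤ GG α v y + GG α w y := by
  have hc : ∀ {v : Cfg m n N → ℂ}, Measurable v → Measurable fun p : Torus n × Hat m n N α => v (glue m n N α (y, p.1) p.2) := fun hv =>
    hv.comp ((glue_mp m n N α).measurable.comp (by fun_prop : Measurable fun p : Torus n × Hat m n N α => (((y, p.1) : Wg m n), p.2)))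
  have hvw : Measurable (fun x => v x + w x) := hv.add hw
  rw [GG_prod α hvw, GG_prod α hv, GG_prod α hw]
  exact eLpNorm_add_le (hc hv).aestronglyMeasurable (hc hw).aestronglyMeasurable (by norm_num)

lemma GG_mul (α : Fin N) (a : (Fin m → ℝ) → ℂ) (v : Cfg m n N → ℂ) (y : Fin m → ℝ) :
    GG α (fun x => a (x α).1 * v x) y = ‖a y‖ₑ * GG α v y := by
  rw [← half_sq (GG α _ y), GG_sq, ← half_sq (‖a y‖ₑ * GG α v y), ENNReal.mul_rpow_of_nonneg _ _ (by norm_num), GG_sq,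
    ← lintegral_const_mul' _ _ (by finiteness)]
  congr 1
  refine lintegral_congr fun z => ?_
  rw [← lintegral_const_mul' _ _ (by finiteness)]
  refine lintegral_congr fun h => ?_
  simp [glue, enorm_mul, mul_pow]

lemma GG_wt (α : Fin N) {a : (Fin m → ℝ) → ℂ} (ha : Measurable a) {v : Cfg m n N → ℂ} (hv : Measurable v) :
    ∫⁻ y, GG α (fun x => a (x α).1 * v x) y ≤ (∫⁻ y, ‖a y‖ₑ ^ 2) ^ (1/2:ℝ) * (∫⁻ x, ‖v x‖ₑ ^ 2) ^ (1/2:ℝ) := by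
  simp_rw [GG_mul]
  have h := ENNReal.lintegral_mul_le_Lp_mul_Lq volume Real.HolderConjugate.two_two ha.enorm.aemeasurable (GG_measurable α hv).aemeasurable
  have h2 := GG_setLIntegral α hv MeasurableSet.univ
  rw [setLIntegral_univ] at h2
  rw [h2] at h
  simpa [slab] using h

lemma PE_le (S : Set (Cfg m n N)) (hS : MeasurableSet S) (v : L2 m n N) : ‖PE volume S hS v‖ₑ ≤ ‖v‖ₑ := by
  have h1 := PE_enorm_sq S hS v
  have h2 := enorm_sq_toLp (Lp.memLp v)
  rw [Lp.toLp_coeFn] at h2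
  rw [← half_sq' ‖PE volume S hS v‖ₑ, ← half_sq' ‖v‖ₑ, h1, h2]
  exact ENNReal.rpow_le_rpow (setLIntegral_le_lintegral _ _) (by norm_num)

variable {U : ℝ → L2 m n N →L[ℂ] L2 m n N}

lemma U_enorm (hU : IsPropagator m n N 0 U) (t : ℝ) (f : L2 m n N) : ‖U t f‖ₑ = ‖f‖ₑ := by
  rw [← ofReal_norm, hU.unitary, ofReal_norm]

lemma Fs_memLp (s : Finset ((Fin N → Fin m → ℝ) × (Fin N → Fin n → ℤ))) (c : (Fin N → Fin m → ℝ) × (Fin N → Fin n → ℤ) → ℂ) (t : ℝ) :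
    MemLp (Fs s c t) 2 :=
  memLp_finsetSum s fun p _ => (Pk_memLp t p.1 p.2).const_mul (c p)

lemma U_Fs (hU : IsPropagator m n N 0 U) (s : Finset ((Fin N → Fin m → ℝ) × (Fin N → Fin n → ℤ)))
    (c : (Fin N → Fin m → ℝ) × (Fin N → Fin n → ℤ) → ℂ) (t : ℝ) :
    U t ((Fs_memLp s c 0).toLp _) = (Fs_memLp s c t).toLp _ := by
  have h : ∀ t, (Fs_memLp s c t).toLp _ = ∑ p ∈ s, c p • pkL t p.1 p.2 := fun t => by
    obtain ⟨h, e⟩ := sum_toLp s c (fun p => Pk t p.1 p.2) (fun p => Pk_memLp t p.1 p.2)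
    exact e.symm
  rw [h, h, map_sum]
  exact Finset.sum_congr rfl fun p _ => by rw [map_smul, U_pk hU]

lemma stepA (hU : IsPropagator m n N 0 U) (α : Fin N) (s : Finset ((Fin N → Fin m → ℝ) × (Fin N → Fin n → ℤ)))
    (c : (Fin N → Fin m → ℝ) × (Fin N → Fin n → ℤ) → ℂ) {t : ℝ} (ht : t ≠ 0) {E : Set (Fin m → ℝ)} (hE : MeasurableSet E) :
    ‖PE volume (slab n α E) (slab_meas α hE) (U t ((Fs_memLp s c 0).toLp _))‖ₑ ≤
      volume E ^ (1/2:ℝ) * (ENNReal.ofReal ((1 / |t|) ^ ((m:ℝ) / 2)) * ∫⁻ y, GG α (Fs s c 0) y) := by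
  rw [U_Fs hU, ← half_sq' ‖PE _ _ _ _‖ₑ, PE_enorm_sq, ← half_sq (_ * ∫⁻ y, GG α (Fs s c 0) y), ← ENNReal.mul_rpow_of_nonneg _ _ (by norm_num)]
  gcongr
  have e : ∫⁻ x in slab n α E, ‖((Fs_memLp s c t).toLp _ : Cfg m n N → ℂ) x‖ₑ ^ 2 = ∫⁻ x in slab n α E, ‖Fs s c t x‖ₑ ^ 2 := by
    refine lintegral_congr_ae (ae_restrict_of_ae ?_)
    filter_upwards [(Fs_memLp s c t).coeFn_toLp] with x hx
    rw [hx]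
  rw [e, ← GG_setLIntegral α (Fs_continuous s c t).measurable hE]
  calc _ ≤ ∫⁻ y in E, (ENNReal.ofReal ((1 / |t|) ^ ((m:ℝ) / 2)) * ∫⁻ y, GG α (Fs s c 0) y) ^ (2:ℝ) := by
        refine lintegral_mono fun y => ?_
        gcongr
        exact disp_GG hU α s c ht y
    _ = _ := by rw [setLIntegral_const, mul_comm]

lemma pos_eps {X A B K : ℝ≥0∞} (hA : A ≠ ∞) (hK : K ≠ ∞)
    (h : ∀ ε : ℝ, 0 < ε → X ≤ A * (B + K * ENNReal.ofReal ε) + ENNReal.ofReal ε) : X ≤ A * B := by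
  have h0 : Filter.Tendsto (fun ε : ℝ => ENNReal.ofReal ε) (nhdsWithin 0 (Set.Ioi 0)) (nhds 0) := by
    have := (ENNReal.continuous_ofReal.tendsto 0).mono_left (nhdsWithin_le_nhds (s := Set.Ioi (0:ℝ)))
    simpa using this
  have h1 : Filter.Tendsto (fun ε : ℝ => A * (B + K * ENNReal.ofReal ε) + ENNReal.ofReal ε) (nhdsWithin 0 (Set.Ioi 0))
      (nhds (A * (B + K * 0) + 0)) :=
    (ENNReal.Tendsto.const_mul (tendsto_const_nhds.add (ENNReal.Tendsto.const_mul h0 (Or.inr hK))) (Or.inr hA)).add h0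
  rw [mul_zero, add_zero, add_zero] at h1
  exact ge_of_tendsto h1 (by filter_upwards [self_mem_nhdsWithin] with ε hε using h ε hε)

/-- one-particle square norm -/
def sq1 (y : Fin m → ℝ) : ℝ := ∑ i, y i ^ 2

lemma sq1_continuous : Continuous (sq1 : (Fin m → ℝ) → ℝ) := by unfold sq1; fun_prop
lemma sq1_nonneg (y : Fin m → ℝ) : 0 ≤ sq1 y := Finset.sum_nonneg fun _ _ => sq_nonneg _
lemma sq1_le_SS (α : Fin N) (x : Cfg m n N) : sq1 (x α).1 ≤ SS x :=
  Finset.single_le_sum (f := fun β => ∑ i, (x β).1 i ^ 2) (fun _ _ => Finset.sum_nonneg fun _ _ => sq_nonneg _) (Finset.mem_univ α)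

/-- weight adapted to particle `α` -/
def Wp (α : Fin N) (x : Cfg m n N) : ℝ := Real.exp (-(1/2) * SS x + sq1 (x α).1 / 4)

lemma sq1a_continuous (α : Fin N) : Continuous fun x : Cfg m n N => sq1 (x α).1 :=
  sq1_continuous.comp (continuous_fst.comp (continuous_apply α))

lemma Wp_memLp (α : Fin N) : MemLp (Wp α : Cfg m n N → ℝ) 2 := by
  have hc : Continuous (Wp α : Cfg m n N → ℝ) :=
    Real.continuous_exp.comp ((continuous_const.mul SS_continuous).add ((sq1a_continuous α).div_const 4))
  refine (gauss_memLp (m := m) (n := n) (N := N) (c := 1/4) (by norm_num)).mono' hc.aestronglyMeasurable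
    (Filter.Eventually.of_forall fun x => ?_)
  rw [Real.norm_eq_abs, Wp, Real.abs_exp]
  refine Real.exp_le_exp.2 ?_
  have := sq1_le_SS α x
  linarith

lemma gaussK : (∫⁻ y : Fin m → ℝ, ‖((Real.exp (-(sq1 y / 4)) : ℝ) : ℂ)‖ₑ ^ 2) ≠ ∞ := by
  have h := (gauss_integrable_pi (ι := Fin m) (c := 1/2) (by norm_num)).2
  rw [hasFiniteIntegral_iff_enorm] at h
  refine ne_of_lt (lt_of_le_of_lt (le_of_eq (lintegral_congr fun y => ?_)) h)
  rw [← ofReal_norm, ← ofReal_norm, ← ENNReal.ofReal_pow (norm_nonneg _), Complex.norm_real, ← norm_pow, ← Real.exp_nat_mul]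
  have e : ((2:ℕ):ℝ) * (-(sq1 y / 4)) = -(1/2) * ∑ i, y i ^ 2 := by unfold sq1; push_cast; ring
  rw [e]

end PartTwelve
end ManyBodyWaveguide

namespace ManyBodyWaveguide
section PartThirteen
variable {m n N : ℕ}

lemma approx_weighted (α : Fin N) (w : L2 m n N) {ε : ℝ} (hε : 0 < ε) :
    ∃ (s : Finset ((Fin N → Fin m → ℝ) × (Fin N → Fin n → ℤ))) (c : (Fin N → Fin m → ℝ) × (Fin N → Fin n → ℤ) → ℂ)
      (h : MemLp (fun x : Cfg m n N => ∑ p ∈ s, c p * ((Wp α x : ℂ) * chr p.1 p.2 x)) 2 volume), ‖w - h.toLp _‖ < ε := by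
  obtain ⟨g, hg, hlt⟩ := approx_span (wchr_dense (Wp_memLp (m := m) (n := n) α) (fun x => Real.exp_pos _)) w hε
  obtain ⟨c, hc⟩ := (Finsupp.mem_span_range_iff_exists_finsupp).1 hg
  obtain ⟨h, e⟩ := sum_toLp c.support c (fun p x => (Wp α x : ℂ) * chr p.1 p.2 x) (fun p => wchr_memLp (Wp_memLp α) p.1 p.2)
  refine ⟨c.support, c, h, ?_⟩
  rw [← e]
  have : g = ∑ p ∈ c.support, c p • (wchr_memLp (Wp_memLp (m := m) (n := n) α) p.1 p.2).toLp _ := by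
    rw [← hc]; rfl
  rw [← this]
  exact hlt

/-- Gaussian weight in one Euclidean variable -/
def ga (y : Fin m → ℝ) : ℂ := -((Real.exp (-(sq1 y / 4)) : ℝ) : ℂ)

lemma ga_measurable : Measurable (ga : (Fin m → ℝ) → ℂ) := by
  have : Continuous (ga : (Fin m → ℝ) → ℂ) :=
    (Complex.continuous_ofReal.comp (Real.continuous_exp.comp (sq1_continuous.div_const 4).neg)).neg
  exact this.measurable

lemma ga_le (y : Fin m → ℝ) : ‖ga y‖ₑ ≤ 1 := by
  rw [← ofReal_norm, ga, norm_neg, Complex.norm_real, Real.norm_eq_abs, Real.abs_exp, ← ENNReal.ofReal_one]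
  refine ENNReal.ofReal_le_ofReal (Real.exp_le_one_iff.2 ?_)
  have := sq1_nonneg y
  linarith

lemma gaK : (∫⁻ y : Fin m → ℝ, ‖ga y‖ₑ ^ 2) ≠ ∞ := by
  have := gaussK (m := m)
  unfold ga
  simpa only [enorm_neg] using this

lemma approx_core (α : Fin N) {u : Cfg m n N → ℂ} (hu : Measurable u)
    (hw : MemLp (fun x => ((Real.exp (sq1 (x α).1 / 4) : ℝ) : ℂ) * u x) 2) {ε : ℝ} (hε : 0 < ε) :
    ∃ (s : Finset ((Fin N → Fin m → ℝ) × (Fin N → Fin n → ℤ))) (c : (Fin N → Fin m → ℝ) × (Fin N → Fin n → ℤ) → ℂ)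
      (D : Cfg m n N → ℂ), Measurable D ∧ (∀ x, Fs s c 0 x = u x + ga (x α).1 * D x) ∧
        (∫⁻ x, ‖D x‖ₑ ^ 2) ^ (1/2:ℝ) ≤ ENNReal.ofReal ε := by
  obtain ⟨s, c, h, hlt⟩ := approx_weighted α (hw.toLp _) hε
  have hW : Continuous (Wp α : Cfg m n N → ℝ) :=
    Real.continuous_exp.comp ((continuous_const.mul SS_continuous).add ((sq1a_continuous α).div_const 4))
  have hGc : Continuous (fun x : Cfg m n N => ∑ p ∈ s, c p * ((Wp α x : ℂ) * chr p.1 p.2 x)) :=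
    continuous_finsetSum _ fun p _ => continuous_const.mul ((Complex.continuous_ofReal.comp hW).mul (chr_continuous p.1 p.2))
  have he : Continuous fun x : Cfg m n N => ((Real.exp (sq1 (x α).1 / 4) : ℝ) : ℂ) :=
    Complex.continuous_ofReal.comp (Real.continuous_exp.comp ((sq1a_continuous α).div_const 4))
  refine ⟨s, fun p => c p * ((Real.exp (-(∑ β, ∑ i, p.1 β i ^ 2 / 2)) : ℝ) : ℂ),
    fun x => ((Real.exp (sq1 (x α).1 / 4) : ℝ) : ℂ) * u x - ∑ p ∈ s, c p * ((Wp α x : ℂ) * chr p.1 p.2 x),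
    (he.measurable.mul hu).sub hGc.measurable, fun x => ?_, ?_⟩
  · have e1 : ga (x α).1 * (((Real.exp (sq1 (x α).1 / 4) : ℝ) : ℂ) * u x) = - u x := by
      rw [← mul_assoc, ga, neg_mul, ← Complex.ofReal_mul, ← Real.exp_add]
      simp
    rw [mul_sub, e1, Finset.mul_sum, Fs, ← sub_eq_zero]
    have e2 : ∀ p ∈ s, c p * ((Real.exp (-(∑ β, ∑ i, p.1 β i ^ 2 / 2)) : ℝ) : ℂ) * Pk 0 p.1 p.2 x =
        - (ga (x α).1 * (c p * ((Wp α x : ℂ) * chr p.1 p.2 x))) := fun p _ => by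
      have e3 : ((Real.exp (-(∑ β, ∑ i, p.1 β i ^ 2 / 2)) : ℝ) : ℂ) * ((Real.exp (∑ β, ∑ i, p.1 β i ^ 2 / 2) : ℝ) : ℂ) = 1 := by
        rw [← Complex.ofReal_mul, ← Real.exp_add]; simp
      have e4 : ((Real.exp (-(sq1 (x α).1 / 4)) : ℝ) : ℂ) * (Wp α x : ℂ) = ((Real.exp (-(1/2) * SS x) : ℝ) : ℂ) := by
        rw [Wp, ← Complex.ofReal_mul, ← Real.exp_add]
        congr 2; ring
      rw [Pk_zero, ga, ← e4]
      linear_combination (c p * ((Real.exp (-(sq1 (x α).1 / 4)) : ℝ) : ℂ) * (Wp α x : ℂ) * chr p.1 p.2 x) * e3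
    rw [Finset.sum_congr rfl e2, Finset.sum_neg_distrib]
    ring
  · rw [← MemLp.toLp_sub] at hlt
    have e := enorm_sq_toLp (hw.sub h)
    have e' : (∫⁻ x, ‖((Real.exp (sq1 (x α).1 / 4) : ℝ) : ℂ) * u x - ∑ p ∈ s, c p * ((Wp α x : ℂ) * chr p.1 p.2 x)‖ₑ ^ 2) =
      ‖(hw.sub h).toLp _‖ₑ ^ 2 := e.symm
    rw [e', half_sq', ← ofReal_norm]
    exact ENNReal.ofReal_le_ofReal hlt.le

variable {U : ℝ → L2 m n N →L[ℂ] L2 m n N}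

lemma stepB (hU : IsPropagator m n N 0 U) (α : Fin N) {t : ℝ} (ht : t ≠ 0) {E F : Set (Fin m → ℝ)} (hE : MeasurableSet E)
    (hF : MeasurableSet F) (hEv : volume E ≠ ∞) {R : ℝ} (hR : ∀ y ∈ F, sq1 y ≤ R) (f : L2 m n N) :
    ‖PE volume (slab n α E) (slab_meas α hE) (U t (PE volume (slab n α F) (slab_meas α hF) f))‖ₑ ≤
      (volume E ^ (1/2:ℝ) * ENNReal.ofReal ((1 / |t|) ^ ((m:ℝ) / 2))) *
        (volume F ^ (1/2:ℝ) * ‖PE volume (slab n α F) (slab_meas α hF) f‖ₑ) := by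
  set u : Cfg m n N → ℂ := (slab n α F).indicator f with hu
  have hum : Measurable u := (Lp.stronglyMeasurable f).measurable.indicator (slab_meas α hF)
  have huL : MemLp u 2 := (Lp.memLp f).indicator (slab_meas α hF)
  have hpe : PE volume (slab n α F) (slab_meas α hF) f = huL.toLp u := rfl
  have he : Continuous fun x : Cfg m n N => ((Real.exp (sq1 (x α).1 / 4) : ℝ) : ℂ) :=
    Complex.continuous_ofReal.comp (Real.continuous_exp.comp ((sq1a_continuous α).div_const 4))
  have hw : MemLp (fun x => ((Real.exp (sq1 (x α).1 / 4) : ℝ) : ℂ) * u x) 2 := by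
    refine MemLp.of_le_mul (c := Real.exp (R / 4)) huL (he.measurable.mul hum).aestronglyMeasurable
      (Filter.Eventually.of_forall fun x => ?_)
    by_cases hx : x ∈ slab n α F
    · rw [norm_mul, Complex.norm_real, Real.norm_eq_abs, Real.abs_exp]
      have := hR _ hx
      exact mul_le_mul_of_nonneg_right (Real.exp_le_exp.2 (by linarith)) (norm_nonneg _)
    · simp [hu, hx]
  have hunorm : (∫⁻ x, ‖u x‖ₑ ^ 2) ^ (1/2:ℝ) = ‖huL.toLp u‖ₑ := by
    rw [← enorm_sq_toLp huL, half_sq']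
  rw [hpe]
  refine pos_eps (K := (∫⁻ y : Fin m → ℝ, ‖ga y‖ₑ ^ 2) ^ (1/2:ℝ))
    (ENNReal.mul_ne_top (ENNReal.rpow_ne_top_of_nonneg (by norm_num) hEv) ENNReal.ofReal_ne_top)
    (ENNReal.rpow_ne_top_of_nonneg (by norm_num) gaK) fun ε hε => ?_
  obtain ⟨s, c, D, hD, hFs, hDe⟩ := approx_core α hum hw hε
  have hgm : Measurable fun x : Cfg m n N => ga (x α).1 := ga_measurable.comp ((measurable_pi_apply α).fst)
  have h1 : ∫⁻ y, GG α (Fs s c 0) y ≤ volume F ^ (1/2:ℝ) * ‖huL.toLp u‖ₑ +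
      (∫⁻ y : Fin m → ℝ, ‖ga y‖ₑ ^ 2) ^ (1/2:ℝ) * ENNReal.ofReal ε := by
    have e1 : Fs s c 0 = fun x => u x + ga (x α).1 * D x := funext hFs
    have hgD : Measurable fun x : Cfg m n N => ga (x α).1 * D x := hgm.mul hD
    rw [e1]
    refine (lintegral_mono fun y => GG_add α hum hgD y).trans ?_
    rw [lintegral_add_left (GG_measurable α hum)]
    refine add_le_add ?_ ((GG_wt α ga_measurable hD).trans (mul_le_mul_right hDe _))
    have e2 : u = fun x => (F.indicator (fun _ => (1:ℂ)) : (Fin m → ℝ) → ℂ) (x α).1 * u x := by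
      ext x
      by_cases hx : (x α).1 ∈ F
      · simp [hx]
      · have : x ∉ slab n α F := hx
        simp [hu, this]
    have h2 := GG_wt α (a := F.indicator (fun _ => (1:ℂ))) (measurable_const.indicator hF) hum
    rw [← e2, hunorm] at h2
    refine h2.trans (le_of_eq ?_)
    congr 2
    rw [← lintegral_indicator_one hF]
    refine lintegral_congr fun y => ?_
    by_cases hy : y ∈ F <;> simp [hy]
  have h3 : ‖huL.toLp u - (Fs_memLp s c 0).toLp _‖ₑ ≤ ENNReal.ofReal ε := by
    rw [← MemLp.toLp_sub, ← half_sq' ‖_‖ₑ, enorm_sq_toLp]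
    refine le_trans (ENNReal.rpow_le_rpow (lintegral_mono fun x => ?_) (by norm_num)) hDe
    have : (u - Fs s c 0) x = - (ga (x α).1 * D x) := by
      rw [Pi.sub_apply, hFs]; ring
    rw [this, enorm_neg, enorm_mul, mul_pow]
    calc _ ≤ 1 ^ 2 * ‖D x‖ₑ ^ 2 := mul_le_mul_left (pow_le_pow_left' (ga_le _) 2) _
      _ = _ := by simp
  have e : huL.toLp u = (Fs_memLp s c 0).toLp _ + (huL.toLp u - (Fs_memLp s c 0).toLp _) := by abel
  calc _ = ‖PE volume (slab n α E) (slab_meas α hE) (U t ((Fs_memLp s c 0).toLp _)) +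
        PE volume (slab n α E) (slab_meas α hE) (U t (huL.toLp u - (Fs_memLp s c 0).toLp _))‖ₑ := by
        rw [← map_add, ← map_add, ← e]
    _ ≤ _ := enorm_add_le _ _
    _ ≤ _ := by
        refine add_le_add ((stepA hU α s c ht hE).trans ?_) ((PE_le _ _ _).trans ((U_enorm hU t _).le.trans h3))
        rw [← mul_assoc]
        exact mul_le_mul_right h1 _

lemma stepC (hU : IsPropagator m n N 0 U) (α : Fin N) {t : ℝ} (ht : t ≠ 0) {E F : Set (Fin m → ℝ)} (hE : MeasurableSet E)
    (hF : MeasurableSet F) (hEv : volume E ≠ ∞) (f : L2 m n N) :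
    ‖PE volume (slab n α E) (slab_meas α hE) (U t (PE volume (slab n α F) (slab_meas α hF) f))‖ₑ ≤
      (volume E ^ (1/2:ℝ) * ENNReal.ofReal ((1 / |t|) ^ ((m:ℝ) / 2))) *
        (volume F ^ (1/2:ℝ) * ‖PE volume (slab n α F) (slab_meas α hF) f‖ₑ) := by
  have hB : ∀ R : ℕ, MeasurableSet {y : Fin m → ℝ | sq1 y ≤ R} := fun R => sq1_continuous.measurable measurableSet_Iic
  have hFR : ∀ R : ℕ, MeasurableSet (F ∩ {y : Fin m → ℝ | sq1 y ≤ R}) := fun R => hF.inter (hB R)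
  have hFC : ∀ R : ℕ, MeasurableSet (F \ {y : Fin m → ℝ | sq1 y ≤ R}) := fun R => hF.diff (hB R)
  have hsplit : ∀ R : ℕ, PE volume (slab n α F) (slab_meas α hF) f =
      PE volume (slab n α _) (slab_meas α (hFR R)) f + PE volume (slab n α _) (slab_meas α (hFC R)) f := fun R => by
    refine Lp.ext ?_
    filter_upwards [PE_coe (slab n α F) (slab_meas α hF) f, PE_coe _ (slab_meas α (hFR R)) f, PE_coe _ (slab_meas α (hFC R)) f,
      Lp.coeFn_add (PE volume (slab n α _) (slab_meas α (hFR R)) f) (PE volume (slab n α _) (slab_meas α (hFC R)) f)] with x h1 h2 h3 h4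
    rw [h4, Pi.add_apply, h1, h2, h3]
    by_cases hx : (x α).1 ∈ F <;> by_cases hy : sq1 (x α).1 ≤ R <;> simp [Set.indicator, slab, hx, hy]
  have hmono : ∀ R : ℕ, ‖PE volume (slab n α _) (slab_meas α (hFR R)) f‖ₑ ≤ ‖PE volume (slab n α F) (slab_meas α hF) f‖ₑ := fun R => by
    rw [← half_sq' ‖PE volume (slab n α (F ∩ _)) _ f‖ₑ, ← half_sq' ‖PE volume (slab n α F) _ f‖ₑ, PE_enorm_sq, PE_enorm_sq]
    exact ENNReal.rpow_le_rpow (lintegral_mono_set fun x hx => hx.1) (by norm_num)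
  have htend : Filter.Tendsto (fun R : ℕ => ‖PE volume (slab n α _) (slab_meas α (hFC R)) f‖ₑ) Filter.atTop (nhds 0) := by
    have hfin : (∫⁻ x, ‖f x‖ₑ ^ 2) ≠ ∞ := by
      have h2 := enorm_sq_toLp (Lp.memLp f)
      rw [← h2]; finiteness
    have h0 : Filter.Tendsto (fun R : ℕ => ∫⁻ x, (slab n α (F \ {y : Fin m → ℝ | sq1 y ≤ R})).indicator (fun x => ‖f x‖ₑ ^ 2) x)
        Filter.atTop (nhds (∫⁻ x : Cfg m n N, 0)) := by
      refine tendsto_lintegral_of_dominated_convergence (fun x => ‖f x‖ₑ ^ 2)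
        (fun R => ((Lp.stronglyMeasurable f).measurable.enorm.pow_const 2).indicator (slab_meas α (hFC R)))
        (fun R => Filter.Eventually.of_forall fun x => Set.indicator_le_self _ _ _) hfin
        (Filter.Eventually.of_forall fun x => ?_)
      obtain ⟨R0, hR0⟩ := exists_nat_ge (sq1 (x α).1)
      refine tendsto_const_nhds.congr' ?_
      filter_upwards [Filter.eventually_ge_atTop R0] with R hRR
      have : x ∉ slab n α (F \ {y : Fin m → ℝ | sq1 y ≤ R}) := fun hx =>
        hx.2 (hR0.trans (by exact_mod_cast hRR))
      rw [Set.indicator_of_notMem this]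
    rw [lintegral_zero] at h0
    have h1 := h0.ennrpow_const (1/2:ℝ)
    rw [ENNReal.zero_rpow_of_pos (by norm_num)] at h1
    refine h1.congr fun R => ?_
    rw [lintegral_indicator (slab_meas α (hFC R)), ← PE_enorm_sq _ (slab_meas α (hFC R)), half_sq']
  have hb : ∀ R : ℕ, ‖PE volume (slab n α E) (slab_meas α hE) (U t (PE volume (slab n α F) (slab_meas α hF) f))‖ₑ ≤
      (volume E ^ (1/2:ℝ) * ENNReal.ofReal ((1 / |t|) ^ ((m:ℝ) / 2))) *
        (volume F ^ (1/2:ℝ) * ‖PE volume (slab n α F) (slab_meas α hF) f‖ₑ) + ‖PE volume (slab n α _) (slab_meas α (hFC R)) f‖ₑ := fun R => by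
    conv_lhs => rw [hsplit R, map_add, map_add]
    refine (enorm_add_le _ _).trans (add_le_add ?_ ((PE_le _ _ _).trans (U_enorm hU t _).le))
    refine (stepB hU α ht hE (hFR R) hEv (R := R) (fun y hy => hy.2) f).trans (mul_le_mul_right ?_ _)
    exact mul_le_mul' (ENNReal.rpow_le_rpow (measure_mono Set.inter_subset_left) (by norm_num)) (hmono R)
  have := htend.const_add ((volume E ^ (1/2:ℝ) * ENNReal.ofReal ((1 / |t|) ^ ((m:ℝ) / 2))) *
        (volume F ^ (1/2:ℝ) * ‖PE volume (slab n α F) (slab_meas α hF) f‖ₑ))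
  rw [add_zero] at this
  exact ge_of_tendsto' this hb

lemma PE_inner (S : Set (Cfg m n N)) (hS : MeasurableSet S) (g v : L2 m n N) :
    inner ℂ (PE volume S hS g) v = inner ℂ (PE volume S hS g) (PE volume S hS v) := by
  rw [L2.inner_def, L2.inner_def]
  refine integral_congr_ae ?_
  filter_upwards [PE_coe S hS g, PE_coe S hS v] with x hx hy
  rw [hx, hy]
  by_cases h : x ∈ S <;> simp [h]

lemma half_two (j : ℤ) : (ENNReal.ofReal ((2:ℝ) ^ ((m:ℝ) * j))) ^ (1/2:ℝ) = ENNReal.ofReal (((2:ℝ) ^ (j:ℝ)) ^ ((m:ℝ)/2)) := by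
  rw [ENNReal.ofReal_rpow_of_nonneg (by positivity) (by norm_num), ← Real.rpow_mul (by norm_num), ← Real.rpow_mul (by norm_num)]
  congr 2; ring

theorem disp_all (hm : 3 ≤ m) (hU : IsPropagator m n N 0 U) (α : Fin N) : Disp m 1 U (PP m n N α) where
  m3 := hm
  one_le := le_rfl
  unitary := hU.unitary
  start := fun f => by rw [IsPropagator.init hU]; rfl
  group := fun s t f => by rw [hU.group]; rfl
  cont := U_cont hU
  ne := fun j => ⟨_, ∅, MeasurableSet.empty, by simp, rfl⟩
  proj := by
    rintro j p ⟨E, hE, -, rfl⟩ v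
    exact PE_proj _ _ v
  disp := by
    rintro j k p ⟨E, hE, hEv, rfl⟩ p' ⟨F, hF, hFv, rfl⟩ f g t ht
    rw [PE_inner]
    refine (norm_inner_le_norm _ _).trans ?_
    have h := stepC hU α ht hE hF (ne_top_of_le_ne_top ENNReal.ofReal_ne_top hEv) f
    have h' := h.trans (mul_le_mul' (mul_le_mul_left (ENNReal.rpow_le_rpow hEv (by norm_num : (0:ℝ) ≤ 1/2)) _)
      (mul_le_mul_left (ENNReal.rpow_le_rpow hFv (by norm_num : (0:ℝ) ≤ 1/2)) _))
    rw [half_two, half_two, ← ofReal_norm, ← ofReal_norm, ← ENNReal.ofReal_mul (by positivity), ← ENNReal.ofReal_mul (by positivity),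
      ← ENNReal.ofReal_mul (by positivity), ENNReal.ofReal_le_ofReal_iff (by positivity)] at h'
    have e : ((2:ℝ) ^ ((j:ℝ) + k) / |t|) ^ ((m:ℝ)/2) =
        ((2:ℝ) ^ (j:ℝ)) ^ ((m:ℝ)/2) * (1 / |t|) ^ ((m:ℝ)/2) * ((2:ℝ) ^ (k:ℝ)) ^ ((m:ℝ)/2) := by
      rw [← Real.mul_rpow (by positivity) (by positivity), ← Real.mul_rpow (by positivity) (by positivity), Real.rpow_add (by norm_num)]
      congr 1; ring
    refine (mul_le_mul_of_nonneg_left h' (norm_nonneg _)).trans (le_of_eq ?_)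
    rw [e]; ring

end PartThirteen
end ManyBodyWaveguide

namespace ManyBodyWaveguide

/-- **Lorentz-refined Strichartz estimate with frozen spatial variables for the
free `N`-body propagator** (Proposition 2.3, homogeneous part).  For `m ≥ 3`,
`n ≥ 1`, every `m`-admissible pair `(q,r)` and every index `α`:
`‖e^{itΔ_x}u₀‖_{L^q_t L^{r,2}_{y_α} L^2_{z_α} L^2_{x̂_α}} ≲ ‖u₀‖_{L²_x}`. -/
theorem strichartz_frozen_free (m n N : ℕ) (hm : 3 ≤ m) (hn : 1 ≤ n)
    (hN : 1 ≤ N) (q r : ℝ≥0∞) (hqr : Admissible m q r) (α : Fin N) :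
    ∃ C : ℝ, 0 < C ∧
      ∀ U0 : ℝ → L2 m n N →L[ℂ] L2 m n N, IsPropagator m n N 0 U0 →
        ∀ u0 : L2 m n N,
          frozenNormL q r 2 α (fun t x => (U0 t u0) x) ≤
            ENNReal.ofReal C * (‖u0‖₊ : ℝ≥0∞) := by
  exact final_of_disp hm q r hqr α 1 fun U0 hU => disp_all hm hU α

end ManyBodyWaveguide
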